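/- arXiv:1511.06937 — 5 statements merged into one kernel-verified Lean document; each statement's English description precedes it below -/
import Mathlib

section
/- Let φ ∈ 𝒮(ℝ^d) be a Schwartz function whose Fourier transform ℱφ is supported in {ζ : |ζ|_∞ ≤ 3/4}, and for ε ∈ (0,1] and t ≥ 0 define G^ε_t(x) := ∫_{ℝ^d} ℱφ(εζ) e^{t ε^{−β} ℱμ(εζ)} e^{2πi⟨x,ζ⟩} dζ and G^ε_t := 0 for t < 0, and set |t|_ε := |t|^{1/β} ∨ ε. Then the rescaled function Ḡ^ε_t(x) := |t|_ε^d G^ε_t(|t|_ε x) is Schwartz in x uniformly: for every m ∈ ℕ and every multi-index k̄ ∈ ℕ^d there is a constant C̄ (independent of ε, t and x) such that |D_x^{k̄} Ḡ^ε_t(x)| ≤ C̄ (1 + |x|)^{−m} for all ε ∈ (0,1], all t > 0 and all x ∈ ℝ^d. -/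
noncomputable section

open scoped BigOperators

/-- The Fourier transform `ℱμ(ζ) = Σ_{y∈ℤ^d} μ(y) e^{−2πi⟨y,ζ⟩}` of `μ : ℤ^d → ℝ`. -/
def Fmu (d : ℕ) (μ : (Fin d → ℤ) → ℝ) (ζ : Fin d → ℝ) : ℂ :=
  ∑' y : Fin d → ℤ,
    ((μ y : ℝ) : ℂ) *
      Complex.exp (-2 * (Real.pi : ℂ) * Complex.I * ((∑ i, (y i : ℝ) * ζ i : ℝ) : ℂ))

/-- The Fourier transform `ℱφ(ζ) = ∫ φ(x) e^{−2πi⟨x,ζ⟩} dx` of `φ : ℝ^d → ℝ`. -/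
def Fphi (d : ℕ) (φ : (Fin d → ℝ) → ℝ) (ζ : Fin d → ℝ) : ℂ :=
  ∫ x : Fin d → ℝ,
    ((φ x : ℝ) : ℂ) *
      Complex.exp (-2 * (Real.pi : ℂ) * Complex.I * ((∑ i, x i * ζ i : ℝ) : ℂ))

/-- The (extension off the grid of the) discrete Green's function
`G^ε_t(x) = ∫ ℱφ(εζ) e^{t ε^{−β} ℱμ(εζ)} e^{2πi⟨x,ζ⟩} dζ` for `t ≥ 0`, and `0` for `t < 0`. -/
def Geps (d β : ℕ) (μ : (Fin d → ℤ) → ℝ) (φ : (Fin d → ℝ) → ℝ) (ε : ℝ) (t : ℝ)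
    (x : Fin d → ℝ) : ℝ :=
  if t < 0 then 0 else
    (∫ ζ : Fin d → ℝ,
      Fphi d φ (ε • ζ) *
        Complex.exp (((t * (ε ^ β)⁻¹ : ℝ) : ℂ) * Fmu d μ (ε • ζ)) *
        Complex.exp (2 * (Real.pi : ℂ) * Complex.I * ((∑ i, x i * ζ i : ℝ) : ℂ))).re

/-- The parabolic time scale `|t|_ε = |t|^{1/β} ∨ ε`. -/
def tScale (β : ℕ) (ε t : ℝ) : ℝ := max (|t| ^ ((β:ℝ)⁻¹)) ε

/-- The rescaled Green's function `Ḡ^ε_t(x) = |t|_ε^d G^ε_t(|t|_ε x)`. -/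
def Gbar (d β : ℕ) (μ : (Fin d → ℤ) → ℝ) (φ : (Fin d → ℝ) → ℝ) (ε t : ℝ) :
    (Fin d → ℝ) → ℝ :=
  fun x => tScale β ε t ^ d * Geps d β μ φ ε t (tScale β ε t • x)

/-- The partial derivative `∂_i`. -/
def pderivR {d : ℕ} (i : Fin d) (F : (Fin d → ℝ) → ℝ) : (Fin d → ℝ) → ℝ :=
  fun x => fderiv ℝ F x (Pi.single i 1)

/-- The iterated spatial partial derivative `D_x^{k̄} = ∂_1^{k₁} ⋯ ∂_d^{k_d}`. -/
def pderivMulti {d : ℕ} (k : Fin d → ℕ) (F : (Fin d → ℝ) → ℝ) : (Fin d → ℝ) → ℝ :=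
  ((List.finRange d).foldr (fun i g => (pderivR i)^[k i] ∘ g) id) F

open scoped SchwartzMap FourierTransform ContDiff

section Calculus

variable {E : Type*} [NormedAddCommGroup E] [NormedSpace ℝ E]

theorem norm_iteratedFDeriv_real_exp (i : ℕ) (u : ℝ) :
    ‖iteratedFDeriv ℝ i Real.exp u‖ = Real.exp u := by
  rw [norm_iteratedFDeriv_eq_norm_iteratedDeriv, iteratedDeriv_eq_iterate, Real.iter_deriv_exp,
    Real.norm_eq_abs, Real.abs_exp]

theorem norm_iteratedFDeriv_exp_comp_le {f : E → ℝ} (hf : ContDiff ℝ ∞ f) (x : E) {n : ℕ} {D : ℝ}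
    (h : ∀ i, 1 ≤ i → i ≤ n → ‖iteratedFDeriv ℝ i f x‖ ≤ D ^ i) :
    ‖iteratedFDeriv ℝ n (fun y => Real.exp (f y)) x‖ ≤ n.factorial * Real.exp (f x) * D ^ n :=
  norm_iteratedFDeriv_comp_le (Real.contDiff_exp (n := ∞)) hf (by exact_mod_cast le_top) x
    (fun i _ => (norm_iteratedFDeriv_real_exp i (f x)).le) h

/-- A Taylor bound: if the derivatives of order less than `i + j` vanish at the origin and the one
of order `i + j` is bounded, then the derivative of order `i` grows at most like `‖x‖ ^ j`. -/
theorem norm_iteratedFDeriv_le_of_vanishing {g : E → ℝ} (hg : ContDiff ℝ ∞ g) {β : ℕ} {M : ℝ}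
    (hM : ∀ x, ‖iteratedFDeriv ℝ β g x‖ ≤ M) (h0 : ∀ i < β, iteratedFDeriv ℝ i g 0 = 0) (j : ℕ) :
    ∀ i, i + j = β → ∀ x, ‖iteratedFDeriv ℝ i g x‖ ≤ M * ‖x‖ ^ j := by
  have hM0 : 0 ≤ M := (norm_nonneg _).trans (hM 0)
  induction j with
  | zero =>
    rintro i rfl x
    simpa using hM x
  | succ j ih =>
    intro i hi x
    have hd : Differentiable ℝ (iteratedFDeriv ℝ i g) :=
      hg.differentiable_iteratedFDeriv (by exact_mod_cast WithTop.coe_lt_top i)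
    have key := Convex.norm_image_sub_le_of_norm_fderiv_le (𝕜 := ℝ) (f := iteratedFDeriv ℝ i g)
      (C := M * ‖x‖ ^ j) (s := Metric.closedBall 0 ‖x‖) (x := 0) (y := x)
      (fun y _ => hd y) (fun y hy => ?_) (convex_closedBall _ _) (by simp) (by simp)
    · rw [h0 i (by omega), sub_zero, sub_zero] at key
      rwa [pow_succ, ← mul_assoc]
    · rw [norm_fderiv_iteratedFDeriv]
      refine (ih (i + 1) (by omega) y).trans ?_
      rw [mem_closedBall_zero_iff] at hy
      gcongr

/-- Rescaling `g ↦ θ δ^{-β} g(δ ·)` preserves polynomial bounds on the derivatives of a function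
which vanishes to order `β` at the origin, uniformly in `0 < δ ≤ 1` and `0 ≤ θ ≤ 1`. -/
theorem norm_iteratedFDeriv_rescale_le {g : E → ℝ} (hg : ContDiff ℝ ∞ g) {β : ℕ} {M : ℝ} {i : ℕ}
    (hβ : ∀ x, ‖iteratedFDeriv ℝ β g x‖ ≤ M) (hi : ∀ x, ‖iteratedFDeriv ℝ i g x‖ ≤ M)
    (h0 : ∀ i < β, iteratedFDeriv ℝ i g 0 = 0) {δ θ : ℝ} (hδ : 0 < δ) (hδ1 : δ ≤ 1)
    (hθ : 0 ≤ θ) (hθ1 : θ ≤ 1) (x : E) :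
    ‖iteratedFDeriv ℝ i (fun y => θ * (δ ^ β)⁻¹ * g (δ • y)) x‖ ≤ M * (1 + ‖x‖) ^ β := by
  have hM0 : 0 ≤ M := (norm_nonneg _).trans (hβ 0)
  have hgi : ContDiff ℝ i g := hg.of_le (by exact_mod_cast le_top)
  have hgs : ContDiff ℝ i (fun y => g (δ • y)) := hgi.comp (contDiff_const_smul δ)
  have e : iteratedFDeriv ℝ i (fun y => θ * (δ ^ β)⁻¹ * g (δ • y)) x
      = (θ * (δ ^ β)⁻¹) • δ ^ i • iteratedFDeriv ℝ i g (δ • x) := by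
    have := iteratedFDeriv_const_smul_apply (a := θ * (δ ^ β)⁻¹) (hgs.contDiffAt (x := x))
    rw [iteratedFDeriv_comp_const_smul δ hgi] at this
    exact this
  have h1 : 1 ≤ 1 + ‖x‖ := by linarith [norm_nonneg x]
  rw [e, norm_smul, norm_smul, Real.norm_of_nonneg (by positivity),
    Real.norm_of_nonneg (by positivity)]
  have hb : (δ ^ β)⁻¹ * (δ ^ i * ‖iteratedFDeriv ℝ i g (δ • x)‖) ≤ M * (1 + ‖x‖) ^ β := by
    rw [inv_mul_le_iff₀ (by positivity)]
    rcases le_total β i with h | h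
    · calc δ ^ i * ‖iteratedFDeriv ℝ i g (δ • x)‖ ≤ δ ^ β * M :=
            mul_le_mul (pow_le_pow_of_le_one hδ.le hδ1 h) (hi _) (norm_nonneg _) (by positivity)
        _ ≤ δ ^ β * (M * (1 + ‖x‖) ^ β) := by
            gcongr
            exact le_mul_of_one_le_right hM0 (one_le_pow₀ h1)
    · have h2 := norm_iteratedFDeriv_le_of_vanishing hg hβ h0 (β - i) i (by omega) (δ • x)
      rw [norm_smul, Real.norm_of_nonneg hδ.le, mul_pow] at h2
      calc δ ^ i * ‖iteratedFDeriv ℝ i g (δ • x)‖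
          ≤ δ ^ i * (M * (δ ^ (β - i) * ‖x‖ ^ (β - i))) := by gcongr
        _ = δ ^ β * (M * ‖x‖ ^ (β - i)) := by
            rw [← pow_mul_pow_sub δ h]; ring
        _ ≤ δ ^ β * (M * (1 + ‖x‖) ^ β) := by
            gcongr
            calc ‖x‖ ^ (β - i) ≤ (1 + ‖x‖) ^ (β - i) := by gcongr; linarith
              _ ≤ (1 + ‖x‖) ^ β := pow_le_pow_right₀ h1 (Nat.sub_le _ _)
  calc θ * (δ ^ β)⁻¹ * (δ ^ i * ‖iteratedFDeriv ℝ i g (δ • x)‖)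
      = θ * ((δ ^ β)⁻¹ * (δ ^ i * ‖iteratedFDeriv ℝ i g (δ • x)‖)) := by ring
    _ ≤ 1 * (M * (1 + ‖x‖) ^ β) := by gcongr
    _ = _ := one_mul _

theorem one_add_pow_mul_exp_neg_le {c : ℝ} (hc : 0 < c) (N : ℕ) {r : ℝ} (hr : 0 ≤ r) :
    (1 + r) ^ N * Real.exp (-(c * r)) ≤ N.factorial * Real.exp c / c ^ N := by
  have h := Real.pow_div_factorial_le_exp (c * (1 + r)) (by positivity) N
  rw [div_le_iff₀ (by positivity), mul_pow, mul_add, mul_one, Real.exp_add] at h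
  rw [le_div_iff₀ (by positivity), Real.exp_neg, ← div_eq_mul_inv, div_mul_eq_mul_div,
    div_le_iff₀ (Real.exp_pos _)]
  linarith

/-- Uniform Schwartz bounds for the family `η ↦ e^{θ δ^{-β} g(δη)} Φ(δη)`. -/
theorem exists_bound_exp_rescale_smul (Φ : 𝓢(E, ℂ)) {g : E → ℝ} (hg : ContDiff ℝ ∞ g)
    (hgb : ∀ i, ∃ M, ∀ x, ‖iteratedFDeriv ℝ i g x‖ ≤ M) {β : ℕ}
    (h0 : ∀ i < β, iteratedFDeriv ℝ i g 0 = 0) {K : Set E} (hK : IsClosed K)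
    (hΦ : ∀ x ∉ K, Φ x = 0) {c A : ℝ} (hc : 0 < c) {S : Set (ℝ × ℝ)}
    (hS : ∀ p ∈ S, 0 < p.1 ∧ p.1 ≤ 1 ∧ 0 ≤ p.2 ∧ p.2 ≤ 1)
    (hexp : ∀ p ∈ S, ∀ η : E, p.1 • η ∈ K →
      Real.exp (p.2 * (p.1 ^ β)⁻¹ * g (p.1 • η)) ≤ A * Real.exp (-(c * ‖η‖))) (k n : ℕ) :
    ∃ C, ∀ p ∈ S, ∀ η : E, ‖η‖ ^ k * ‖iteratedFDeriv ℝ n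
      (fun η => Real.exp (p.2 * (p.1 ^ β)⁻¹ * g (p.1 • η)) • Φ (p.1 • η)) η‖ ≤ C := by
  choose M hM using hgb
  choose B hB using fun i => Φ.decay 0 i
  set M' : ℝ := 1 + |M β| + ∑ i ∈ Finset.range (n + 1), |M i| with hM'
  set B' : ℝ := ∑ i ∈ Finset.range (n + 1), B i with hB'
  have hM1 : 1 ≤ M' := by
    have : 0 ≤ ∑ i ∈ Finset.range (n + 1), |M i| := by positivity
    linarith [abs_nonneg (M β)]
  have hMi : ∀ i ≤ n, M i ≤ M' := fun i hi => by
    have := Finset.single_le_sum (f := fun i => |M i|) (fun i _ => abs_nonneg _)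
      (Finset.mem_range.2 (Nat.lt_succ_of_le hi))
    linarith [abs_nonneg (M β), le_abs_self (M i)]
  have hMβ : M β ≤ M' := by
    have : 0 ≤ ∑ i ∈ Finset.range (n + 1), |M i| := by positivity
    linarith [le_abs_self (M β)]
  have hBi : ∀ i ≤ n, B i ≤ B' := fun i hi =>
    Finset.single_le_sum (f := B) (fun i _ => (hB i).1.le)
      (Finset.mem_range.2 (Nat.lt_succ_of_le hi))
  have hB0 : 0 ≤ B' := Finset.sum_nonneg fun i _ => (hB i).1.le
  set L : ℝ := (k + β * n).factorial * Real.exp c / c ^ (k + β * n) with hL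
  have hL0 : 0 ≤ L := by positivity
  refine ⟨2 ^ n * (n.factorial * |A| * M' ^ n * B') * L, ?_⟩
  rintro ⟨δ, θ⟩ hp η
  obtain ⟨hδ, hδ1, hθ, hθ1⟩ := hS _ hp
  specialize hexp _ hp η
  simp only at hδ hδ1 hθ hθ1 hexp ⊢
  by_cases hη : δ • η ∈ K
  · specialize hexp hη
    set f : E → ℝ := fun η => θ * (δ ^ β)⁻¹ * g (δ • η) with hf
    have hfs : ContDiff ℝ ∞ f := contDiff_const.mul (hg.comp (contDiff_const_smul δ))
    have hΦs : ContDiff ℝ ∞ (fun η => Φ (δ • η)) := (Φ.smooth ⊤).comp (contDiff_const_smul δ)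
    set r := ‖η‖ with hr
    have hr0 : 0 ≤ r := norm_nonneg _
    set D : ℝ := M' * (1 + r) ^ β with hD
    have hD1 : 1 ≤ D := one_le_mul_of_one_le_of_one_le hM1 (one_le_pow₀ (by linarith))
    have hfd : ∀ i, 1 ≤ i → i ≤ n → ‖iteratedFDeriv ℝ i f η‖ ≤ D ^ i := fun i h1 hi =>
      (norm_iteratedFDeriv_rescale_le hg (fun x => (hM β x).trans hMβ)
        (fun x => (hM i x).trans (hMi i hi)) h0 hδ hδ1 hθ hθ1 η).trans
        (le_self_pow₀ hD1 (by omega))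
    have hA : Real.exp (f η) ≤ |A| * Real.exp (-(c * r)) :=
      hexp.trans (by gcongr; exact le_abs_self A)
    have hterm : ∀ i ∈ Finset.range (n + 1),
        (n.choose i : ℝ) * ‖iteratedFDeriv ℝ i (fun η => Real.exp (f η)) η‖ *
          ‖iteratedFDeriv ℝ (n - i) (fun η => Φ (δ • η)) η‖ ≤
        n.choose i * (n.factorial * (|A| * Real.exp (-(c * r))) * D ^ n * B') := by
      intro i hi
      have hin : i ≤ n := Nat.lt_succ_iff.1 (Finset.mem_range.1 hi)
      have e1 : ‖iteratedFDeriv ℝ i (fun η => Real.exp (f η)) η‖ ≤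
          n.factorial * (|A| * Real.exp (-(c * r))) * D ^ n :=
        (norm_iteratedFDeriv_exp_comp_le hfs η
          fun j hj1 hj => hfd j hj1 (hj.trans hin)).trans (by
            have : i.factorial ≤ n.factorial := Nat.factorial_le hin
            have : D ^ i ≤ D ^ n := pow_le_pow_right₀ hD1 hin
            gcongr)
      have e2 : ‖iteratedFDeriv ℝ (n - i) (fun η => Φ (δ • η)) η‖ ≤ B' := by
        rw [iteratedFDeriv_comp_const_smul δ (Φ.smooth _), norm_smul,
          Real.norm_of_nonneg (by positivity)]
        have h3 := (hB (n - i)).2 (δ • η)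
        rw [pow_zero, one_mul] at h3
        calc δ ^ (n - i) * ‖iteratedFDeriv ℝ (n - i) Φ (δ • η)‖ ≤ 1 * B' := by
              gcongr
              · exact pow_le_one₀ hδ.le hδ1
              · exact h3.trans (hBi _ (Nat.sub_le _ _))
          _ = B' := one_mul _
      rw [mul_assoc]
      gcongr
    have hmain : ‖iteratedFDeriv ℝ n (fun η => Real.exp (f η) • Φ (δ • η)) η‖ ≤
        2 ^ n * (n.factorial * (|A| * Real.exp (-(c * r))) * D ^ n * B') := by
      refine (norm_iteratedFDeriv_smul_le (hfs.exp) hΦs η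
        (by exact_mod_cast le_top)).trans ((Finset.sum_le_sum hterm).trans ?_)
      rw [← Finset.sum_mul]
      apply le_of_eq
      congr 1
      exact_mod_cast Nat.sum_range_choose n
    calc r ^ k * ‖iteratedFDeriv ℝ n (fun η => Real.exp (f η) • Φ (δ • η)) η‖
        ≤ (1 + r) ^ k * (2 ^ n * (n.factorial * (|A| * Real.exp (-(c * r))) * D ^ n * B')) := by
          gcongr
          linarith
      _ = 2 ^ n * (n.factorial * |A| * M' ^ n * B') *
            ((1 + r) ^ (k + β * n) * Real.exp (-(c * r))) := by
          rw [hD, mul_pow, ← pow_mul, pow_add]; ring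
      _ ≤ 2 ^ n * (n.factorial * |A| * M' ^ n * B') * L := by
          gcongr
          exact one_add_pow_mul_exp_neg_le hc _ hr0
  · have hev : (fun η => Real.exp (θ * (δ ^ β)⁻¹ * g (δ • η)) • Φ (δ • η)) =ᶠ[nhds η]
        fun _ => (0 : ℂ) := by
      filter_upwards [(hK.isOpen_compl.preimage (continuous_const_smul δ)).mem_nhds hη] with y hy
      rw [hΦ _ hy, smul_zero]
    rw [(hev.iteratedFDeriv ℝ n).eq_of_nhds]
    have : iteratedFDeriv ℝ n (fun _ : E => (0 : ℂ)) η = 0 := by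
      simp
    rw [this, norm_zero, mul_zero]
    positivity

end Calculus

section TrigonometricPolynomial

variable {E : Type*} [NormedAddCommGroup E] [NormedSpace ℝ E] {ι : Type*}

theorem contDiff_sum_mul_cos (s : Finset ι) (w : ι → ℝ) (L : ι → E →L[ℝ] ℝ) {n : ℕ∞ω} :
    ContDiff ℝ n fun ζ => ∑ y ∈ s, w y * Real.cos (L y ζ) :=
  ContDiff.sum fun y _ => contDiff_const.mul (Real.contDiff_cos.comp (L y).contDiff)

theorem iteratedFDeriv_sum_mul_cos (s : Finset ι) (w : ι → ℝ) (L : ι → E →L[ℝ] ℝ) (n : ℕ) (ζ : E) :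
    iteratedFDeriv ℝ n (fun ζ => ∑ y ∈ s, w y * Real.cos (L y ζ)) ζ =
      ∑ y ∈ s, w y • (iteratedFDeriv ℝ n Real.cos (L y ζ)).compContinuousLinearMap
        fun _ => L y := by
  have hc : ∀ y, ContDiff ℝ n fun ζ => Real.cos (L y ζ) :=
    fun y => Real.contDiff_cos.comp (L y).contDiff
  rw [iteratedFDeriv_sum fun y _ => contDiff_const.mul (hc y), Finset.sum_apply]
  refine Finset.sum_congr rfl fun y _ => ?_
  rw [← (L y).iteratedFDeriv_comp_right (Real.contDiff_cos (n := n)) ζ le_rfl]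
  exact iteratedFDeriv_const_smul_apply (a := w y) (hc y).contDiffAt

theorem norm_iteratedFDeriv_sum_mul_cos_le (s : Finset ι) (w : ι → ℝ) (L : ι → E →L[ℝ] ℝ) (n : ℕ)
    (ζ : E) : ‖iteratedFDeriv ℝ n (fun ζ => ∑ y ∈ s, w y * Real.cos (L y ζ)) ζ‖ ≤
      ∑ y ∈ s, |w y| * ‖L y‖ ^ n := by
  rw [iteratedFDeriv_sum_mul_cos]
  refine norm_sum_le_of_le _ fun y _ => ?_
  rw [norm_smul, Real.norm_eq_abs]
  gcongr
  refine (ContinuousMultilinearMap.norm_compContinuousLinearMap_le _ _).trans ?_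
  rw [norm_iteratedFDeriv_eq_norm_iteratedDeriv, Real.norm_eq_abs, Finset.prod_const,
    Finset.card_univ, Fintype.card_fin]
  exact mul_le_of_le_one_left (by positivity) (Real.abs_iteratedDeriv_cos_le_one _ _)

theorem iteratedFDeriv_sum_mul_cos_zero (s : Finset ι) (w : ι → ℝ) (L : ι → E →L[ℝ] ℝ) (n : ℕ)
    (h : ∀ v : Fin n → E, ∑ y ∈ s, w y * ∏ j, L y (v j) = 0) :
    iteratedFDeriv ℝ n (fun ζ => ∑ y ∈ s, w y * Real.cos (L y ζ)) 0 = 0 := by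
  rw [iteratedFDeriv_sum_mul_cos]
  ext v
  simp only [map_zero, sum_apply, smul_apply,
    ContinuousMultilinearMap.compContinuousLinearMap_apply,
    iteratedFDeriv_apply_eq_iteratedDeriv_mul_prod, smul_eq_mul, zero_apply]
  simp only [← mul_assoc]
  rw [← Finset.sum_mul, h, zero_mul]

/-- If all moments of order less than `β` vanish, so do the sums of products of fewer than `β`
linear forms. -/
theorem sum_mul_prod_linear_eq_zero {κ : Type*} [Fintype κ] (s : Finset ι) (w : ι → ℝ)
    (z : ι → κ → ℝ) {β n : ℕ} (hn : n < β)
    (h : ∀ l : κ → ℕ, ∑ i, l i < β → ∑ y ∈ s, w y * ∏ i, z y i ^ l i = 0) (c : Fin n → κ → ℝ) :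
    ∑ y ∈ s, w y * ∏ j, ∑ i, z y i * c j i = 0 := by
  classical
  simp only [Finset.prod_univ_sum, Finset.mul_sum]
  rw [Finset.sum_comm]
  refine Finset.sum_eq_zero fun p _ => ?_
  have hcard : ∑ i, Finset.card {j | p j = i} < β := by
    rw [← Finset.card_eq_sum_card_fiberwise (fun j _ => Finset.mem_univ (p j))]
    simpa using hn
  have key := h (fun i => Finset.card {j | p j = i}) hcard
  calc ∑ y ∈ s, w y * ∏ j, z y (p j) * c j (p j)
      = (∑ y ∈ s, w y * ∏ i, z y i ^ Finset.card {j | p j = i}) * ∏ j, c j (p j) := by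
        rw [Finset.sum_mul]
        refine Finset.sum_congr rfl fun y _ => ?_
        rw [Finset.prod_mul_distrib, mul_assoc, ← Finset.prod_fiberwise' _ p]
        simp only [Finset.prod_const]
    _ = 0 := by rw [key, zero_mul]

end TrigonometricPolynomial

theorem exists_clm_pderivMulti {d : ℕ} (k : Fin d → ℕ) :
    ∃ T : 𝓢(Fin d → ℝ, ℝ) →L[ℝ] 𝓢(Fin d → ℝ, ℝ), ∀ F, ⇑(T F) = pderivMulti k ⇑F := by
  have hone : ∀ (i : Fin d) (n : ℕ), ∃ T : 𝓢(Fin d → ℝ, ℝ) →L[ℝ] 𝓢(Fin d → ℝ, ℝ),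
      ∀ F, ⇑(T F) = (pderivR i)^[n] ⇑F := by
    intro i n
    induction n with
    | zero => exact ⟨.id ℝ _, fun F => rfl⟩
    | succ n ih =>
      obtain ⟨T, hT⟩ := ih
      refine ⟨(LineDeriv.lineDerivOpCLM ℝ 𝓢(Fin d → ℝ, ℝ) (Pi.single i (1 : ℝ) : Fin d → ℝ)).comp T,
        fun F => ?_⟩
      ext x
      rw [Function.iterate_succ_apply', ← hT]
      exact SchwartzMap.lineDerivOp_apply_eq_fderiv _ _ _
  unfold pderivMulti
  induction List.finRange d with
  | nil => exact ⟨.id ℝ _, fun F => rfl⟩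
  | cons i l ih =>
    obtain ⟨T, hT⟩ := ih
    obtain ⟨U, hU⟩ := hone i (k i)
    refine ⟨U.comp T, fun F => ?_⟩
    rw [List.foldr_cons, Function.comp_apply, ← hT, ← hU]
    rfl

theorem Fmu_re_eq_sum {d : ℕ} {μ : (Fin d → ℤ) → ℝ} {s : Finset (Fin d → ℤ)} (hs : ∀ y ∉ s, μ y = 0)
    (ζ : Fin d → ℝ) : (Fmu d μ ζ).re =
      ∑ y ∈ s, μ y * Real.cos (2 * Real.pi * ∑ i, (y i : ℝ) * ζ i) := by
  unfold Fmu
  rw [tsum_eq_sum (s := s) fun y hy => by rw [hs y hy]; simp, Complex.re_sum]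
  refine Finset.sum_congr rfl fun y _ => ?_
  rw [Complex.re_ofReal_mul,
    show -2 * (Real.pi : ℂ) * Complex.I * ((∑ i, (y i : ℝ) * ζ i : ℝ) : ℂ) =
      ((-(2 * Real.pi * ∑ i, (y i : ℝ) * ζ i) : ℝ) : ℂ) * Complex.I by push_cast; ring,
    Complex.exp_ofReal_mul_I_re, Real.cos_neg]

theorem tScale_pos (β : ℕ) {ε : ℝ} (hε : 0 < ε) (t : ℝ) : 0 < tScale β ε t :=
  lt_max_of_lt_right hε

/-- The range of the parameters `(ε / |t|_ε, t / |t|_ε ^ β)`. -/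
def scaleParams : Set (ℝ × ℝ) :=
  {p | (0 < p.1 ∧ p.1 ≤ 1 ∧ p.2 = 1) ∨ (p.1 = 1 ∧ 0 ≤ p.2 ∧ p.2 ≤ 1)}

theorem mem_scaleParams {β : ℕ} (hβ : 0 < β) {ε t : ℝ} (hε : 0 < ε) (ht : 0 < t) :
    (ε / tScale β ε t, t / tScale β ε t ^ β) ∈ scaleParams := by
  have hpow : (t ^ ((β : ℝ)⁻¹)) ^ β = t := Real.rpow_inv_natCast_pow ht.le hβ.ne'
  have h0 : 0 < t ^ ((β : ℝ)⁻¹) := Real.rpow_pos_of_pos ht _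
  unfold tScale
  rw [abs_of_pos ht]
  rcases le_total ε (t ^ ((β : ℝ)⁻¹)) with h | h
  · rw [max_eq_left h, hpow]
    exact .inl ⟨by positivity, (div_le_one h0).2 h, div_self ht.ne'⟩
  · rw [max_eq_right h]
    refine .inr ⟨div_self hε.ne', by positivity, (div_le_one (by positivity)).2 ?_⟩
    calc t = (t ^ ((β : ℝ)⁻¹)) ^ β := hpow.symm
      _ ≤ ε ^ β := by gcongr

theorem Gbar_eq_integral (d : ℕ) {β : ℕ} (μ : (Fin d → ℤ) → ℝ) (φ : (Fin d → ℝ) → ℝ) {ε t : ℝ}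
    (hε : 0 < ε) (ht : 0 < t) (x : Fin d → ℝ) :
    Gbar d β μ φ ε t x = (∫ ζ : Fin d → ℝ, Fphi d φ ((ε / tScale β ε t) • ζ) *
      Complex.exp (((t / tScale β ε t ^ β * ((ε / tScale β ε t) ^ β)⁻¹ : ℝ) : ℂ) *
        Fmu d μ ((ε / tScale β ε t) • ζ)) *
      Complex.exp (2 * (Real.pi : ℂ) * Complex.I * ((∑ i, x i * ζ i : ℝ) : ℂ))).re := by
  unfold Gbar Geps
  have hs := tScale_pos β hε t
  set s := tScale β ε t
  rw [if_neg ht.not_gt]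
  set f : (Fin d → ℝ) → ℂ := fun ζ => Fphi d φ ((ε / s) • ζ) *
      Complex.exp (((t / s ^ β * ((ε / s) ^ β)⁻¹ : ℝ) : ℂ) * Fmu d μ ((ε / s) • ζ)) *
      Complex.exp (2 * (Real.pi : ℂ) * Complex.I * ((∑ i, x i * ζ i : ℝ) : ℂ))
  have hf := MeasureTheory.Measure.integral_comp_smul MeasureTheory.volume f s
  have h1 : ε / s * s = ε := div_mul_cancel₀ _ hs.ne'
  have h2 : t / s ^ β * ((ε / s) ^ β)⁻¹ = t * (ε ^ β)⁻¹ := by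
    rw [div_pow]
    field_simp
  have h3 : ∀ ζ : Fin d → ℝ, ∑ i, x i * (s • ζ) i = ∑ i, (s • x) i * ζ i := fun ζ =>
    Finset.sum_congr rfl fun i _ => by simp only [Pi.smul_apply, smul_eq_mul]; ring
  have h4 : (fun ζ => f (s • ζ)) = fun ζ => Fphi d φ (ε • ζ) *
      Complex.exp (((t * (ε ^ β)⁻¹ : ℝ) : ℂ) * Fmu d μ (ε • ζ)) *
      Complex.exp (2 * (Real.pi : ℂ) * Complex.I * ((∑ i, (s • x) i * ζ i : ℝ) : ℂ)) := by
    funext ζ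
    simp only [f, smul_smul, h1, h2, h3]
  rw [h4] at hf
  rw [hf, Module.finrank_fin_fun, abs_of_pos (by positivity), Complex.smul_re, smul_eq_mul,
    mul_inv_cancel_left₀ (by positivity)]

theorem integral_euclideanSpace_comp_ofLp {d : ℕ} (f : (Fin d → ℝ) → ℂ) :
    ∫ ζ : EuclideanSpace ℝ (Fin d), f ζ.ofLp = ∫ ζ, f ζ :=
  (EuclideanSpace.volume_preserving_symm_measurableEquiv_toLp (Fin d)).integral_comp' f

theorem exists_schwartz_eq_Fphi {d : ℕ} (φ : 𝓢(Fin d → ℝ, ℝ)) :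
    ∃ Φ : 𝓢(EuclideanSpace ℝ (Fin d), ℂ), ∀ ζ, Φ ζ = Fphi d φ ζ.ofLp := by
  refine ⟨𝓕 (SchwartzMap.postcompCLM Complex.ofRealCLM
    (SchwartzMap.compCLMOfContinuousLinearEquiv ℝ
      (PiLp.continuousLinearEquiv 2 ℝ fun _ : Fin d => ℝ) φ)), fun ζ => ?_⟩
  rw [SchwartzMap.fourier_coe, Real.fourier_eq', Fphi, ← integral_euclideanSpace_comp_ofLp]
  congr 1
  funext x
  have : inner ℝ x ζ = ∑ i, x.ofLp i * ζ.ofLp i := by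
    simp [PiLp.inner_apply, mul_comm]
  rw [this, smul_eq_mul, mul_comm]
  congr 2
  push_cast
  ring

theorem re_fourierInv_eq_integral {d : ℕ} (H : 𝓢(EuclideanSpace ℝ (Fin d), ℂ)) (x : Fin d → ℝ) :
    (𝓕⁻ H : 𝓢(EuclideanSpace ℝ (Fin d), ℂ)) (WithLp.toLp 2 x) =
      ∫ ζ : Fin d → ℝ, H (WithLp.toLp 2 ζ) *
        Complex.exp (2 * (Real.pi : ℂ) * Complex.I * ((∑ i, x i * ζ i : ℝ) : ℂ)) := by
  rw [SchwartzMap.fourierInv_coe, Real.fourierInv_eq', ← integral_euclideanSpace_comp_ofLp]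
  congr 1
  funext ζ
  have : inner ℝ ζ (WithLp.toLp 2 x) = ∑ i, x i * ζ.ofLp i := by
    simp [PiLp.inner_apply]
  rw [this, smul_eq_mul, mul_comm]
  congr 2
  push_cast
  ring

/-- A negative function, homogeneous of degree `β`, is bounded by `-c ‖ζ‖ ^ β`. -/
theorem exists_pos_le_neg_mul_norm_pow {E : Type*} [NormedAddCommGroup E] [NormedSpace ℝ E]
    [FiniteDimensional ℝ E] {β : ℕ} (hβ : 0 < β) {a : E → ℝ} (ha : Continuous a)
    (hom : ∀ c : ℝ, 0 < c → ∀ ζ, a (c • ζ) = c ^ β * a ζ) (hneg : ∀ ζ, ζ ≠ 0 → a ζ < 0) :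
    ∃ c, 0 < c ∧ ∀ ζ, a ζ ≤ -(c * ‖ζ‖ ^ β) := by
  have := FiniteDimensional.proper ℝ E
  obtain ⟨c, hc, hle⟩ := (isCompact_sphere (0 : E) 1).exists_forall_le' (f := fun ζ => -a ζ)
    (a := 0) ha.neg.continuousOn fun ζ hζ =>
      neg_pos.2 (hneg ζ (ne_zero_of_mem_unit_sphere ⟨ζ, hζ⟩))
  refine ⟨c, hc, fun ζ => ?_⟩
  by_cases h : ζ = 0
  · have h2 := hom 2 two_pos 0
    rw [smul_zero] at h2
    have h3 : (1 : ℝ) < 2 ^ β := one_lt_pow₀ one_lt_two hβ.ne'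
    have h4 : a 0 = 0 := by
      by_contra h5
      exact h3.ne (mul_right_cancel₀ h5 (by rwa [one_mul]))
    rw [h, h4, norm_zero, zero_pow hβ.ne', mul_zero, neg_zero]
  · have hp : 0 < ‖ζ‖ := norm_pos_iff.2 h
    have h1 := hle (‖ζ‖⁻¹ • ζ) (by simp [norm_smul, hp.ne'])
    have h2 := hom ‖ζ‖ hp (‖ζ‖⁻¹ • ζ)
    rw [smul_smul, mul_inv_cancel₀ hp.ne', one_smul] at h2
    rw [h2]
    nlinarith [pow_pos hp β]

theorem Fmu_re_symbol {d β : ℕ} {rhat : ℝ} {μ : (Fin d → ℤ) → ℝ}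
    (hμsupp : ∀ y : Fin d → ℤ, rhat < ‖y‖ → μ y = 0)
    (hμmom : ∀ l : Fin d → ℕ, (∑ i, l i) < β →
      ∑' y : Fin d → ℤ, μ y * ∏ i, (y i : ℝ) ^ (l i) = 0) :
    let g : EuclideanSpace ℝ (Fin d) → ℝ := fun ζ => (Fmu d μ ζ.ofLp).re
    ContDiff ℝ ∞ g ∧ (∀ i, ∃ M, ∀ x, ‖iteratedFDeriv ℝ i g x‖ ≤ M) ∧
      ∀ i < β, iteratedFDeriv ℝ i g 0 = 0 := by
  intro g
  have hfin : (Metric.closedBall (0 : Fin d → ℤ) rhat).Finite :=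
    (isCompact_closedBall _ _).finite_of_discrete
  set s := hfin.toFinset with hs_def
  have hs : ∀ y ∉ s, μ y = 0 := fun y hy => hμsupp y <| by
    simpa [hs_def] using hy
  let L : (Fin d → ℤ) → EuclideanSpace ℝ (Fin d) →L[ℝ] ℝ :=
    fun y => ∑ i, ((y i : ℝ) * (2 * Real.pi)) • EuclideanSpace.proj i
  have hL : ∀ y ζ, L y ζ = ∑ i, (y i : ℝ) * (2 * Real.pi * ζ.ofLp i) := fun y ζ => by
    simp [L, mul_assoc]
  have hg : g = fun ζ => ∑ y ∈ s, μ y * Real.cos (L y ζ) := by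
    funext ζ
    simp only [g, Fmu_re_eq_sum hs, hL, Finset.mul_sum]
    simp only [mul_left_comm]
  rw [hg]
  refine ⟨contDiff_sum_mul_cos s μ L, fun i => ⟨_, norm_iteratedFDeriv_sum_mul_cos_le s μ L i⟩,
    fun n hn => iteratedFDeriv_sum_mul_cos_zero s μ L n fun v => ?_⟩
  simp only [hL]
  refine sum_mul_prod_linear_eq_zero s μ (fun y i => (y i : ℝ)) hn (fun l hl => ?_)
    (fun j i => 2 * Real.pi * (v j).ofLp i)
  rw [← hμmom l hl, tsum_eq_sum fun y hy => by rw [hs y hy, zero_mul]]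

/-- The exponential factor decays uniformly on the support of the rescaled cut-off. -/
theorem exists_exp_rescale_le {d β : ℕ} (hβ : 0 < β) {a : (Fin d → ℝ) → ℝ} (ha : Continuous a)
    (hom : ∀ c : ℝ, 0 < c → ∀ ζ : Fin d → ℝ, a (c • ζ) = c ^ β * a ζ)
    (hneg : ∀ ζ : Fin d → ℝ, ζ ≠ 0 → a ζ < 0) {cbar : ℝ} (hcbar : 0 < cbar)
    {g : EuclideanSpace ℝ (Fin d) → ℝ} {ρ : ℝ} (hg : ∀ ζ, ‖ζ.ofLp‖ ≤ ρ → g ζ ≤ cbar * a ζ.ofLp) :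
    ∃ c A : ℝ, 0 < c ∧ ∀ p ∈ scaleParams, ∀ η : EuclideanSpace ℝ (Fin d),
      p.1 • η ∈ {ζ : EuclideanSpace ℝ (Fin d) | ‖ζ.ofLp‖ ≤ ρ} →
      Real.exp (p.2 * (p.1 ^ β)⁻¹ * g (p.1 • η)) ≤ A * Real.exp (-(c * ‖η‖)) := by
  obtain ⟨c, hc, hle⟩ := exists_pos_le_neg_mul_norm_pow (E := EuclideanSpace ℝ (Fin d)) hβ
    (a := fun ζ => cbar * a ζ.ofLp)
    (continuous_const.mul (ha.comp (PiLp.continuous_ofLp 2 _)))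
    (fun c hc ζ => by rw [WithLp.ofLp_smul, hom c hc]; ring)
    (fun ζ hζ => mul_neg_of_pos_of_neg hcbar (hneg _ (by simpa using hζ)))
  let e := (PiLp.continuousLinearEquiv 2 ℝ fun _ : Fin d => ℝ).symm
  set R : ℝ := ‖(e : (Fin d → ℝ) →L[ℝ] EuclideanSpace ℝ (Fin d))‖ * |ρ| with hR
  have hR0 : 0 ≤ R := by positivity
  refine ⟨c, Real.exp (c * (1 + R)), hc, ?_⟩
  rintro ⟨δ, θ⟩ hp η hη
  rw [← Real.exp_add]
  refine Real.exp_le_exp.2 ?_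
  have hη0 := norm_nonneg η
  have hgη := hg _ hη
  rcases hp with ⟨hδ, -, hθ⟩ | ⟨hδ, hθ, -⟩
  · simp only at hδ hθ hη hgη ⊢
    subst hθ
    have h1 : ‖η‖ ≤ 1 + ‖η‖ ^ β := by
      rcases le_total ‖η‖ 1 with h | h
      · linarith [pow_nonneg hη0 β]
      · linarith [le_self_pow₀ h hβ.ne']
    rw [WithLp.ofLp_smul, hom δ hδ] at hgη
    have h2 : (δ ^ β)⁻¹ * g (δ • η) ≤ -(c * ‖η‖ ^ β) := by
      rw [inv_mul_le_iff₀ (by positivity)]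
      refine hgη.trans ?_
      rw [mul_left_comm]
      have := hle η
      gcongr
    rw [one_mul]
    nlinarith [mul_nonneg hc.le hR0]
  · simp only at hδ hθ hη hgη ⊢
    subst hδ
    rw [one_smul] at hη hgη ⊢
    have h1 : ‖η‖ ≤ R := by
      have := (e : (Fin d → ℝ) →L[ℝ] EuclideanSpace ℝ (Fin d)).le_opNorm η.ofLp
      refine (show ‖η‖ ≤ _ from this).trans ?_
      rw [hR]
      gcongr
      exact (show ‖η.ofLp‖ ≤ ρ from hη).trans (le_abs_self ρ)
    have h2 : g η ≤ 0 := (hgη.trans (hle η)).trans (neg_nonpos.2 (by positivity))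
    rw [one_pow, inv_one, mul_one]
    nlinarith [mul_nonpos_of_nonneg_of_nonpos hθ h2]

/-- **Uniform Schwartz bounds for the rescaled discrete Green's function** (part of
Lemma 5.4 in the paper).  Under the stated assumptions on `a`, `μ` and `φ`, for every `m ∈ ℕ`
and every spatial multi-index `k̄` there is a constant `C̄`, independent of `ε ∈ (0,1]`,
`t > 0` and `x`, such that `|D_x^{k̄} Ḡ^ε_t(x)| ≤ C̄ (1+|x|)^{−m}`. -/
theorem rescaled_green_function_schwartz
    (d β : ℕ) (hd : 1 ≤ d) (hβpos : 0 < β) (hβeven : Even β)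
    (a : (Fin d → ℝ) → ℝ) (ha_cont : Continuous a)
    (ha_hom : ∀ c : ℝ, 0 < c → ∀ ζ : Fin d → ℝ, a (c • ζ) = c ^ β * a ζ)
    (ha_neg : ∀ ζ : Fin d → ℝ, ζ ≠ 0 → a ζ < 0)
    (rhat : ℝ) (μ : (Fin d → ℤ) → ℝ)
    (hμsupp : ∀ y : Fin d → ℤ, rhat < ‖y‖ → μ y = 0)
    (hμmom : ∀ l : Fin d → ℕ, (∑ i, l i) < β →
      ∑' y : Fin d → ℤ, μ y * ∏ i, (y i : ℝ) ^ (l i) = 0)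
    (hμreal : ∀ ζ : Fin d → ℝ, (Fmu d μ ζ).im = 0)
    (cbar : ℝ) (hcbar : 0 < cbar)
    (hμbound : ∀ ζ : Fin d → ℝ, ‖ζ‖ ≤ 3/4 → (Fmu d μ ζ).re ≤ cbar * a ζ)
    (φ : SchwartzMap (Fin d → ℝ) ℝ)
    (hφsupp : ∀ ζ : Fin d → ℝ, ¬(‖ζ‖ ≤ 3/4) → Fphi d (⇑φ) ζ = 0) :
    ∀ m : ℕ, ∀ kb : Fin d → ℕ,
      ∃ C : ℝ, 0 < C ∧
        ∀ ε : ℝ, 0 < ε → ε ≤ 1 → ∀ t : ℝ, 0 < t → ∀ x : Fin d → ℝ,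
          |pderivMulti kb (Gbar d β μ (⇑φ) ε t) x| ≤ C * ((1 + ‖x‖) ^ m)⁻¹ := by
  intro m kb
  set E := EuclideanSpace ℝ (Fin d)
  set g : E → ℝ := fun ζ => (Fmu d μ ζ.ofLp).re
  obtain ⟨hgs, hgb, hg0⟩ := Fmu_re_symbol hμsupp hμmom
  obtain ⟨Φ, hΦ⟩ := exists_schwartz_eq_Fphi φ
  obtain ⟨c, A, hc, hexp⟩ := exists_exp_rescale_le hβpos ha_cont ha_hom ha_neg hcbar
    (g := g) (ρ := 3 / 4) fun ζ hζ => hμbound _ hζ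
  have hK : IsClosed {ζ : E | ‖ζ.ofLp‖ ≤ 3 / 4} :=
    isClosed_le (PiLp.continuous_ofLp 2 _).norm continuous_const
  have hbd := exists_bound_exp_rescale_smul Φ hgs hgb hg0 hK
    (fun ζ hζ => (hΦ ζ).trans (hφsupp _ hζ)) hc (S := scaleParams)
    (by
      rintro p (⟨h1, h2, h3⟩ | ⟨h1, h2, h3⟩)
      · exact ⟨h1, h2, h3 ▸ zero_le_one, h3.le⟩
      · exact ⟨h1 ▸ one_pos, h1.le, h2, h3⟩) hexp
  set h : ℝ × ℝ → E → ℂ :=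
    fun p η => Real.exp (p.2 * (p.1 ^ β)⁻¹ * g (p.1 • η)) • Φ (p.1 • η)
  have hsmooth : ∀ p, ContDiff ℝ ∞ (h p) := fun p =>
    (contDiff_const.mul (hgs.comp (contDiff_const_smul p.1))).exp.smul
      ((Φ.smooth ⊤).comp (contDiff_const_smul p.1))
  let H : scaleParams → 𝓢(E, ℂ) := fun p =>
    ⟨h p, hsmooth p, fun k n => (hbd k n).imp fun C hC => hC p p.2⟩
  have hH : Bornology.IsVonNBounded ℝ (Set.range H) := by
    rw [(schwartz_withSeminorms ℝ E ℂ).isVonNBounded_iff_seminorm_bounded]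
    rintro ⟨k, n⟩
    obtain ⟨C, hC⟩ := hbd k n
    refine ⟨|C| + 1, by positivity, ?_⟩
    rintro _ ⟨p, rfl⟩
    refine (SchwartzMap.seminorm_le_bound ℝ k n (H p) (abs_nonneg C) fun η =>
      (hC p p.2 η).trans (le_abs_self C)).trans_lt (lt_add_one _)
  obtain ⟨T, hT⟩ := exists_clm_pderivMulti kb
  let U : 𝓢(E, ℂ) →L[ℝ] 𝓢(Fin d → ℝ, ℝ) :=
    (SchwartzMap.postcompCLM Complex.reCLM).comp
      ((SchwartzMap.compCLMOfContinuousLinearEquiv ℝ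
        (PiLp.continuousLinearEquiv 2 ℝ fun _ : Fin d => ℝ).symm).comp
        (FourierTransform.fourierInvCLM ℝ 𝓢(E, ℂ)))
  have hUT := hH.image (T.comp U)
  rw [(schwartz_withSeminorms ℝ (Fin d → ℝ) ℝ).isVonNBounded_iff_finset_seminorm_bounded] at hUT
  obtain ⟨r, hr, hrb⟩ := hUT (Finset.Iic (m, 0))
  refine ⟨2 ^ m * r, by positivity, fun ε hε _ t ht x => ?_⟩
  set p : scaleParams := ⟨_, mem_scaleParams hβpos hε ht⟩
  have hU : Gbar d β μ φ ε t = U (H p) := by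
    funext x
    rw [Gbar_eq_integral d μ φ hε ht x]
    refine Eq.trans ?_ (congrArg Complex.re (re_fourierInv_eq_integral (H p) x).symm)
    congr 2
    funext ζ
    congr 1
    have hre : ∀ ζ, Fmu d μ ζ = ((Fmu d μ ζ).re : ℂ) := fun ζ =>
      Complex.ext rfl (by rw [hμreal, Complex.ofReal_im])
    change _ = Real.exp _ • Φ _
    rw [hΦ, hre, ← Complex.ofReal_mul, ← Complex.ofReal_exp, mul_comm, Complex.real_smul]
    rfl
  rw [hU, ← hT]
  have hb := SchwartzMap.one_add_le_sup_seminorm_apply (𝕜 := ℝ) (m := (m, 0)) le_rfl le_rfl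
    (T (U (H p))) x
  rw [norm_iteratedFDeriv_zero, Real.norm_eq_abs] at hb
  rw [← div_eq_mul_inv, le_div_iff₀ (by positivity), mul_comm]
  refine hb.trans ?_
  gcongr
  exact (hrb _ ⟨_, ⟨p, rfl⟩, rfl⟩).le
end
end

section
/- Let G : ℝ^{d+1} ∖ {0} → ℝ be smooth, with G(t,x) = 0 whenever t ≤ 0, and satisfy the scaling relation λ^d G(λ^β t, λx) = G(t,x) for every λ > 0 and every (t,x) ≠ 0. Then for every r > 0 there exist constants c, C > 0 and functions K^{(n)} : ℝ^{d+1} → ℝ (n ≥ 0) and R : ℝ^{d+1} → ℝ such that: (i) each K^{(n)} is smooth, supported in {z : ‖z‖_𝔰 ≤ c 2^{−n}}, satisfies |D^k K^{(n)}(z)| ≤ C 2^{(|𝔰|−β+|k|_𝔰)n} for every multi-index k ∈ ℕ^{d+1} with |k|_𝔰 ≤ r, and ∫_{ℝ^{d+1}} z^k K^{(n)}(z) dz = 0 for every |k|_𝔰 ≤ r; (ii) R is smooth, compactly supported, and vanishes for t ≤ 0; (iii) for every bounded measurable u : ℝ^{d+1} → ℝ vanishing for t ≤ 0 and 1-periodic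 in each spatial coordinate, and for every z ∈ (−∞,1] × ℝ^d, one has (G ⋆ u)(z) = (K ⋆ u)(z) + (R ⋆ u)(z), where K := Σ_{n≥0} K^{(n)} and ⋆ denotes space-time convolution on ℝ^{d+1}. -/
noncomputable section

open scoped BigOperators

/-- The parabolic norm `‖(t,x)‖_𝔰 = |t|^{1/β} ∨ |x|_∞` for the scaling `𝔰 = (β,1,…,1)`. -/
def snormP (d : ℕ) (β : ℝ) (t : ℝ) (x : Fin d → ℝ) : ℝ := max (|t| ^ β⁻¹) ‖x‖

/-- The mixed space-time partial derivative `D^k = ∂_t^{k₀} ∂_x^{k̄}` of a space-time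
function. -/
def mixedPartial (d : ℕ) (k0 : ℕ) (ks : Fin d → ℕ) (F : ℝ → (Fin d → ℝ) → ℝ) :
    ℝ → (Fin d → ℝ) → ℝ :=
  fun t x => iteratedDeriv k0 (fun s => pderivMulti ks (F s) x) t

/-- Smooth, compactly supported space-time functions. -/
def IsTestFun {d : ℕ} (F : ℝ → (Fin d → ℝ) → ℝ) : Prop :=
  ContDiff ℝ (⊤ : ℕ∞) (fun z : ℝ × (Fin d → ℝ) => F z.1 z.2) ∧
    HasCompactSupport (fun z : ℝ × (Fin d → ℝ) => F z.1 z.2)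

lemma IsTestFun.fderiv_apply {d : ℕ} {F : ℝ → (Fin d → ℝ) → ℝ} (hF : IsTestFun F)
    (v : ℝ × (Fin d → ℝ)) :
    IsTestFun (fun t x => fderiv ℝ (fun z : ℝ × (Fin d → ℝ) => F z.1 z.2) (t, x) v) := by
  refine ⟨?_, ?_⟩
  · exact (hF.1.fderiv_right (m := ((⊤ : ℕ∞) : WithTop ℕ∞)) (by simp)).clm_apply contDiff_const
  · exact hF.2.fderiv_apply (𝕜 := ℝ) v

lemma IsTestFun.pderivR {d : ℕ} {F : ℝ → (Fin d → ℝ) → ℝ} (hF : IsTestFun F) (i : Fin d) :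
    IsTestFun (fun t x => pderivR i (F t) x) := by
  convert hF.fderiv_apply ((0 : ℝ), Pi.single i (1 : ℝ)) using 3 with t x
  have h1 : HasFDerivAt (fun y : Fin d → ℝ => (t, y))
      (ContinuousLinearMap.inr ℝ ℝ (Fin d → ℝ)) x := hasFDerivAt_prodMk_right t x
  have h2 := ((hF.1.differentiable (by simp)) (t, x)).hasFDerivAt
  have h3 := h2.comp x h1
  have h4 : fderiv ℝ (F t) x = _ := h3.fderiv
  simp [_root_.pderivR, h4]

lemma IsTestFun.deriv {d : ℕ} {F : ℝ → (Fin d → ℝ) → ℝ} (hF : IsTestFun F) :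
    IsTestFun (fun t x => deriv (fun s => F s x) t) := by
  convert hF.fderiv_apply ((1 : ℝ), (0 : Fin d → ℝ)) using 3 with t x
  have h1 : HasFDerivAt (fun s : ℝ => (s, x))
      (ContinuousLinearMap.inl ℝ ℝ (Fin d → ℝ)) t := hasFDerivAt_prodMk_left t x
  have h2 := ((hF.1.differentiable (by simp)) (t, x)).hasFDerivAt
  have h3 := h2.comp t h1
  have h4 : fderiv ℝ (fun s => F s x) t = _ := h3.fderiv
  rw [← fderiv_apply_one_eq_deriv, h4]
  simp

lemma IsTestFun.pderivMulti {d : ℕ} {F : ℝ → (Fin d → ℝ) → ℝ} (hF : IsTestFun F)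
    (k : Fin d → ℕ) : IsTestFun (fun t x => pderivMulti k (F t) x) := by
  unfold _root_.pderivMulti
  induction List.finRange d with
  | nil => exact hF
  | cons i l ih =>
    simp only [List.foldr_cons, Function.comp_apply]
    induction k i with
    | zero => exact ih
    | succ n ihn =>
      simp only [Function.iterate_succ_apply']
      exact ihn.pderivR i

lemma IsTestFun.mixedPartial {d : ℕ} {F : ℝ → (Fin d → ℝ) → ℝ} (hF : IsTestFun F)
    (k0 : ℕ) (ks : Fin d → ℕ) : IsTestFun (mixedPartial d k0 ks F) := by
  unfold _root_.mixedPartial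
  induction k0 with
  | zero => simpa using hF.pderivMulti ks
  | succ n ih =>
    simp only [iteratedDeriv_succ]
    exact ih.deriv

lemma IsTestFun.exists_bound {d : ℕ} {F : ℝ → (Fin d → ℝ) → ℝ} (hF : IsTestFun F) :
    ∃ C : ℝ, ∀ t x, |F t x| ≤ C := by
  obtain ⟨C, hC⟩ := hF.1.continuous.bounded_above_of_compact_support hF.2
  exact ⟨C, fun t x => hC (t, x)⟩

lemma pderivR_scale {d : ℕ} (i : Fin d) (F : (Fin d → ℝ) → ℝ) (a b : ℝ) :
    pderivR i (fun x => a * F (b • x)) = fun x => a * b * pderivR i F (b • x) := by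
  funext x
  have h : fderiv ℝ (fun x => a * F (b • x)) x = a • fderiv ℝ (fun x => F (b • x)) x :=
    congrFun (fderiv_const_smul_field (f := fun x => F (b • x)) a) x
  simp only [pderivR, h, fderiv_comp_smul]
  simp [mul_assoc]

lemma pderivMulti_scale {d : ℕ} (k : Fin d → ℕ) (F : (Fin d → ℝ) → ℝ) (a b : ℝ) :
    pderivMulti k (fun x => a * F (b • x)) =
      fun x => a * b ^ (∑ i, k i) * pderivMulti k F (b • x) := by
  have hs : ∑ i, k i = ((List.finRange d).map k).sum := by
    rw [← List.ofFn_eq_map, List.sum_ofFn]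
  rw [hs]
  unfold pderivMulti
  induction List.finRange d with
  | nil => simp
  | cons i l ih =>
    simp only [List.foldr_cons, Function.comp_apply, List.map_cons, List.sum_cons]
    rw [ih]
    generalize List.foldr (fun i g => (pderivR i)^[k i] ∘ g) id l F = H
    induction k i with
    | zero => simp
    | succ n ihn =>
      rw [Function.iterate_succ_apply', ihn, pderivR_scale]
      funext x
      rw [Function.iterate_succ_apply']
      ring

lemma iteratedDeriv_scale (n : ℕ) (f : ℝ → ℝ) (a b : ℝ) :
    iteratedDeriv n (fun t => a * f (b * t)) = fun t => a * b ^ n * iteratedDeriv n f (b * t) := by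
  induction n with
  | zero => simp
  | succ n ih =>
    rw [iteratedDeriv_succ, ih]
    funext t
    have h : deriv (fun t => a * b ^ n * iteratedDeriv n f (b * t)) t =
        (a * b ^ n) * deriv (fun t => iteratedDeriv n f (b * t)) t :=
      deriv_const_mul_field (v := fun t => iteratedDeriv n f (b * t)) (a * b ^ n)
    rw [h, deriv_comp_mul_left b (iteratedDeriv n f) t, iteratedDeriv_succ, smul_eq_mul]
    ring

lemma mixedPartial_scale {d : ℕ} (k0 : ℕ) (ks : Fin d → ℕ) (F : ℝ → (Fin d → ℝ) → ℝ)
    (a b c : ℝ) (t : ℝ) (x : Fin d → ℝ) :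
    mixedPartial d k0 ks (fun t x => a * F (b * t) (c • x)) t x =
      a * c ^ (∑ i, ks i) * b ^ k0 * mixedPartial d k0 ks F (b * t) (c • x) := by
  unfold mixedPartial
  simp only [pderivMulti_scale]
  exact congrFun (iteratedDeriv_scale k0 (fun s => pderivMulti ks (F s) (c • x)) _ b) t

/-- The space-time monomial `t^{k₀} x^{k̄}`. -/
def stMonomial {d : ℕ} (k0 : ℕ) (ks : Fin d → ℕ) (z : ℝ × (Fin d → ℝ)) : ℝ :=
  z.1 ^ k0 * ∏ i, z.2 i ^ ks i

lemma continuous_stMonomial {d : ℕ} (k0 : ℕ) (ks : Fin d → ℕ) :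
    Continuous (stMonomial k0 ks) := by
  unfold stMonomial
  fun_prop

lemma contDiff_stMonomial {d : ℕ} (k0 : ℕ) (ks : Fin d → ℕ) :
    ContDiff ℝ (⊤ : ℕ∞) (stMonomial k0 ks) := by
  unfold stMonomial
  refine (contDiff_fst.pow _).mul (contDiff_prod fun i _ => ContDiff.pow ?_ _)
  exact (contDiff_apply ℝ ℝ i).comp contDiff_snd

instance isAddHaarMeasure_volume_spaceTime (d : ℕ) :
    (MeasureTheory.volume : MeasureTheory.Measure (ℝ × (Fin d → ℝ))).IsAddHaarMeasure :=
  inferInstanceAs ((MeasureTheory.volume : MeasureTheory.Measure ℝ).prod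
    (MeasureTheory.volume : MeasureTheory.Measure (Fin d → ℝ))).IsAddHaarMeasure

/-- The parabolic dilation `(t, x) ↦ (λ^β t, λ x)`. -/
def dil (d : ℕ) (β : ℝ) (lam : ℝ) (h : 0 < lam) :
    (ℝ × (Fin d → ℝ)) ≃L[ℝ] (ℝ × (Fin d → ℝ)) :=
  (ContinuousLinearEquiv.smulLeft (Units.mk0 (lam ^ β) (Real.rpow_pos_of_pos h β).ne')).prodCongr
    (ContinuousLinearEquiv.smulLeft (Units.mk0 lam h.ne'))

@[simp]
lemma dil_apply (d : ℕ) (β : ℝ) (lam : ℝ) (h : 0 < lam) (z : ℝ × (Fin d → ℝ)) :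
    dil d β lam h z = (lam ^ β * z.1, lam • z.2) := rfl

lemma exists_map_dil_eq_smul (d : ℕ) (β lam : ℝ) (h : 0 < lam) :
    ∃ a : ENNReal, a ≠ ⊤ ∧ MeasureTheory.Measure.map (dil d β lam h).toHomeomorph
      MeasureTheory.volume = a • MeasureTheory.volume := by
  have hdet : LinearMap.det ((dil d β lam h).toLinearEquiv :
      (ℝ × (Fin d → ℝ)) →ₗ[ℝ] (ℝ × (Fin d → ℝ))) ≠ 0 :=
    (LinearEquiv.isUnit_det' (dil d β lam h).toLinearEquiv).ne_zero
  exact ⟨_, ENNReal.ofReal_ne_top, MeasureTheory.Measure.map_linearMap_addHaar_eq_smul_addHaar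
    (MeasureTheory.volume : MeasureTheory.Measure (ℝ × (Fin d → ℝ))) hdet⟩

lemma integral_comp_dil_eq_zero {d : ℕ} (β lam : ℝ) (h : 0 < lam) {f : ℝ × (Fin d → ℝ) → ℝ}
    (hf : ∫ z, f z = 0) : ∫ z, f (dil d β lam h z) = 0 := by
  obtain ⟨a, -, ha⟩ := exists_map_dil_eq_smul d β lam h
  have h2 := ((dil d β lam h).toHomeomorph.measurableEmbedding).integral_map
    (μ := MeasureTheory.volume) f
  rw [ha, MeasureTheory.integral_smul_measure, hf, smul_zero] at h2
  exact h2.symm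

lemma integrable_comp_dil {d : ℕ} (β lam : ℝ) (h : 0 < lam) {f : ℝ × (Fin d → ℝ) → ℝ}
    (hf : MeasureTheory.Integrable f) :
    MeasureTheory.Integrable (fun z => f (dil d β lam h z)) := by
  obtain ⟨a, ha', ha⟩ := exists_map_dil_eq_smul d β lam h
  have h2 := ((dil d β lam h).toHomeomorph.measurableEmbedding).integrable_map_iff
    (μ := MeasureTheory.volume) (g := f)
  rw [ha] at h2
  exact h2.mp (hf.smul_measure ha')

lemma stMonomial_mul_comp_dil {d : ℕ} (β lam : ℝ) (h : 0 < lam)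
    (A : ℝ × (Fin d → ℝ) → ℝ) (k0 : ℕ) (ks : Fin d → ℕ) (z : ℝ × (Fin d → ℝ)) :
    stMonomial k0 ks z * A (dil d β lam h z) =
      ((lam ^ β) ^ k0 * lam ^ (∑ i, ks i))⁻¹ *
        (stMonomial k0 ks (dil d β lam h z) * A (dil d β lam h z)) := by
  have h3 : stMonomial k0 ks (dil d β lam h z) =
      ((lam ^ β) ^ k0 * lam ^ (∑ i, ks i)) * stMonomial k0 ks z := by
    simp only [stMonomial, dil_apply, Pi.smul_apply, smul_eq_mul, mul_pow,
      Finset.prod_mul_distrib, Finset.prod_pow_eq_pow_sum]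
    ring
  have h4 : (lam ^ β) ^ k0 * lam ^ (∑ i, ks i) ≠ 0 :=
    mul_ne_zero (pow_ne_zero _ (Real.rpow_pos_of_pos h β).ne') (pow_ne_zero _ h.ne')
  rw [h3]
  field_simp

lemma integral_stMonomial_mul_comp_dil {d : ℕ} (β lam : ℝ) (h : 0 < lam)
    {A : ℝ × (Fin d → ℝ) → ℝ} (k0 : ℕ) (ks : Fin d → ℕ)
    (hA : ∫ z, stMonomial k0 ks z * A z = 0) :
    ∫ z, stMonomial k0 ks z * A (dil d β lam h z) = 0 := by
  simp_rw [stMonomial_mul_comp_dil]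
  rw [MeasureTheory.integral_const_mul, integral_comp_dil_eq_zero β lam h hA, mul_zero]

lemma integrable_stMonomial_mul_comp_dil {d : ℕ} (β lam : ℝ) (h : 0 < lam)
    {A : ℝ × (Fin d → ℝ) → ℝ} (k0 : ℕ) (ks : Fin d → ℕ)
    (hA : MeasureTheory.Integrable (fun z => stMonomial k0 ks z * A z)) :
    MeasureTheory.Integrable (fun z => stMonomial k0 ks z * A (dil d β lam h z)) := by
  simp_rw [stMonomial_mul_comp_dil]
  exact (integrable_comp_dil β lam h hA).const_mul _

lemma exists_mem_ball_sum_stMonomial_ne_zero {d N : ℕ}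
    {a : Fin (N + 1) × (Fin d → Fin (N + 1)) → ℝ} (ha : a ≠ 0) :
    ∃ z ∈ Metric.ball ((1 : ℝ), (0 : Fin d → ℝ)) (1 / 4),
      ∑ k, a k * stMonomial (k.1 : ℕ) (fun i => (k.2 i : ℕ)) z ≠ 0 := by
  by_contra! hz
  apply ha
  let e : Fin (N + 1) × (Fin d → Fin (N + 1)) → (Option (Fin d) →₀ ℕ) := fun k =>
    Finsupp.equivFunOnFinite.symm (fun o => o.elim (k.1 : ℕ) (fun i => (k.2 i : ℕ)))
  have he : Function.Injective e := by
    intro k l hkl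
    have h1 := Finsupp.equivFunOnFinite.symm.injective hkl
    refine Prod.ext ?_ (funext fun i => ?_)
    · exact Fin.ext (congrFun h1 none)
    · exact Fin.ext (congrFun h1 (some i))
  let P : MvPolynomial (Option (Fin d)) ℝ := ∑ k, MvPolynomial.monomial (e k) (a k)
  have hev : ∀ y : Option (Fin d) → ℝ, MvPolynomial.eval y P =
      ∑ k, a k * stMonomial (k.1 : ℕ) (fun i => (k.2 i : ℕ)) (y none, fun i => y (some i)) := by
    intro y
    simp only [P, map_sum, MvPolynomial.eval_monomial]
    refine Finset.sum_congr rfl fun k _ => ?_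
    rw [Finsupp.prod_fintype _ _ (by simp), Fintype.prod_option]
    simp [stMonomial, e]
  have hP : P = 0 := by
    refine MvPolynomial.funext_set
      (fun o => o.elim (Set.Ioo (1 - 1 / 8 : ℝ) (1 + 1 / 8)) (fun _ => Set.Ioo (-(1 / 8)) (1 / 8)))
      ?_ ?_
    · rintro (_ | i)
      · exact Set.Ioo_infinite (by norm_num)
      · exact Set.Ioo_infinite (by norm_num)
    · intro y hy
      rw [hev, map_zero]
      refine hz _ ?_
      have h0 := hy none trivial
      simp only [Option.elim, Set.mem_Ioo] at h0
      rw [Metric.mem_ball, Prod.dist_eq, max_lt_iff]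
      constructor
      · rw [Real.dist_eq, abs_lt]
        constructor <;> linarith [h0.1, h0.2]
      · rw [dist_pi_lt_iff (by norm_num)]
        intro i
        have hi := hy (some i) trivial
        simp only [Option.elim, Set.mem_Ioo] at hi
        rw [Real.dist_eq, abs_lt]
        simp only [Pi.zero_apply]
        constructor <;> linarith [hi.1, hi.2]
  funext k
  have h1 : MvPolynomial.coeff (e k) P = a k := by
    simp only [P, MvPolynomial.coeff_sum, MvPolynomial.coeff_monomial]
    rw [Finset.sum_eq_single k]
    · simp
    · intro l _ hl
      rw [if_neg (fun h => hl (he h))]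
    · simp
  rw [← h1, hP]
  simp

/-- Finitely many moments of a test function supported in positive times can be prescribed. -/
lemma exists_testFun_moments (d N : ℕ) (s : ℕ → (Fin d → ℕ) → ℝ) :
    ∃ S : ℝ × (Fin d → ℝ) → ℝ, ContDiff ℝ (⊤ : ℕ∞) S ∧ HasCompactSupport S ∧
      (∀ z, z.1 ≤ 0 → S z = 0) ∧
      ∀ (k0 : ℕ) (ks : Fin d → ℕ), k0 ≤ N → (∀ i, ks i ≤ N) →
        ∫ z, stMonomial k0 ks z * S z = s k0 ks := by
  let ρ : ContDiffBump ((1 : ℝ), (0 : Fin d → ℝ)) := ⟨1 / 4, 1 / 2, by norm_num, by norm_num⟩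
  let m : Fin (N + 1) × (Fin d → Fin (N + 1)) → ℝ × (Fin d → ℝ) → ℝ :=
    fun k => stMonomial (k.1 : ℕ) (fun i => (k.2 i : ℕ))
  have hm : ∀ k, ContDiff ℝ (⊤ : ℕ∞) (m k) := fun k => contDiff_stMonomial _ _
  let F : (Fin (N + 1) × (Fin d → Fin (N + 1)) → ℝ) → ℝ × (Fin d → ℝ) → ℝ :=
    fun a z => ρ z * ∑ k, a k * m k z
  have hFs : ∀ a, ContDiff ℝ (⊤ : ℕ∞) (F a) := fun a =>
    ρ.contDiff.mul (ContDiff.sum fun k _ => contDiff_const.mul (hm k))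
  have hFc : ∀ a, HasCompactSupport (F a) := fun a => ρ.hasCompactSupport.mul_right
  have hInt : ∀ (g : ℝ × (Fin d → ℝ) → ℝ), Continuous g → ∀ a,
      MeasureTheory.Integrable (fun z => g z * F a z) := fun g hg a =>
    (hg.mul (hFs a).continuous).integrable_of_hasCompactSupport ((hFc a).mul_left)
  let T : (Fin (N + 1) × (Fin d → Fin (N + 1)) → ℝ) →ₗ[ℝ]
      (Fin (N + 1) × (Fin d → Fin (N + 1)) → ℝ) :=
    { toFun := fun a k => ∫ z, m k z * F a z
      map_add' := by
        intro a b
        funext k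
        rw [Pi.add_apply, ← MeasureTheory.integral_add (hInt _ (hm k).continuous a)
          (hInt _ (hm k).continuous b)]
        refine MeasureTheory.integral_congr_ae (Filter.Eventually.of_forall fun z => ?_)
        simp only [F, Pi.add_apply, add_mul, Finset.sum_add_distrib]
        ring
      map_smul' := by
        intro c a
        funext k
        rw [RingHom.id_apply, Pi.smul_apply, smul_eq_mul, ← MeasureTheory.integral_const_mul]
        refine MeasureTheory.integral_congr_ae (Filter.Eventually.of_forall fun z => ?_)
        simp only [F, Pi.smul_apply, smul_eq_mul, mul_assoc, ← Finset.mul_sum]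
        ring }
  have hT : Function.Injective T := by
    rw [injective_iff_map_eq_zero]
    intro a ha
    by_contra hne
    obtain ⟨z, hz, hzne⟩ := exists_mem_ball_sum_stMonomial_ne_zero hne
    have h1 : ∫ z, (∑ k, a k * m k z) * F a z = 0 := by
      have h2 : ∀ z, (∑ k, a k * m k z) * F a z = ∑ k, a k * (m k z * F a z) := by
        intro z
        simp only [Finset.sum_mul, mul_assoc]
      simp_rw [h2]
      rw [MeasureTheory.integral_finsetSum _
        (fun k _ => (hInt _ (hm k).continuous a).const_mul (a k))]
      refine Finset.sum_eq_zero fun k _ => ?_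
      rw [MeasureTheory.integral_const_mul]
      have h3 : ∫ z, m k z * F a z = 0 := congrFun ha k
      rw [h3, mul_zero]
    have hc : Continuous fun z => ∑ k, a k * m k z :=
      continuous_finsetSum _ fun k _ => continuous_const.mul (hm k).continuous
    have h0 : 0 ≤ fun z => (∑ k, a k * m k z) * F a z := by
      intro z
      have : (∑ k, a k * m k z) * F a z = ρ z * (∑ k, a k * m k z) ^ 2 := by
        simp only [F]; ring
      simp only [Pi.zero_apply, this]
      exact mul_nonneg ρ.nonneg (sq_nonneg _)
    have hpos : (fun z => (∑ k, a k * m k z) * F a z) z ≠ 0 := by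
      have : ρ z = 1 := ρ.one_of_mem_closedBall (Metric.ball_subset_closedBall hz)
      simp only [F, this, one_mul]
      exact mul_ne_zero hzne hzne
    have := (hc.mul (hFs a).continuous).integral_pos_of_hasCompactSupport_nonneg_nonzero
      (μ := MeasureTheory.volume) ((hFc a).mul_left) h0 hpos
    exact this.ne' h1
  obtain ⟨a, ha⟩ := LinearMap.injective_iff_surjective.mp hT
    (fun k => s (k.1 : ℕ) (fun i => (k.2 i : ℕ)))
  refine ⟨F a, hFs a, hFc a, ?_, ?_⟩
  · intro z hz
    have : ρ z = 0 := by
      apply ρ.zero_of_le_dist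
      rw [Prod.dist_eq]
      refine le_trans ?_ (le_max_left _ _)
      rw [Real.dist_eq, abs_sub_comm]
      refine le_trans ?_ (le_abs_self _)
      change (1 / 2 : ℝ) ≤ _
      simp only
      linarith
    simp only [F, this, zero_mul]
  · intro k0 ks h0 hs
    exact congrFun ha (⟨k0, by omega⟩, fun i => ⟨ks i, by have := hs i; omega⟩)

/-- A self-similar kernel: smooth away from the origin, vanishing for non-positive times and
invariant under the parabolic dilations up to the factor `λ^d`. -/
structure IsSelfSimilarKernel (d : ℕ) (β : ℝ) (g : ℝ × (Fin d → ℝ) → ℝ) : Prop where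
  contDiffOn : ContDiffOn ℝ (⊤ : ℕ∞) g {z | z ≠ 0}
  eq_zero : ∀ z, z.1 ≤ 0 → g z = 0
  scale : ∀ (lam : ℝ) (h : 0 < lam) (z), lam ^ d * g (dil d β lam h z) = g z

lemma eq_zero_of_forall_neg {d : ℕ} {W : Type*} [NormedAddCommGroup W]
    {H : ℝ × (Fin d → ℝ) → W} (hH : ContinuousOn H {z | z ≠ 0})
    (h0 : ∀ z, z.1 < 0 → H z = 0) (z : ℝ × (Fin d → ℝ)) (hz : z ≠ 0) (hz1 : z.1 ≤ 0) :
    H z = 0 := by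
  rcases hz1.lt_or_eq with h | h
  · exact h0 z h
  · have hc : ContinuousAt H z := hH.continuousAt (isOpen_ne.mem_nhds hz)
    have hl : Filter.Tendsto (fun s : ℝ => ((s, z.2) : ℝ × (Fin d → ℝ)))
        (nhdsWithin 0 (Set.Iio 0)) (nhds z) := by
      have : Continuous (fun s : ℝ => ((s, z.2) : ℝ × (Fin d → ℝ))) := by fun_prop
      have h2 := (this.tendsto 0).mono_left (nhdsWithin_le_nhds (s := Set.Iio 0))
      have h3 : ((0 : ℝ), z.2) = z := Prod.ext h.symm rfl
      rwa [h3] at h2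
    refine tendsto_nhds_unique (hc.tendsto.comp hl) ?_
    refine tendsto_const_nhds.congr' ?_
    filter_upwards [self_mem_nhdsWithin] with s hs
    exact (h0 (s, z.2) hs).symm

lemma exists_bound_pow_of_eq_zero {d : ℕ} {W : Type*} [NormedAddCommGroup W] [NormedSpace ℝ W]
    (T : ℝ) (N : ℕ) (H : ℝ × (Fin d → ℝ) → W)
    (hH : ContDiffOn ℝ (⊤ : ℕ∞) H {z | z ≠ 0}) (h0 : ∀ z, z.1 < 0 → H z = 0) :
    ∃ C : ℝ, 0 ≤ C ∧ ∀ t ∈ Set.Icc 0 T, ∀ x : Fin d → ℝ, ‖x‖ = 1 → ‖H (t, x)‖ ≤ C * t ^ N := by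
  have hne : ∀ (t : ℝ) (x : Fin d → ℝ), ‖x‖ = 1 → ((t, x) : ℝ × (Fin d → ℝ)) ≠ 0 := by
    intro t x hx h
    have : x = 0 := congrArg Prod.snd h
    simp [this] at hx
  induction N generalizing H with
  | zero =>
    have hK : IsCompact (Set.Icc (0 : ℝ) T ×ˢ Metric.sphere (0 : Fin d → ℝ) 1) :=
      isCompact_Icc.prod (isCompact_sphere _ _)
    obtain ⟨C, hC⟩ := hK.exists_bound_of_continuousOn (f := H) (hH.continuousOn.mono (by
      rintro ⟨t, x⟩ ⟨_, hx⟩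
      exact hne t x (by simpa using hx)))
    refine ⟨max C 0, le_max_right _ _, fun t ht x hx => ?_⟩
    rw [pow_zero, mul_one]
    exact (hC (t, x) ⟨ht, by simpa using hx⟩).trans (le_max_left _ _)
  | succ N ih =>
    obtain ⟨C, hC0, hC⟩ := ih (fun z => fderiv ℝ H z (1, 0))
      ((hH.fderiv_of_isOpen isOpen_ne (by simp)).clm_apply contDiffOn_const) (by
        intro z hz
        have : H =ᶠ[nhds z] fun _ => (0 : W) := by
          filter_upwards [(isOpen_Iio.preimage continuous_fst).mem_nhds hz] with y hy
          exact h0 y hy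
        simp [this.fderiv_eq])
    refine ⟨C, hC0, fun t ht x hx => ?_⟩
    have hd : ∀ s : ℝ, HasDerivAt (fun s => H (s, x)) (fderiv ℝ H (s, x) (1, 0)) s := by
      intro s
      have h1 : HasFDerivAt H (fderiv ℝ H (s, x)) (s, x) :=
        ((hH.contDiffAt (isOpen_ne.mem_nhds (hne s x hx))).differentiableAt
          (by simp)).hasFDerivAt
      have h2 : HasDerivAt (fun s : ℝ => ((s, x) : ℝ × (Fin d → ℝ))) (1, 0) s :=
        (hasDerivAt_id s).prodMk (hasDerivAt_const s x)
      exact h1.comp_hasDerivAt s h2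
    have h3 := norm_image_sub_le_of_norm_deriv_le_segment' (f := fun s => H (s, x))
      (a := 0) (b := t) (C := C * t ^ N) (fun s _ => (hd s).hasDerivWithinAt)
      (fun s hs => (hC s ⟨hs.1, hs.2.le.trans ht.2⟩ x hx).trans (by
        have := hs.1
        have := hs.2.le
        gcongr)) t ⟨ht.1, le_rfl⟩
    have h4 : H (0, x) = 0 := eq_zero_of_forall_neg hH.continuousOn h0 _ (hne 0 x hx) le_rfl
    simpa [h4, pow_succ, mul_assoc] using h3

namespace IsSelfSimilarKernel

variable {d : ℕ} {β : ℝ} {g : ℝ × (Fin d → ℝ) → ℝ}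

lemma contDiffAt (hg : IsSelfSimilarKernel d β g) {z : ℝ × (Fin d → ℝ)} (hz : z ≠ 0) :
    ContDiffAt ℝ (⊤ : ℕ∞) g z := hg.contDiffOn.contDiffAt (isOpen_ne.mem_nhds hz)

lemma contDiffOn_iteratedFDeriv (hg : IsSelfSimilarKernel d β g) (k : ℕ) :
    ContDiffOn ℝ (⊤ : ℕ∞) (iteratedFDeriv ℝ k g) {z | z ≠ 0} := fun _ hz =>
  ((hg.contDiffAt hz).iteratedFDeriv_right (by exact_mod_cast le_top)).contDiffWithinAt

lemma iteratedFDeriv_eq_zero_of_neg (hg : IsSelfSimilarKernel d β g) (k : ℕ)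
    (z : ℝ × (Fin d → ℝ)) (hz : z.1 < 0) : iteratedFDeriv ℝ k g z = 0 := by
  have : g =ᶠ[nhds z] fun _ => (0 : ℝ) := by
    filter_upwards [(isOpen_Iio.preimage continuous_fst).mem_nhds hz] with y hy
    exact hg.eq_zero y (le_of_lt hy)
  rw [(this.iteratedFDeriv ℝ k).eq_of_nhds]
  simp

lemma norm_iteratedFDeriv_le (hg : IsSelfSimilarKernel d β g) (k : ℕ) (lam : ℝ) (h : 0 < lam)
    (h1 : lam ≤ 1) (hβ : 0 < β) {z : ℝ × (Fin d → ℝ)} (hz : z ≠ 0) :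
    ‖iteratedFDeriv ℝ k g z‖ ≤ ‖iteratedFDeriv ℝ k g (dil d β lam h z)‖ := by
  have hgeq : g = fun z => lam ^ d • (g ∘ dil d β lam h) z := by
    funext z
    exact (hg.scale lam h z).symm
  have h2 : iteratedFDeriv ℝ k (g ∘ dil d β lam h) z =
      (iteratedFDeriv ℝ k g (dil d β lam h z)).compContinuousLinearMap
        (fun _ => (dil d β lam h : (ℝ × (Fin d → ℝ)) →L[ℝ] (ℝ × (Fin d → ℝ)))) := by
    have := (dil d β lam h).iteratedFDerivWithin_comp_right (𝕜 := ℝ) g (s := Set.univ)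
      uniqueDiffOn_univ (x := z) (Set.mem_univ _) k
    simpa [iteratedFDerivWithin_univ] using this
  have hnorm : ‖(dil d β lam h : (ℝ × (Fin d → ℝ)) →L[ℝ] (ℝ × (Fin d → ℝ)))‖ ≤ 1 := by
    refine ContinuousLinearMap.opNorm_le_bound _ zero_le_one fun z => ?_
    rw [one_mul, ContinuousLinearEquiv.coe_coe, dil_apply, Prod.norm_mk, norm_mul, norm_smul]
    have h3 : ‖lam ^ β‖ ≤ 1 := by
      rw [Real.norm_of_nonneg (Real.rpow_nonneg h.le _)]
      exact Real.rpow_le_one h.le h1 hβ.le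
    have h4 : ‖lam‖ ≤ 1 := by rwa [Real.norm_of_nonneg h.le]
    exact max_le_max (mul_le_of_le_one_left (norm_nonneg _) h3)
      (mul_le_of_le_one_left (norm_nonneg _) h4)
  have h5 : iteratedFDeriv ℝ k g z = lam ^ d • iteratedFDeriv ℝ k (g ∘ dil d β lam h) z := by
    conv_lhs => rw [hgeq]
    refine iteratedFDeriv_const_smul_apply' (ContDiffAt.comp z ?_ ?_)
    · exact (hg.contDiffAt ((dil d β lam h).map_ne_zero_iff.mpr hz)).of_le
        (by exact_mod_cast le_top)
    · exact (dil d β lam h).contDiff.contDiffAt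
  rw [h5, h2, norm_smul]
  have h6 : ‖lam ^ d‖ ≤ 1 := by
    rw [Real.norm_of_nonneg (pow_nonneg h.le _)]
    exact pow_le_one₀ h.le h1
  refine (mul_le_of_le_one_left (norm_nonneg _) h6).trans ?_
  refine (ContinuousMultilinearMap.norm_compContinuousLinearMap_le _ _).trans ?_
  refine mul_le_of_le_one_right (norm_nonneg _) ?_
  exact Finset.prod_le_one (fun _ _ => norm_nonneg _) (fun _ _ => hnorm)

/-- All derivatives decay faster than any power in space, locally uniformly in time. -/
lemma exists_decay (hg : IsSelfSimilarKernel d β g) (hβ : 0 < β) (T : ℝ) (k M : ℕ) :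
    ∃ C : ℝ, 0 ≤ C ∧ ∀ z : ℝ × (Fin d → ℝ), z.1 ≤ T → 1 ≤ ‖z.2‖ →
      ‖iteratedFDeriv ℝ k g z‖ ≤ C * (‖z.2‖ ^ M)⁻¹ := by
  obtain ⟨N, hN⟩ := exists_nat_ge ((M : ℝ) / β)
  rw [div_le_iff₀ hβ] at hN
  obtain ⟨C, hC0, hC⟩ := exists_bound_pow_of_eq_zero T N _ (hg.contDiffOn_iteratedFDeriv k)
    (hg.iteratedFDeriv_eq_zero_of_neg k)
  refine ⟨C * |T| ^ N, by positivity, fun z hzT hz => ?_⟩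
  have hx0 : 0 < ‖z.2‖ := by linarith
  have hz0 : z ≠ 0 := by
    rintro rfl
    simp at hx0
  rcases le_or_gt z.1 0 with h | h
  · rw [eq_zero_of_forall_neg (hg.contDiffOn_iteratedFDeriv k).continuousOn
      (hg.iteratedFDeriv_eq_zero_of_neg k) z hz0 h, norm_zero]
    positivity
  · have hl : 0 < ‖z.2‖⁻¹ := inv_pos.mpr hx0
    have hl1 : ‖z.2‖⁻¹ ≤ 1 := inv_le_one_of_one_le₀ hz
    have hb : 0 < ‖z.2‖⁻¹ ^ β := Real.rpow_pos_of_pos hl β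
    have hb1 : ‖z.2‖⁻¹ ^ β ≤ 1 := Real.rpow_le_one hl.le hl1 hβ.le
    refine (hg.norm_iteratedFDeriv_le k _ hl hl1 hβ hz0).trans ?_
    rw [dil_apply]
    refine (hC _ ⟨by positivity, ?_⟩ _ ?_).trans ?_
    · exact (mul_le_of_le_one_left h.le hb1).trans hzT
    · rw [norm_smul, norm_inv, norm_norm, inv_mul_cancel₀ hx0.ne']
    · rw [mul_pow, mul_assoc, mul_comm (|T| ^ N)]
      have h3 : (‖z.2‖⁻¹ ^ β) ^ N ≤ (‖z.2‖ ^ M)⁻¹ := by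
        rw [← Real.rpow_natCast, ← Real.rpow_mul hl.le, ← inv_pow, ← Real.rpow_natCast _ M]
        exact Real.rpow_le_rpow_of_exponent_ge hl hl1 (by linarith)
      have h4 : z.1 ^ N ≤ |T| ^ N := pow_le_pow_left₀ h.le (hzT.trans (le_abs_self T)) N
      gcongr

/-- The kernel multiplied by a smooth cutoff vanishing near the origin is smooth. -/
lemma contDiff_mul_cutoff (hg : IsSelfSimilarKernel d β g) {ψ : ℝ × (Fin d → ℝ) → ℝ}
    (hψ : ContDiff ℝ (⊤ : ℕ∞) ψ) (h0 : ∀ᶠ z in nhds 0, ψ z = 0) :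
    ContDiff ℝ (⊤ : ℕ∞) (fun z => g z * ψ z) := by
  rw [contDiff_iff_contDiffAt]
  intro z
  rcases eq_or_ne z 0 with rfl | hz
  · refine (contDiffAt_const (c := (0 : ℝ))).congr_of_eventuallyEq ?_
    filter_upwards [h0] with y hy
    rw [hy, mul_zero]
  · exact (hg.contDiffAt hz).mul hψ.contDiffAt

lemma exists_decay_mul_cutoff (hg : IsSelfSimilarKernel d β g) (hβ : 0 < β)
    {ψ : ℝ × (Fin d → ℝ) → ℝ} (hψ : ContDiff ℝ (⊤ : ℕ∞) ψ) (h0 : ∀ᶠ z in nhds 0, ψ z = 0)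
    (h1 : ∀ z, 1 ≤ ‖z‖ → ψ z = 1) (T : ℝ) (k M : ℕ) :
    ∃ C : ℝ, 0 ≤ C ∧ ∀ z : ℝ × (Fin d → ℝ), |z.1| ≤ T →
      ‖iteratedFDeriv ℝ k (fun z => g z * ψ z) z‖ ≤ C * ((1 + ‖z.2‖) ^ M)⁻¹ := by
  obtain ⟨C₁, hC₁, hb₁⟩ := hg.exists_decay hβ T k M
  have hK : IsCompact (Set.Icc (-T) T ×ˢ Metric.closedBall (0 : Fin d → ℝ) 1) :=
    isCompact_Icc.prod (isCompact_closedBall _ _)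
  obtain ⟨C₂, hb₂⟩ := hK.exists_bound_of_continuousOn
    (f := iteratedFDeriv ℝ k (fun z => g z * ψ z))
    ((hg.contDiff_mul_cutoff hψ h0).continuous_iteratedFDeriv (by exact_mod_cast le_top)).continuousOn
  refine ⟨(C₁ + |C₂|) * 2 ^ M, by positivity, fun z hz => ?_⟩
  rcases le_or_gt ‖z.2‖ 1 with h | h
  · refine (hb₂ z ⟨abs_le.mp hz, by simpa using h⟩).trans ?_
    rw [mul_assoc, ← div_eq_mul_inv]
    have h2 : 1 ≤ (2 : ℝ) ^ M / (1 + ‖z.2‖) ^ M := by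
      rw [one_le_div (by positivity)]
      gcongr
      linarith
    calc C₂ ≤ |C₂| := le_abs_self _
      _ ≤ C₁ + |C₂| := by linarith
      _ ≤ _ := le_mul_of_one_le_right (by positivity) h2
  · have he : (fun z => g z * ψ z) =ᶠ[nhds z] g := by
      filter_upwards [(isOpen_lt continuous_const (continuous_snd.norm)).mem_nhds h] with y hy
      have hy' : (1 : ℝ) < ‖y.2‖ := hy
      rw [h1 y (hy'.le.trans (norm_snd_le y)), mul_one]
    rw [(he.iteratedFDeriv ℝ k).eq_of_nhds]
    refine (hb₁ z (le_of_abs_le hz) h.le).trans ?_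
    rw [mul_assoc]
    have h2 : (‖z.2‖ ^ M)⁻¹ ≤ 2 ^ M * ((1 + ‖z.2‖) ^ M)⁻¹ := by
      rw [← div_eq_mul_inv, ← div_pow, ← inv_pow, ← one_div]
      refine pow_le_pow_left₀ (by positivity) ?_ M
      rw [div_le_div_iff₀ (by linarith) (by linarith)]
      linarith
    have h3 : C₁ ≤ C₁ + |C₂| := by linarith [abs_nonneg C₂]
    gcongr

lemma measurable (hg : IsSelfSimilarKernel d β g) : Measurable g :=
  measurable_of_continuousOn_compl_singleton 0 hg.contDiffOn.continuousOn

lemma integrable_slice_one (hg : IsSelfSimilarKernel d β g) (hβ : 0 < β) :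
    MeasureTheory.Integrable (fun x : Fin d → ℝ => g (1, x)) := by
  let χ : ContDiffBump (0 : ℝ × (Fin d → ℝ)) := ⟨1 / 2, 1, by norm_num, by norm_num⟩
  have h1 : ∀ z : ℝ × (Fin d → ℝ), 1 ≤ ‖z‖ → 1 - χ z = 1 := by
    intro z hz
    rw [χ.zero_of_le_dist (by simpa using hz), sub_zero]
  obtain ⟨C, hC0, hC⟩ := hg.exists_decay_mul_cutoff hβ (ψ := fun z => 1 - χ z)
    (contDiff_const.sub χ.contDiff) (by
      filter_upwards [χ.eventuallyEq_one] with z hz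
      simp [hz]) h1 1 0 (d + 1)
  have hc : Continuous (fun x : Fin d → ℝ => g (1, x)) := by
    refine hg.contDiffOn.continuousOn.comp_continuous (by fun_prop) fun x h => ?_
    have : (1 : ℝ) = 0 := congrArg Prod.fst h
    exact one_ne_zero this
  have hi := (integrable_one_add_norm (E := Fin d → ℝ) (μ := MeasureTheory.volume)
    (r := ((d + 1 : ℕ) : ℝ)) (by simp)).const_mul C
  refine hi.mono' hc.aestronglyMeasurable (Filter.Eventually.of_forall fun x => ?_)
  have h2 := hC (1, x) (by simp)
  rw [norm_iteratedFDeriv_zero, h1 (1, x) (by simp [Prod.norm_mk]), mul_one] at h2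
  rwa [Real.rpow_neg (by positivity), Real.rpow_natCast]

lemma integrableOn_Iic (hg : IsSelfSimilarKernel d β g) (hβ : 0 < β) (T : ℝ) :
    MeasureTheory.IntegrableOn g {z | z.1 ≤ T} := by
  have hms : MeasurableSet {z : ℝ × (Fin d → ℝ) | z.1 ≤ T} :=
    measurableSet_le measurable_fst measurable_const
  rw [← MeasureTheory.integrable_indicator_iff hms]
  have hslice : ∀ t : ℝ, ∀ h : 0 < t, ∀ x : Fin d → ℝ,
      g (t, x) = (t ^ (-β⁻¹)) ^ d * g (1, t ^ (-β⁻¹) • x) := by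
    intro t ht x
    rw [← hg.scale (t ^ (-β⁻¹)) (Real.rpow_pos_of_pos ht _) (t, x), dil_apply]
    congr 3
    rw [← Real.rpow_mul ht.le, neg_mul, inv_mul_cancel₀ hβ.ne', Real.rpow_neg_one,
      inv_mul_cancel₀ ht.ne']
  have hmeas := hg.measurable.indicator hms
  refine (MeasureTheory.integrable_prod_iff hmeas.aestronglyMeasurable).mpr ⟨?_, ?_⟩
  · refine Filter.Eventually.of_forall fun t => ?_
    by_cases ht : 0 < t ∧ t ≤ T
    · have : (fun x : Fin d → ℝ => Set.indicator {z : ℝ × (Fin d → ℝ) | z.1 ≤ T} g (t, x)) =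
          fun x => (t ^ (-β⁻¹)) ^ d * g (1, t ^ (-β⁻¹) • x) := by
        funext x
        rw [Set.indicator_of_mem (by exact ht.2), hslice t ht.1]
      rw [this]
      exact ((hg.integrable_slice_one hβ).comp_smul
        (Real.rpow_pos_of_pos ht.1 _).ne').const_mul _
    · have : (fun x : Fin d → ℝ => Set.indicator {z : ℝ × (Fin d → ℝ) | z.1 ≤ T} g (t, x)) =
          fun x => 0 := by
        funext x
        rw [Set.indicator_apply_eq_zero]
        intro hT
        exact hg.eq_zero _ (not_lt.mp fun h => ht ⟨h, hT⟩)
      rw [this]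
      exact MeasureTheory.integrable_zero _ _ _
  · have : (fun t : ℝ => ∫ x : Fin d → ℝ,
        ‖Set.indicator {z : ℝ × (Fin d → ℝ) | z.1 ≤ T} g (t, x)‖) =
        Set.indicator (Set.Ioc 0 T) (fun _ => ∫ x : Fin d → ℝ, ‖g (1, x)‖) := by
      funext t
      by_cases ht : 0 < t ∧ t ≤ T
      · rw [Set.indicator_of_mem (show t ∈ Set.Ioc 0 T from ht)]
        have h1 : ∀ x : Fin d → ℝ, ‖Set.indicator {z : ℝ × (Fin d → ℝ) | z.1 ≤ T} g (t, x)‖ =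
            (t ^ (-β⁻¹)) ^ d * ‖g (1, t ^ (-β⁻¹) • x)‖ := by
          intro x
          rw [Set.indicator_of_mem (by exact ht.2), hslice t ht.1, norm_mul, Real.norm_of_nonneg]
          exact pow_nonneg (Real.rpow_nonneg ht.1.le _) _
        simp_rw [h1]
        have hp : 0 < t ^ (-β⁻¹) := Real.rpow_pos_of_pos ht.1 _
        rw [MeasureTheory.integral_const_mul,
          MeasureTheory.Measure.integral_comp_smul MeasureTheory.volume
            (fun x : Fin d → ℝ => ‖g (1, x)‖), Module.finrank_fin_fun, abs_inv,
          abs_of_pos (pow_pos hp d), smul_eq_mul, mul_inv_cancel_left₀ (pow_pos hp d).ne']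
      · rw [Set.indicator_of_notMem (show t ∉ Set.Ioc 0 T from ht)]
        have h1 : ∀ x : Fin d → ℝ,
            ‖Set.indicator {z : ℝ × (Fin d → ℝ) | z.1 ≤ T} g (t, x)‖ = 0 := by
          intro x
          rw [norm_eq_zero, Set.indicator_apply_eq_zero]
          intro hT
          exact hg.eq_zero _ (not_lt.mp fun h => ht ⟨h, hT⟩)
        simp_rw [h1]
        simp
    rw [this, MeasureTheory.integrable_indicator_iff measurableSet_Ioc]
    exact MeasureTheory.integrableOn_const (by simp) (by simp)

end IsSelfSimilarKernel

/-- A smooth bump whose integer translates sum to one. -/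
def unityBump (s : ℝ) : ℝ := Real.smoothTransition (s + 1) - Real.smoothTransition s

lemma contDiff_unityBump : ContDiff ℝ (⊤ : ℕ∞) unityBump := by
  unfold unityBump
  exact (Real.smoothTransition.contDiff.comp (contDiff_id.add contDiff_const)).sub
    Real.smoothTransition.contDiff

lemma unityBump_eq_zero {s : ℝ} (hs : 1 ≤ |s|) : unityBump s = 0 := by
  unfold unityBump
  rcases le_abs.mp hs with h | h
  · rw [Real.smoothTransition.one_of_one_le h, Real.smoothTransition.one_of_one_le (by linarith),
      sub_self]
  · rw [Real.smoothTransition.zero_of_nonpos (by linarith),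
      Real.smoothTransition.zero_of_nonpos (by linarith), sub_self]

lemma unityBump_sub_int_eq_zero {s : ℝ} {n : ℤ} (h : n ∉ Finset.Icc ⌊s⌋ (⌊s⌋ + 1)) :
    unityBump (s - n) = 0 := by
  apply unityBump_eq_zero
  rw [Finset.mem_Icc, not_and_or, not_le, not_le] at h
  rcases h with h | h
  · have h1 : ((n + 1 : ℤ) : ℝ) ≤ ⌊s⌋ := by exact_mod_cast h
    have h2 := Int.floor_le s
    push_cast at h1
    exact le_abs.mpr (Or.inl (by linarith))
  · have h1 : ((⌊s⌋ + 1 + 1 : ℤ) : ℝ) ≤ n := by exact_mod_cast h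
    have h2 := Int.lt_floor_add_one s
    push_cast at h1
    exact le_abs.mpr (Or.inr (by linarith))

lemma sum_unityBump_sub_int (s : ℝ) :
    ∑ n ∈ Finset.Icc ⌊s⌋ (⌊s⌋ + 1), unityBump (s - n) = 1 := by
  have h : Finset.Icc ⌊s⌋ (⌊s⌋ + 1) = {⌊s⌋, ⌊s⌋ + 1} := by
    ext n
    simp only [Finset.mem_Icc, Finset.mem_insert, Finset.mem_singleton]
    omega
  have h1 := Int.floor_le s
  have h2 := Int.lt_floor_add_one s
  rw [h, Finset.sum_pair (by omega)]
  unfold unityBump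
  push_cast
  rw [Real.smoothTransition.one_of_one_le (x := s - ⌊s⌋ + 1) (by linarith),
    Real.smoothTransition.zero_of_nonpos (x := s - (⌊s⌋ + 1)) (by linarith)]
  ring_nf

lemma hasSum_prod_unityBump {d : ℕ} (x : Fin d → ℝ) :
    HasSum (fun m : Fin d → ℤ => ∏ i, unityBump (x i - m i)) 1 := by
  have h1 : ∑ m ∈ Fintype.piFinset (fun i => Finset.Icc ⌊x i⌋ (⌊x i⌋ + 1)),
      ∏ i, unityBump (x i - m i) = 1 := by
    rw [← Finset.prod_univ_sum (fun i => Finset.Icc ⌊x i⌋ (⌊x i⌋ + 1))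
      (fun i n => unityBump (x i - (n : ℤ)))]
    simp [sum_unityBump_sub_int]
  rw [← h1]
  refine hasSum_sum_of_ne_finset_zero fun m hm => ?_
  simp only [Fintype.mem_piFinset, not_forall] at hm
  obtain ⟨i, hi⟩ := hm
  exact Finset.prod_eq_zero (Finset.mem_univ i) (unityBump_sub_int_eq_zero hi)

lemma summable_one_add_norm_int (d : ℕ) :
    Summable (fun m : Fin d → ℤ => ((1 + ‖(fun i => (m i : ℝ))‖) ^ (d + 1))⁻¹) := by
  let L : Submodule ℤ (Fin d → ℝ) := Submodule.span ℤ (Set.range (Pi.basisFun ℝ (Fin d)))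
  have hmem : ∀ m : Fin d → ℤ, (fun i => (m i : ℝ)) ∈ L := by
    intro m
    refine ((Pi.basisFun ℝ (Fin d)).mem_span_iff_repr_mem ℤ _).mpr fun i => ?_
    exact ⟨m i, by simp⟩
  let e : (Fin d → ℤ) → L := fun m => ⟨fun i => (m i : ℝ), hmem m⟩
  have he : Function.Injective e := by
    intro m n hmn
    funext i
    have : (m i : ℝ) = n i := congrFun (congrArg Subtype.val hmn) i
    exact_mod_cast this
  have hrank : Module.finrank ℤ L < d + 1 := by
    rw [ZLattice.rank ℝ L, Module.finrank_fin_fun]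
    exact Nat.lt_succ_self d
  have hs := (ZLattice.summable_norm_pow_inv L (d + 1) hrank).comp_injective he
  have hcomp : ∀ m, ((fun z : L => ‖z‖⁻¹ ^ (d + 1)) ∘ e) m =
      (‖(fun i => (m i : ℝ))‖ ^ (d + 1))⁻¹ := fun m => inv_pow _ _
  replace hs := hs.congr hcomp
  have hs0 : Summable (fun m : Fin d → ℤ => if m = 0 then (1 : ℝ) else 0) :=
    (hasSum_ite_eq 0 1).summable
  refine Summable.of_nonneg_of_le (fun m => by positivity) (fun m => ?_) (hs.add hs0)
  by_cases hm : m = 0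
  · have h0 : (fun i => (m i : ℝ)) = 0 := by
      subst hm
      exact funext fun i => by simp
    rw [h0, if_pos hm]
    simp
  · have hpos : 0 < ‖(fun i => (m i : ℝ))‖ := by
      rw [norm_pos_iff]
      intro h
      exact hm (funext fun i => by simpa using congrFun h i)
    simp only [hm, if_false, add_zero]
    gcongr
    linarith

/-- The integer lattice translation vector in space-time. -/
def latticeShift {d : ℕ} (m : Fin d → ℤ) : ℝ × (Fin d → ℝ) := (0, fun i => (m i : ℝ))

/-- A smooth function with fast spatial decay can be replaced by a smooth compactly supported
one without changing its integral against spatially periodic functions, up to a time cutoff. -/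
lemma exists_compactSupport_periodization {d : ℕ} (η : ContDiffBump (0 : ℝ)) {T : ℝ}
    (hη : η.rOut ≤ T) {h : ℝ × (Fin d → ℝ) → ℝ} (hh : ContDiff ℝ (⊤ : ℕ∞) h)
    (h0 : ∀ z, z.1 ≤ 0 → h z = 0)
    (hdecay : ∀ k M : ℕ, ∃ C : ℝ, 0 ≤ C ∧ ∀ z : ℝ × (Fin d → ℝ), |z.1| ≤ T →
      ‖iteratedFDeriv ℝ k h z‖ ≤ C * ((1 + ‖z.2‖) ^ M)⁻¹) :
    ∃ R : ℝ × (Fin d → ℝ) → ℝ, ContDiff ℝ (⊤ : ℕ∞) R ∧ HasCompactSupport R ∧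
      (∀ z, z.1 ≤ 0 → R z = 0) ∧
      ∀ v : ℝ × (Fin d → ℝ) → ℝ, Measurable v → (∃ B, ∀ z, |v z| ≤ B) →
        (∀ (m : Fin d → ℤ) z, v (z + latticeShift m) = v z) →
        ∫ z, R z * v z = ∫ z, η z.1 * h z * v z := by
  let Θ : ℝ × (Fin d → ℝ) → ℝ := fun z => η z.1 * ∏ i, unityBump (z.2 i)
  let K : Set (ℝ × (Fin d → ℝ)) := Metric.closedBall (0 : ℝ) T ×ˢ Metric.closedBall 0 1
  have hK : IsCompact K := (isCompact_closedBall _ _).prod (isCompact_closedBall _ _)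
  have hΘ : ContDiff ℝ (⊤ : ℕ∞) Θ :=
    (η.contDiff.comp contDiff_fst).mul (contDiff_prod fun i _ =>
      contDiff_unityBump.comp ((contDiff_apply ℝ ℝ i).comp contDiff_snd))
  have hΘ0 : ∀ z, z ∉ K → Θ z = 0 := by
    intro z hz
    rw [Set.mem_prod, not_and_or] at hz
    rcases hz with hz | hz
    · rw [Metric.mem_closedBall, not_le] at hz
      have : η z.1 = 0 := η.zero_of_le_dist (hη.trans hz.le)
      simp only [Θ, this, zero_mul]
    · rw [mem_closedBall_zero_iff, pi_norm_le_iff_of_nonneg zero_le_one, not_forall] at hz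
      obtain ⟨i, hi⟩ := hz
      have : unityBump (z.2 i) = 0 := unityBump_eq_zero (not_le.mp hi).le
      simp only [Θ]
      rw [Finset.prod_eq_zero (Finset.mem_univ i) this, mul_zero]
  have hΘt : tsupport Θ ⊆ K := closure_minimal (fun z hz => by
    by_contra hzK
    exact hz (hΘ0 z hzK)) hK.isClosed
  have hΘc : HasCompactSupport Θ := hK.of_isClosed_subset (isClosed_tsupport _) hΘt
  let f : (Fin d → ℤ) → ℝ × (Fin d → ℝ) → ℝ := fun m z => Θ z * h (z + latticeShift m)
  have hsh : ∀ m : Fin d → ℤ, ContDiff ℝ (⊤ : ℕ∞)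
      (fun z : ℝ × (Fin d → ℝ) => h (z + latticeShift m)) := fun m =>
    hh.comp (contDiff_id.add contDiff_const)
  have hf : ∀ m, ContDiff ℝ (⊤ : ℕ∞) (f m) := fun m => hΘ.mul (hsh m)
  let w : (Fin d → ℤ) → ℝ := fun m => ((1 + ‖(fun i => (m i : ℝ))‖) ^ (d + 1))⁻¹
  have hw : Summable w := summable_one_add_norm_int d
  have hw0 : ∀ m, 0 ≤ w m := fun m => by positivity
  have hbound : ∀ k : ℕ, ∃ c : ℝ, ∀ m z, ‖iteratedFDeriv ℝ k (f m) z‖ ≤ c * w m := by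
    intro k
    choose C hC0 hC using fun j => hdecay j (d + 1)
    have hΘb : ∀ i : ℕ, ∃ D : ℝ, ∀ z, ‖iteratedFDeriv ℝ i Θ z‖ ≤ D := fun i =>
      (hΘ.continuous_iteratedFDeriv (by exact_mod_cast le_top)).bounded_above_of_compact_support
        (hΘc.iteratedFDeriv i)
    choose D hD using hΘb
    have hD0 : ∀ i, 0 ≤ D i := fun i => (norm_nonneg _).trans (hD i 0)
    refine ⟨∑ i ∈ Finset.range (k + 1), (k.choose i : ℝ) * D i * (C (k - i) * 2 ^ (d + 1)), ?_⟩
    intro m z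
    by_cases hz : z ∈ tsupport Θ
    · obtain ⟨hz1, hz2⟩ := hΘt hz
      rw [mem_closedBall_zero_iff] at hz1 hz2
      refine (norm_iteratedFDeriv_mul_le hΘ (hsh m) z (by exact_mod_cast le_top)).trans ?_
      rw [Finset.sum_mul]
      refine Finset.sum_le_sum fun i _ => ?_
      rw [mul_assoc _ (C (k - i) * 2 ^ (d + 1)), iteratedFDeriv_comp_add_right]
      have h1 := hC (k - i) (z + latticeShift m) (by simpa [latticeShift] using hz1)
      have h2 : ((1 + ‖(z + latticeShift m).2‖) ^ (d + 1))⁻¹ ≤ 2 ^ (d + 1) * w m := by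
        simp only [w]
        rw [← div_eq_mul_inv, ← div_pow, ← inv_pow]
        refine pow_le_pow_left₀ (by positivity) ?_ _
        rw [inv_eq_one_div, div_le_div_iff₀ (by positivity) (by positivity)]
        have h3 : ‖(fun i => (m i : ℝ))‖ ≤ ‖(z + latticeShift m).2‖ + ‖z.2‖ := by
          have : (fun i => (m i : ℝ)) = (z + latticeShift m).2 - z.2 := by
            simp [latticeShift]
          rw [this]
          exact norm_sub_le _ _
        linarith [norm_nonneg (z + latticeShift m).2]
      have h4 : ‖iteratedFDeriv ℝ (k - i) h (z + latticeShift m)‖ ≤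
          C (k - i) * 2 ^ (d + 1) * w m := by
        refine h1.trans ?_
        rw [mul_assoc]
        exact mul_le_mul_of_nonneg_left h2 (hC0 _)
      exact mul_le_mul (mul_le_mul_of_nonneg_left (hD i z) (Nat.cast_nonneg _)) h4
        (norm_nonneg _) (mul_nonneg (Nat.cast_nonneg _) (hD0 i))
    · have h1 : iteratedFDeriv ℝ k (f m) z = 0 := by
        by_contra hne
        exact hz (tsupport_mul_subset_left (support_iteratedFDeriv_subset k hne))
      rw [h1, norm_zero]
      refine mul_nonneg (Finset.sum_nonneg fun i _ => ?_) (hw0 m)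
      have := hD0 i
      have := hC0 (k - i)
      positivity
  choose c hc using hbound
  have hR0 : ∀ z, Θ z = 0 → ∑' m, f m z = 0 := by
    intro z hz
    simp [f, hz]
  refine ⟨fun z => ∑' m, f m z, ?_, ?_, ?_, ?_⟩
  · exact contDiff_tsum (v := fun k m => c k * w m) hf (fun k _ => hw.mul_left _)
      (fun k m z _ => hc k m z)
  · refine HasCompactSupport.of_support_subset_isCompact hK fun z hz => ?_
    by_contra hzK
    exact hz (hR0 z (hΘ0 z hzK))
  · intro z hz
    have : ∀ m, f m z = 0 := by
      intro m
      simp only [f]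
      rw [h0 _ (by simpa [latticeShift] using hz), mul_zero]
    simp [this]
  · rintro v hv ⟨B, hB⟩ hper
    have hInt : ∀ m, MeasureTheory.Integrable (fun z => f m z * v z) := by
      intro m
      have h1 : MeasureTheory.Integrable (f m) :=
        (hf m).continuous.integrable_of_hasCompactSupport hΘc.mul_right
      exact h1.mul_bdd (c := B) hv.aestronglyMeasurable (Filter.Eventually.of_forall hB)
    have hB0 : 0 ≤ B := (abs_nonneg _).trans (hB 0)
    have hsum : Summable fun m => ∫ z, ‖f m z * v z‖ := by
      refine Summable.of_nonneg_of_le (fun m => by positivity) (fun m => ?_)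
        (hw.mul_left (c 0 * B * MeasureTheory.volume.real K))
      have h1 : ∀ z, ‖f m z * v z‖ ≤ K.indicator (fun _ => c 0 * w m * B) z := by
        intro z
        by_cases hz : z ∈ K
        · rw [Set.indicator_of_mem hz, norm_mul]
          have h2 := hc 0 m z
          rw [norm_iteratedFDeriv_zero] at h2
          exact mul_le_mul h2 (hB z) (norm_nonneg _) ((norm_nonneg _).trans h2)
        · rw [Set.indicator_of_notMem hz]
          simp [f, hΘ0 z hz]
      have h2 : MeasureTheory.Integrable (K.indicator fun _ => c 0 * w m * B) := by
        rw [MeasureTheory.integrable_indicator_iff hK.measurableSet]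
        exact MeasureTheory.integrableOn_const hK.measure_lt_top.ne ENNReal.coe_ne_top
      refine (MeasureTheory.integral_mono (hInt m).norm h2 h1).trans (le_of_eq ?_)
      rw [MeasureTheory.integral_indicator hK.measurableSet, MeasureTheory.setIntegral_const,
        smul_eq_mul]
      ring
    have e1 := MeasureTheory.hasSum_integral_of_summable_integral_norm hInt hsum
    have htr : ∀ (m : Fin d → ℤ) z,
        f m (z - latticeShift m) * v (z - latticeShift m) = Θ (z - latticeShift m) * h z * v z := by
      intro m z
      have h1 := hper m (z - latticeShift m)
      rw [sub_add_cancel] at h1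
      simp only [f, sub_add_cancel, h1]
    have hInt' : ∀ m : Fin d → ℤ, MeasureTheory.Integrable
        (fun z => Θ (z - latticeShift m) * h z * v z) := by
      intro m
      have := (hInt m).comp_sub_right (latticeShift m)
      simpa only [htr] using this
    have hsum' : Summable fun m : Fin d → ℤ =>
        ∫ z, ‖Θ (z - latticeShift m) * h z * v z‖ := by
      refine hsum.congr fun m => ?_
      rw [← MeasureTheory.integral_sub_right_eq_self (fun z => ‖f m z * v z‖) (latticeShift m)]
      simp only [htr]
    have e2 := MeasureTheory.hasSum_integral_of_summable_integral_norm hInt' hsum'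
    have e3 : ∀ m : Fin d → ℤ, ∫ z, f m z * v z = ∫ z, Θ (z - latticeShift m) * h z * v z := by
      intro m
      rw [← MeasureTheory.integral_sub_right_eq_self (fun z => f m z * v z) (latticeShift m)]
      simp only [htr]
    simp_rw [e3] at e1
    have e4 := e1.unique e2
    simp only [tsum_mul_right] at e4
    rw [e4]
    refine MeasureTheory.integral_congr_ae (Filter.Eventually.of_forall fun z => ?_)
    have h1 : ∑' m : Fin d → ℤ, Θ (z - latticeShift m) = η z.1 := by
      have := (hasSum_prod_unityBump z.2).mul_left (η z.1)
      rw [mul_one] at this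
      rw [← this.tsum_eq]
      refine tsum_congr fun m => ?_
      simp [Θ, latticeShift]
    simp only [h1]

lemma periodic_latticeShift {d : ℕ} {v : ℝ × (Fin d → ℝ) → ℝ}
    (hv : ∀ j z, v (z + (0, Pi.single j 1)) = v z) (m : Fin d → ℤ) (z : ℝ × (Fin d → ℝ)) :
    v (z + latticeShift m) = v z := by
  let H : AddSubgroup (ℝ × (Fin d → ℝ)) :=
    { carrier := {p | ∀ z, v (z + p) = v z}
      zero_mem' := fun z => by rw [add_zero]
      add_mem' := fun {a b} ha hb z => by rw [← add_assoc, hb, ha]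
      neg_mem' := fun {a} ha z => by
        rw [← ha (z + -a), neg_add_cancel_right] }
  have h1 : latticeShift m = ∑ j, m j • ((0, Pi.single j 1) : ℝ × (Fin d → ℝ)) := by
    refine Prod.ext ?_ (funext fun i => ?_)
    · simp [latticeShift, Prod.fst_sum]
    · simp [latticeShift, Prod.snd_sum, Finset.sum_apply, Pi.single_apply]
  have h2 : latticeShift m ∈ H := by
    rw [h1]
    exact AddSubgroup.sum_mem H fun j _ => H.zsmul_mem (hv j) (m j)
  exact h2 z

lemma exists_dil_two_pow_eq_zero {d : ℕ} {β : ℝ} (hβ : 0 < β) {A : ℝ × (Fin d → ℝ) → ℝ}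
    (hA : HasCompactSupport A) {z : ℝ × (Fin d → ℝ)} (hz : z ≠ 0) :
    ∃ N : ℕ, ∀ n : ℕ, N ≤ n → A (dil d β (2 ^ n) (by positivity) z) = 0 := by
  obtain ⟨M, hM⟩ := hA.isCompact.isBounded.exists_norm_le
  have hM' : ∀ y, M < ‖y‖ → A y = 0 := fun y hy =>
    image_eq_zero_of_notMem_tsupport fun hy' => absurd (hM y hy') (not_le.mpr hy)
  have hpow : Filter.Tendsto (fun n : ℕ => (2 : ℝ) ^ n) Filter.atTop Filter.atTop :=
    tendsto_pow_atTop_atTop_of_one_lt one_lt_two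
  suffices h : ∀ᶠ n : ℕ in Filter.atTop, A (dil d β (2 ^ n) (by positivity) z) = 0 from
    Filter.eventually_atTop.mp h
  by_cases h2 : z.2 = 0
  · have h1 : 0 < |z.1| := abs_pos.mpr fun h => hz (Prod.ext h h2)
    have hl := ((tendsto_rpow_atTop hβ).comp hpow).atTop_mul_const h1
    filter_upwards [hl.eventually_gt_atTop M] with n hn
    refine hM' _ (hn.trans_le ?_)
    rw [dil_apply]
    refine le_trans (le_of_eq ?_) (norm_fst_le _)
    simp only [Function.comp_apply, norm_mul, Real.norm_eq_abs]
    rw [abs_of_nonneg (by positivity : (0 : ℝ) ≤ ((2 : ℝ) ^ n) ^ β)]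
  · have h1 : 0 < ‖z.2‖ := norm_pos_iff.mpr h2
    have hl := hpow.atTop_mul_const h1
    filter_upwards [hl.eventually_gt_atTop M] with n hn
    refine hM' _ (hn.trans_le ?_)
    rw [dil_apply]
    refine le_trans (le_of_eq ?_) (norm_snd_le _)
    simp only [norm_smul, norm_pow, Real.norm_eq_abs, abs_two]

lemma hasSum_dyadic {d : ℕ} {β : ℝ} (hβ : 0 < β) {A : ℝ × (Fin d → ℝ) → ℝ}
    (hA : HasCompactSupport A) {z : ℝ × (Fin d → ℝ)} (hz : z ≠ 0) :
    HasSum (fun n : ℕ => ((2 : ℝ) ^ n) ^ d * A (dil d β (2 ^ n) (by positivity) z) -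
      ((2 : ℝ) ^ (n + 1)) ^ d * A (dil d β (2 ^ (n + 1)) (by positivity) z)) (A z) := by
  obtain ⟨N, hN⟩ := exists_dil_two_pow_eq_zero hβ hA hz
  have hsum := Finset.sum_range_sub' (fun n : ℕ =>
    ((2 : ℝ) ^ n) ^ d * A (dil d β (2 ^ n) (by positivity) z)) N
  have hz0 : ((2 : ℝ) ^ 0) ^ d * A (dil d β (2 ^ 0) (by positivity) z) = A z := by
    simp
  rw [hz0, hN N le_rfl, mul_zero, sub_zero] at hsum
  rw [← hsum]
  refine hasSum_sum_of_ne_finset_zero fun n hn => ?_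
  have hn' : N ≤ n := by simpa using hn
  rw [hN n hn', hN (n + 1) (by omega), mul_zero, mul_zero, sub_zero]

lemma exists_snormP_bound {d : ℕ} {β : ℝ} (hβ : 0 < β) {A : ℝ × (Fin d → ℝ) → ℝ}
    (hA : HasCompactSupport A) :
    ∃ c : ℝ, 0 < c ∧ ∀ z, c < snormP d β z.1 z.2 → A z = 0 := by
  have hcont : Continuous (fun z : ℝ × (Fin d → ℝ) => snormP d β z.1 z.2) := by
    unfold snormP
    exact (continuous_fst.abs.rpow_const fun _ => Or.inr (inv_pos.mpr hβ).le).max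
      continuous_snd.norm
  obtain ⟨c, hc⟩ := hA.isCompact.exists_bound_of_continuousOn hcont.continuousOn
  refine ⟨max c 1, by positivity, fun z hz => ?_⟩
  by_contra hAz
  have h1 := hc z (subset_tsupport A hAz)
  have h2 := le_abs_self (snormP d β z.1 z.2)
  rw [Real.norm_eq_abs] at h1
  linarith [le_max_left c 1]

lemma snormP_scale {d : ℕ} {β lam : ℝ} (hβ : 0 < β) (h : 0 < lam) (t : ℝ) (x : Fin d → ℝ) :
    snormP d β (lam ^ β * t) (lam • x) = lam * snormP d β t x := by
  unfold snormP
  rw [abs_mul, abs_of_pos (Real.rpow_pos_of_pos h β), Real.mul_rpow (by positivity) (abs_nonneg t),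
    ← Real.rpow_mul h.le, mul_inv_cancel₀ hβ.ne', Real.rpow_one, norm_smul, Real.norm_eq_abs,
    abs_of_pos h, mul_max_of_nonneg _ _ h.le]

lemma exists_forall_mixedPartial_le {d : ℕ} {F : ℝ → (Fin d → ℝ) → ℝ} (hF : IsTestFun F)
    (N : ℕ) :
    ∃ C : ℝ, 0 < C ∧ ∀ (k0 : ℕ) (ks : Fin d → ℕ), k0 ≤ N → (∀ i, ks i ≤ N) →
      ∀ t x, |mixedPartial d k0 ks F t x| ≤ C := by
  choose B hB using fun (k0 : ℕ) (ks : Fin d → ℕ) => (hF.mixedPartial k0 ks).exists_bound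
  have hB0 : ∀ k0 ks, 0 ≤ B k0 ks := fun k0 ks => (abs_nonneg _).trans (hB k0 ks 0 0)
  refine ⟨1 + ∑ k : Fin (N + 1) × (Fin d → Fin (N + 1)), B k.1 (fun i => k.2 i), ?_,
    fun k0 ks hk0 hks t x => ?_⟩
  · have := Finset.sum_nonneg fun (k : Fin (N + 1) × (Fin d → Fin (N + 1))) (_ : k ∈ Finset.univ) =>
      hB0 k.1 (fun i => k.2 i)
    linarith
  · have h1 := Finset.single_le_sum
      (f := fun k : Fin (N + 1) × (Fin d → Fin (N + 1)) => B k.1 (fun i => k.2 i))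
      (fun k _ => hB0 k.1 (fun i => k.2 i))
      (Finset.mem_univ (⟨k0, by omega⟩, fun i => ⟨ks i, Nat.lt_succ_of_le (hks i)⟩))
    have h2 := hB k0 ks t x
    simp only at h1
    linarith

namespace IsSelfSimilarKernel

variable {d : ℕ} {β : ℝ} {g : ℝ × (Fin d → ℝ) → ℝ}

lemma integrable_mul_bump (hg : IsSelfSimilarKernel d β g) (hβ : 0 < β)
    (χ : ContDiffBump (0 : ℝ × (Fin d → ℝ))) (hχ : χ.rOut = 1) :
    MeasureTheory.Integrable (fun z => g z * χ z) := by
  have hms : MeasurableSet {z : ℝ × (Fin d → ℝ) | z.1 ≤ 1} :=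
    measurableSet_le measurable_fst measurable_const
  have h1 := ((MeasureTheory.integrable_indicator_iff hms).mpr
    (hg.integrableOn_Iic hβ 1)).mul_bdd (c := 1) χ.continuous.aestronglyMeasurable
    (Filter.Eventually.of_forall fun z => by
      rw [Real.norm_eq_abs, abs_of_nonneg χ.nonneg]
      exact χ.le_one)
  refine h1.congr (Filter.Eventually.of_forall fun z => ?_)
  by_cases hz : z.1 ≤ 1
  · simp only [Set.indicator_of_mem (show z ∈ {z : ℝ × (Fin d → ℝ) | z.1 ≤ 1} from hz)]
  · have h0 : χ z = 0 := by
      refine χ.zero_of_le_dist ?_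
      rw [hχ, dist_zero_right]
      exact (not_le.mp hz).le.trans ((le_abs_self _).trans (norm_fst_le z))
    simp only [h0, mul_zero]

lemma integrable_timeCutoff_mul (hg : IsSelfSimilarKernel d β g) (hβ : 0 < β)
    (η : ContDiffBump (0 : ℝ)) {ψ : ℝ × (Fin d → ℝ) → ℝ} (hψ : Continuous ψ)
    (hψ1 : ∀ z, |ψ z| ≤ 1) :
    MeasureTheory.Integrable (fun z : ℝ × (Fin d → ℝ) => η z.1 * (g z * ψ z)) := by
  have hms : MeasurableSet {z : ℝ × (Fin d → ℝ) | z.1 ≤ η.rOut} :=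
    measurableSet_le measurable_fst measurable_const
  have h1 := ((MeasureTheory.integrable_indicator_iff hms).mpr
    (hg.integrableOn_Iic hβ η.rOut)).mul_bdd (g := fun z => η z.1 * ψ z) (c := 1)
    ((η.continuous.comp continuous_fst).mul hψ).aestronglyMeasurable
    (Filter.Eventually.of_forall fun z => by
      rw [Real.norm_eq_abs, abs_mul, abs_of_nonneg η.nonneg]
      exact mul_le_one₀ η.le_one (abs_nonneg _) (hψ1 z))
  refine h1.congr (Filter.Eventually.of_forall fun z => ?_)
  by_cases hz : z.1 ≤ η.rOut
  · simp only [Set.indicator_of_mem (show z ∈ {z : ℝ × (Fin d → ℝ) | z.1 ≤ η.rOut} from hz)]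
    ring
  · have h0 : η z.1 = 0 := by
      refine η.zero_of_le_dist ?_
      rw [dist_zero_right, Real.norm_eq_abs]
      exact (not_le.mp hz).le.trans (le_abs_self _)
    simp only [h0, mul_zero, zero_mul]

lemma integral_mul_eq_add (hg : IsSelfSimilarKernel d β g) (hβ : 0 < β)
    (χ : ContDiffBump (0 : ℝ × (Fin d → ℝ))) (hχ : χ.rOut = 1)
    (η : ContDiffBump (0 : ℝ)) (hη : η.rIn = 1) {v : ℝ × (Fin d → ℝ) → ℝ}
    (hvm : Measurable v) {B : ℝ} (hvb : ∀ z, |v z| ≤ B) (hv0 : ∀ z, 1 ≤ z.1 → v z = 0) :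
    ∫ z, g z * v z =
      (∫ z, g z * χ z * v z) + ∫ z, η z.1 * (g z * (1 - χ z)) * v z := by
  have hvb' : ∀ᵐ z, ‖v z‖ ≤ B := Filter.Eventually.of_forall hvb
  rw [← MeasureTheory.integral_add
    ((hg.integrable_mul_bump hβ χ hχ).mul_bdd hvm.aestronglyMeasurable hvb')
    ((hg.integrable_timeCutoff_mul hβ η (ψ := fun z => 1 - χ z)
      (continuous_const.sub χ.continuous) fun z => by
      rw [abs_le]
      constructor <;> linarith [χ.nonneg (x := z), χ.le_one (x := z)]).mul_bdd
        hvm.aestronglyMeasurable hvb')]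
  refine MeasureTheory.integral_congr_ae (Filter.Eventually.of_forall fun z => ?_)
  simp only
  rcases le_or_gt z.1 0 with h | h
  · simp [hg.eq_zero z h]
  rcases le_or_gt 1 z.1 with h' | h'
  · simp [hv0 z h']
  · rw [η.one_of_mem_closedBall (by
      rw [hη, mem_closedBall_zero_iff, Real.norm_eq_abs, abs_of_pos h]
      exact h'.le)]
    ring

lemma integrable_stMonomial_mul_sub (hg : IsSelfSimilarKernel d β g) (hβ : 0 < β)
    (χ : ContDiffBump (0 : ℝ × (Fin d → ℝ))) (hχ : χ.rOut = 1) {S : ℝ × (Fin d → ℝ) → ℝ}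
    (hS : Continuous S) (hS' : HasCompactSupport S) (k0 : ℕ) (ks : Fin d → ℕ) :
    MeasureTheory.Integrable (fun z => stMonomial k0 ks z * (g z * χ z)) ∧
      MeasureTheory.Integrable (fun z => stMonomial k0 ks z * S z) := by
  refine ⟨?_, ((continuous_stMonomial k0 ks).mul hS).integrable_of_hasCompactSupport hS'.mul_left⟩
  have hcs : HasCompactSupport (fun z => g z * χ z) := χ.hasCompactSupport.mul_left
  obtain ⟨B, hB⟩ := hcs.isCompact.exists_bound_of_continuousOn
    (continuous_stMonomial (d := d) k0 ks).continuousOn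
  rw [← MeasureTheory.integrableOn_iff_integrable_of_support_subset
    (s := tsupport (fun z => g z * χ z))]
  · refine (hg.integrable_mul_bump hβ χ hχ).integrableOn.bdd_mul (c := B)
      (continuous_stMonomial k0 ks).aestronglyMeasurable ?_
    exact (MeasureTheory.ae_restrict_iff' (isClosed_tsupport _).measurableSet).mpr
      (Filter.Eventually.of_forall hB)
  · exact (Function.support_mul_subset_right _ _).trans (subset_tsupport _)

lemma exists_moment_correction (hg : IsSelfSimilarKernel d β g) (hβ : 0 < β)
    (χ : ContDiffBump (0 : ℝ × (Fin d → ℝ))) (hχ : χ.rOut = 1) (N : ℕ) :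
    ∃ S : ℝ × (Fin d → ℝ) → ℝ, ContDiff ℝ (⊤ : ℕ∞) S ∧ HasCompactSupport S ∧
      (∀ z, z.1 ≤ 0 → S z = 0) ∧
      ∀ (k0 : ℕ) (ks : Fin d → ℕ), k0 ≤ N → (∀ i, ks i ≤ N) →
        MeasureTheory.Integrable (fun z => stMonomial k0 ks z * (g z * χ z - S z)) ∧
        ∫ z, stMonomial k0 ks z * (g z * χ z - S z) = 0 := by
  obtain ⟨S, hS, hS', hS0, hSm⟩ := exists_testFun_moments d N
    (fun k0 ks => ∫ z, stMonomial k0 ks z * (g z * χ z))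
  refine ⟨S, hS, hS', hS0, fun k0 ks hk0 hks => ?_⟩
  obtain ⟨h1, h2⟩ := hg.integrable_stMonomial_mul_sub hβ χ hχ hS.continuous hS' k0 ks
  simp only [mul_sub]
  refine ⟨h1.sub h2, ?_⟩
  rw [MeasureTheory.integral_sub h1 h2, hSm k0 ks hk0 hks, sub_self]

/-- The difference of a truncated self-similar kernel and its rescaling is a test function. -/
lemma contDiff_sub_dil (hg : IsSelfSimilarKernel d β g)
    (χ : ContDiffBump (0 : ℝ × (Fin d → ℝ))) {S : ℝ × (Fin d → ℝ) → ℝ}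
    (hS : ContDiff ℝ (⊤ : ℕ∞) S) :
    ContDiff ℝ (⊤ : ℕ∞) (fun z => (g z * χ z - S z) -
      (2 : ℝ) ^ d * (g (dil d β 2 two_pos z) * χ (dil d β 2 two_pos z) -
        S (dil d β 2 two_pos z))) := by
  have hdil : ContDiff ℝ (⊤ : ℕ∞) (dil d β 2 two_pos) := (dil d β 2 two_pos).contDiff
  have h1 := hg.contDiff_mul_cutoff (ψ := fun z => χ z - χ (dil d β 2 two_pos z))
    (χ.contDiff.sub (χ.contDiff.comp hdil)) (by
      have hd0 : Filter.Tendsto (dil d β 2 two_pos) (nhds 0) (nhds 0) := by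
        have := (dil d β 2 two_pos).continuous.tendsto 0
        rwa [map_zero] at this
      filter_upwards [χ.eventuallyEq_one, hd0.eventually χ.eventuallyEq_one] with z h1 h2
      simp only [Pi.one_apply] at h1 h2
      rw [h1, h2, sub_self])
  have h2 := (h1.sub hS).add (contDiff_const (c := (2 : ℝ) ^ d) |>.mul (hS.comp hdil))
  convert h2 using 2 with z
  have := hg.scale 2 two_pos z
  simp only [Function.comp_apply]
  rw [← this]
  ring

end IsSelfSimilarKernel

/-- **Decomposition of a self-similar Green's function into a singular and a smooth part**
(Lemma 5.5 in the paper).  If `G` is smooth away from the origin, vanishes for `t ≤ 0` and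
satisfies `λ^d G(λ^β t, λx) = G(t,x)`, then `G = K + R` with `K = Σ_n K^{(n)}`, where each
`K^{(n)}` is smooth, supported in `{‖z‖_𝔰 ≤ c2^{−n}}`, satisfies the bounds
`|D^k K^{(n)}(z)| ≤ C 2^{(|𝔰|−β+|k|_𝔰)n}` and annihilates all polynomials of scaled degree
`≤ r`, while `R` is smooth, compactly supported and vanishes for `t ≤ 0`; moreover the
convolution identity `(G ⋆ u)(z) = (K ⋆ u)(z) + (R ⋆ u)(z)` holds on `(−∞,1] × ℝ^d` for every
bounded measurable `u` vanishing for `t ≤ 0` and `1`-periodic in space. -/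
theorem green_function_decomposition (d : ℕ) (hd : 1 ≤ d) (β : ℝ) (hβ : 0 < β)
    (G : ℝ → (Fin d → ℝ) → ℝ)
    (hGsmooth : ContDiffOn ℝ (⊤ : ℕ∞) (fun z : ℝ × (Fin d → ℝ) => G z.1 z.2)
      {z : ℝ × (Fin d → ℝ) | z ≠ 0})
    (hGzero : ∀ t : ℝ, t ≤ 0 → ∀ x : Fin d → ℝ, (t, x) ≠ (0, 0) → G t x = 0)
    (hGscale : ∀ lam : ℝ, 0 < lam → ∀ t : ℝ, ∀ x : Fin d → ℝ, (t, x) ≠ (0, 0) →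
      lam ^ d * G (lam ^ β * t) (lam • x) = G t x) :
    ∀ r : ℝ, 0 < r →
      ∃ c C : ℝ, 0 < c ∧ 0 < C ∧
        ∃ Kn : ℕ → ℝ → (Fin d → ℝ) → ℝ, ∃ R : ℝ → (Fin d → ℝ) → ℝ,
          -- (i) properties of the K^{(n)}
          (∀ n : ℕ, ContDiff ℝ (⊤ : ℕ∞) (fun z : ℝ × (Fin d → ℝ) => Kn n z.1 z.2)) ∧
          (∀ n : ℕ, ∀ t : ℝ, ∀ x : Fin d → ℝ,
            c * (2:ℝ) ^ (-(n:ℤ)) < snormP d β t x → Kn n t x = 0) ∧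
          (∀ n : ℕ, ∀ k0 : ℕ, ∀ ks : Fin d → ℕ,
            β * k0 + (∑ i, ks i : ℕ) ≤ r →
            ∀ t : ℝ, ∀ x : Fin d → ℝ,
              |mixedPartial d k0 ks (Kn n) t x| ≤
                C * (2:ℝ) ^ ((n : ℝ) * ((d : ℝ) + β * k0 + (∑ i, ks i : ℕ)))) ∧
          (∀ n : ℕ, ∀ k0 : ℕ, ∀ ks : Fin d → ℕ,
            β * k0 + (∑ i, ks i : ℕ) ≤ r →
            (∫ z : ℝ × (Fin d → ℝ),
              z.1 ^ k0 * (∏ i, z.2 i ^ ks i) * Kn n z.1 z.2) = 0) ∧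
          -- (ii) properties of R
          ContDiff ℝ (⊤ : ℕ∞) (fun z : ℝ × (Fin d → ℝ) => R z.1 z.2) ∧
          HasCompactSupport (fun z : ℝ × (Fin d → ℝ) => R z.1 z.2) ∧
          (∀ t : ℝ, t ≤ 0 → ∀ x : Fin d → ℝ, R t x = 0) ∧
          -- (iii) the convolution identity
          (∀ u : ℝ → (Fin d → ℝ) → ℝ,
            Measurable (fun z : ℝ × (Fin d → ℝ) => u z.1 z.2) →
            (∃ M : ℝ, ∀ s : ℝ, ∀ y : Fin d → ℝ, |u s y| ≤ M) →
            (∀ s : ℝ, s ≤ 0 → ∀ y : Fin d → ℝ, u s y = 0) →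
            (∀ s : ℝ, ∀ y : Fin d → ℝ, ∀ j : Fin d,
              u s (fun i => y i + if i = j then 1 else 0) = u s y) →
            ∀ t : ℝ, t ≤ 1 → ∀ x : Fin d → ℝ,
              (∫ z : ℝ × (Fin d → ℝ), G z.1 z.2 * u (t - z.1) (x - z.2)) =
                (∫ z : ℝ × (Fin d → ℝ),
                  (∑' n : ℕ, Kn n z.1 z.2) * u (t - z.1) (x - z.2)) +
                  ∫ z : ℝ × (Fin d → ℝ), R z.1 z.2 * u (t - z.1) (x - z.2)) := by
  intro r hr
  let g : ℝ × (Fin d → ℝ) → ℝ := fun z => if z = 0 then 0 else G z.1 z.2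
  have hg0 : ∀ z : ℝ × (Fin d → ℝ), z ≠ 0 → g z = G z.1 z.2 := fun z hz => if_neg hz
  have hg : IsSelfSimilarKernel d β g := by
    refine ⟨hGsmooth.congr hg0, fun z hz => ?_, fun lam h z => ?_⟩
    · by_cases hz0 : z = 0
      · exact if_pos hz0
      · rw [hg0 z hz0]
        exact hGzero z.1 hz z.2 hz0
    · by_cases hz0 : z = 0
      · subst hz0
        simp [g]
      · have h1 : dil d β lam h z ≠ 0 := fun h' => hz0 ((dil d β lam h).map_eq_zero_iff.mp h')
        rw [hg0 z hz0, hg0 _ h1, dil_apply]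
        exact hGscale lam h z.1 z.2 hz0
  obtain ⟨N, hN⟩ := exists_nat_ge (max (r / β) r)
  have hN1 : r ≤ N * β := (div_le_iff₀ hβ).mp ((le_max_left _ _).trans hN)
  have hN2 : r ≤ N := (le_max_right _ _).trans hN
  have hdeg : ∀ (k0 : ℕ) (ks : Fin d → ℕ), β * k0 + (∑ i, ks i : ℕ) ≤ r →
      k0 ≤ N ∧ ∀ i, ks i ≤ N := by
    intro k0 ks hk
    have hb : 0 ≤ β * (k0 : ℝ) := by positivity
    have hs : (0 : ℝ) ≤ (∑ i, ks i : ℕ) := Nat.cast_nonneg _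
    constructor
    · have h1 : (k0 : ℝ) * β ≤ N * β := by linarith
      exact_mod_cast le_of_mul_le_mul_right h1 hβ
    · intro i
      refine (Finset.single_le_sum (f := ks) (fun _ _ => Nat.zero_le _)
        (Finset.mem_univ i)).trans ?_
      have h1 : ((∑ i, ks i : ℕ) : ℝ) ≤ N := by linarith
      exact_mod_cast h1
  let χ : ContDiffBump (0 : ℝ × (Fin d → ℝ)) := ⟨1 / 2, 1, by norm_num, by norm_num⟩
  let η : ContDiffBump (0 : ℝ) := ⟨1, 2, by norm_num, by norm_num⟩
  obtain ⟨S, hS, hS', hS0, hSm⟩ := hg.exists_moment_correction hβ χ rfl N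
  let A : ℝ × (Fin d → ℝ) → ℝ := fun z => g z * χ z - S z
  have hA : HasCompactSupport A := (χ.hasCompactSupport.mul_left (f := g)).sub hS'
  let K₀ : ℝ → (Fin d → ℝ) → ℝ := fun t x =>
    A (t, x) - (2 : ℝ) ^ d * A (dil d β 2 two_pos (t, x))
  have hK₀ : IsTestFun K₀ := by
    refine ⟨hg.contDiff_sub_dil χ hS, hA.sub (HasCompactSupport.mul_left ?_)⟩
    exact hA.comp_homeomorph (dil d β 2 two_pos).toHomeomorph
  let Kn : ℕ → ℝ → (Fin d → ℝ) → ℝ := fun n t x =>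
    ((2 : ℝ) ^ n) ^ d * K₀ (((2 : ℝ) ^ n) ^ β * t) ((2 : ℝ) ^ n • x)
  have hKn : ∀ n (z : ℝ × (Fin d → ℝ)), Kn n z.1 z.2 =
      ((2 : ℝ) ^ n) ^ d * A (dil d β (2 ^ n) (by positivity) z) -
      ((2 : ℝ) ^ (n + 1)) ^ d * A (dil d β (2 ^ (n + 1)) (by positivity) z) := by
    intro n z
    have h1 : dil d β 2 two_pos (dil d β (2 ^ n) (by positivity) z) =
        dil d β (2 ^ (n + 1)) (by positivity) z := by
      simp only [dil_apply, smul_smul, ← mul_assoc]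
      rw [← Real.mul_rpow two_pos.le (by positivity), pow_succ']
    rw [← h1]
    simp only [Kn, K₀, dil_apply]
    ring
  obtain ⟨c, hc, hcK⟩ := exists_snormP_bound hβ hK₀.2
  obtain ⟨C, hC, hCK⟩ := exists_forall_mixedPartial_le hK₀ N
  have hψ : ContDiff ℝ (⊤ : ℕ∞) (fun z => 1 - χ z) := contDiff_const.sub χ.contDiff
  have hψ0 : ∀ᶠ z in nhds 0, 1 - χ z = 0 := by
    filter_upwards [χ.eventuallyEq_one] with z hz
    rw [hz, Pi.one_apply, sub_self]
  have hψ1 : ∀ z : ℝ × (Fin d → ℝ), 1 ≤ ‖z‖ → 1 - χ z = 1 := by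
    intro z hz
    rw [χ.zero_of_le_dist (by simpa using hz), sub_zero]
  obtain ⟨R', hR', hR'', hR0, hRv⟩ := exists_compactSupport_periodization η (T := 2) le_rfl
    (hg.contDiff_mul_cutoff hψ hψ0) (fun z hz => by rw [hg.eq_zero z hz, zero_mul])
    (hg.exists_decay_mul_cutoff hβ hψ hψ0 hψ1 2)
  refine ⟨c, C, hc, hC, Kn, fun t x => S (t, x) + R' (t, x), fun n => ?_, fun n t x h => ?_,
    fun n k0 ks hk t x => ?_, fun n k0 ks hk => ?_, hS.add hR', hS'.add hR'',
    fun t ht x => ?_, fun u hu hub hu0 hup t ht x => ?_⟩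
  · exact contDiff_const.mul (hK₀.1.comp (dil d β (2 ^ n) (by positivity)).contDiff)
  · have h2 : (0 : ℝ) < 2 ^ n := by positivity
    have h1 := hcK (((2 : ℝ) ^ n) ^ β * t, (2 : ℝ) ^ n • x) (by
      simp only
      rw [snormP_scale hβ h2]
      rw [zpow_neg, zpow_natCast, ← div_eq_mul_inv, div_lt_iff₀ h2] at h
      linarith)
    simp only at h1
    simp only [Kn, h1, mul_zero]
  · obtain ⟨hk0, hks⟩ := hdeg k0 ks hk
    simp only [Kn]
    rw [mixedPartial_scale, abs_mul, mul_comm, abs_of_nonneg (a := _ * _ * _) (by positivity)]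
    refine mul_le_mul (hCK k0 ks hk0 hks _ _) (le_of_eq ?_) (by positivity) hC.le
    rw [Real.rpow_mul two_pos.le, Real.rpow_natCast, Real.rpow_add (by positivity),
      Real.rpow_add (by positivity), Real.rpow_natCast, Real.rpow_natCast, Real.rpow_mul
      (by positivity), Real.rpow_natCast]
    ring
  · obtain ⟨hk0, hks⟩ := hdeg k0 ks hk
    have hI : ∀ m : ℕ, MeasureTheory.Integrable
        (fun z => stMonomial k0 ks z * A (dil d β (2 ^ m) (by positivity) z)) := fun m =>
      integrable_stMonomial_mul_comp_dil β (2 ^ m) (by positivity) k0 ks (hSm k0 ks hk0 hks).1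
    have h0 := fun m : ℕ => integral_stMonomial_mul_comp_dil β (2 ^ m) (by positivity) k0 ks
      (hSm k0 ks hk0 hks).2
    simp only [hKn]
    calc _ = ∫ z, (((2 : ℝ) ^ n) ^ d *
            (stMonomial k0 ks z * A (dil d β (2 ^ n) (by positivity) z)) -
          ((2 : ℝ) ^ (n + 1)) ^ d *
            (stMonomial k0 ks z * A (dil d β (2 ^ (n + 1)) (by positivity) z))) := by
          refine MeasureTheory.integral_congr_ae (Filter.Eventually.of_forall fun z => ?_)
          simp only [stMonomial]
          ring
      _ = 0 := by
          rw [MeasureTheory.integral_sub ((hI n).const_mul _) ((hI (n + 1)).const_mul _),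
            MeasureTheory.integral_const_mul, MeasureTheory.integral_const_mul]
          simp only [A, h0, mul_zero, sub_zero]
  · simp only [hS0 (t, x) ht, hR0 (t, x) ht, add_zero]
  · obtain ⟨B, hB⟩ := hub
    let v : ℝ × (Fin d → ℝ) → ℝ := fun z => u (t - z.1) (x - z.2)
    have hvm : Measurable v := hu.comp
      ((measurable_const.sub measurable_fst).prodMk (measurable_const.sub measurable_snd))
    have hvb : ∀ z, |v z| ≤ B := fun z => hB _ _
    have hv0 : ∀ z, 1 ≤ z.1 → v z = 0 := fun z hz => hu0 _ (by linarith) _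
    have hvp : ∀ m z, v (z + latticeShift m) = v z := by
      refine periodic_latticeShift fun j z => ?_
      simp only [v, Prod.fst_add, Prod.snd_add, add_zero]
      rw [← hup (t - z.1) (x - (z.2 + Pi.single j 1)) j]
      congr 1
      funext i
      simp only [Pi.sub_apply, Pi.add_apply, Pi.single_apply]
      ring
    have hvb' : ∀ᵐ z, ‖v z‖ ≤ B := Filter.Eventually.of_forall hvb
    have hne : ∀ᵐ z : ℝ × (Fin d → ℝ), z ≠ 0 := MeasureTheory.Measure.ae_ne _ 0
    have hgχ := (hg.integrable_mul_bump hβ χ rfl).mul_bdd hvm.aestronglyMeasurable hvb'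
    have hSv := (hS.continuous.integrable_of_hasCompactSupport hS').mul_bdd
      hvm.aestronglyMeasurable hvb'
    have hRi := (hR'.continuous.integrable_of_hasCompactSupport hR'').mul_bdd
      hvm.aestronglyMeasurable hvb'
    have e1 : ∫ z, G z.1 z.2 * v z = ∫ z, g z * v z := by
      refine MeasureTheory.integral_congr_ae ?_
      filter_upwards [hne] with z hz
      rw [hg0 z hz]
    have e2 : ∫ z, (∑' n, Kn n z.1 z.2) * v z = (∫ z, g z * χ z * v z) - ∫ z, S z * v z := by
      rw [← MeasureTheory.integral_sub hgχ hSv]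
      refine MeasureTheory.integral_congr_ae ?_
      filter_upwards [hne] with z hz
      simp only [hKn]
      rw [(hasSum_dyadic hβ hA hz).tsum_eq, ← sub_mul]
    have e3 : ∫ z, (S z + R' z) * v z = (∫ z, S z * v z) + ∫ z, R' z * v z := by
      rw [← MeasureTheory.integral_add hSv hRi]
      simp only [add_mul]
    have e4 := hg.integral_mul_eq_add hβ χ rfl η rfl hvm hvb hv0
    have e5 := hRv v hvm ⟨B, hvb⟩ hvp
    change ∫ z, G z.1 z.2 * v z = (∫ z, (∑' n, Kn n z.1 z.2) * v z) + ∫ z, (S z + R' z) * v z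
    rw [e1, e2, e3, e4, e5]
    ring
end
end

section
/- Let ζ₁, ζ₂ ≤ 0, m ∈ ℕ and R > 0. There exists a constant C, depending only on d, 𝔰₀, m, ζ₁, ζ₂ and R and independent of ε = 2^{-N}, such that for all N ∈ ℕ and all K₁, K₂ : ℝ × Λ_ε^d → ℝ supported in {z : ‖z‖_𝔰 ≤ R} with ⦀K₁⦀_{ζ₁;m} < ∞ and ⦀K₂⦀_{ζ₂;m} < ∞, the pointwise product K₁K₂ satisfies ⦀K₁K₂⦀_{ζ₁+ζ₂;m} ≤ C ⦀K₁⦀_{ζ₁;m} ⦀K₂⦀_{ζ₂;m}. -/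
noncomputable section

open scoped BigOperators

/-- The dyadic mesh size `ε = 2^{-N}`. -/
def meps (N : ℕ) : ℝ := (2:ℝ) ^ (-(N:ℤ))

/-- `x` is a point of the grid `Λ_ε^d = (εℤ)^d`. -/
def onGrid (d : ℕ) (ε : ℝ) (x : Fin d → ℝ) : Prop := ∀ i, ∃ m : ℤ, x i = ε * (m : ℝ)

/-- The scaled norm `‖(t,x)‖_𝔰 = |t|^{1/𝔰₀} ∨ |x|_∞` for the scaling `𝔰 = (𝔰₀,1,…,1)`. -/
def snormS (d s0 : ℕ) (t : ℝ) (x : Fin d → ℝ) : ℝ := max (|t| ^ ((s0:ℝ)⁻¹)) ‖x‖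

/-- `‖z‖_{𝔰,ε} = ‖z‖_𝔰 ∨ ε`. -/
def snormE (d s0 : ℕ) (ε : ℝ) (t : ℝ) (x : Fin d → ℝ) : ℝ := max (snormS d s0 t x) ε

/-- The discrete spatial derivative `D_{i,ε}` of a space-time function. -/
def dDeriv (d : ℕ) (ε : ℝ) (i : Fin d) (K : ℝ → (Fin d → ℝ) → ℝ) : ℝ → (Fin d → ℝ) → ℝ :=
  fun t x => (K t (fun j => x j + if j = i then ε else 0) - K t x) / ε

/-- The iterated discrete spatial derivative `D_{1,ε}^{k₁} ⋯ D_{d,ε}^{k_d}`. -/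
def dDerivSpace (d : ℕ) (ε : ℝ) (ks : Fin d → ℕ) (K : ℝ → (Fin d → ℝ) → ℝ) :
    ℝ → (Fin d → ℝ) → ℝ :=
  ((List.finRange d).foldr (fun i g => (dDeriv d ε i)^[ks i] ∘ g) id) K

/-- The mixed space-time discrete derivative `D_ε^k = ∂_t^{k₀} D_{1,ε}^{k₁} ⋯ D_{d,ε}^{k_d}`. -/
def dDerivST (d : ℕ) (ε : ℝ) (k0 : ℕ) (ks : Fin d → ℕ) (K : ℝ → (Fin d → ℝ) → ℝ) :
    ℝ → (Fin d → ℝ) → ℝ :=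
  fun t x => iteratedDeriv k0 (fun s => dDerivSpace d ε ks K s x) t

/-- The scaled degree `|k|_𝔰 = 𝔰₀k₀ + k₁ + ⋯ + k_d` of a space-time multi-index. -/
def sAbs (s0 : ℕ) {d : ℕ} (k0 : ℕ) (ks : Fin d → ℕ) : ℕ := s0 * k0 + ∑ i, ks i

/-- `K` is supported in `{z : ‖z‖_𝔰 ≤ R}`. -/
def suppIn (d s0 : ℕ) (R : ℝ) (K : ℝ → (Fin d → ℝ) → ℝ) : Prop :=
  ∀ t : ℝ, ∀ x : Fin d → ℝ, R < snormS d s0 t x → K t x = 0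

/-- `K` is `⌊m/𝔰₀⌋`-times continuously differentiable in the time variable outside of
`P₀ = {(0,x)}`. -/
def timeReg (d s0 : ℕ) (ε : ℝ) (m : ℕ) (K : ℝ → (Fin d → ℝ) → ℝ) : Prop :=
  ∀ x : Fin d → ℝ, onGrid d ε x →
    ContDiffOn ℝ ((m / s0 : ℕ) : ℕ∞) (fun t => K t x) {t : ℝ | t ≠ 0}

/-- `B` is an upper bound for the seminorm `⦀K⦀_{ζ;m}`, i.e.
`|D_ε^k K(z)| ≤ B ‖z‖_{𝔰,ε}^{(ζ−|k|_𝔰)∧0}` for all `|k|_𝔰 ≤ m` and all grid points `z ∉ P₀`. -/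
def normBound (d s0 : ℕ) (ε : ℝ) (ζ : ℝ) (m : ℕ) (K : ℝ → (Fin d → ℝ) → ℝ) (B : ℝ) : Prop :=
  ∀ k0 : ℕ, ∀ ks : Fin d → ℕ, sAbs s0 k0 ks ≤ m →
    ∀ t : ℝ, t ≠ 0 → ∀ x : Fin d → ℝ, onGrid d ε x →
      |dDerivST d ε k0 ks K t x| ≤ B * snormE d s0 ε t x ^ (min (ζ - (sAbs s0 k0 ks : ℝ)) 0)

/-- The discrete space-time convolution `(K₁ ⋆_ε K₂)`. -/
def dConv (d : ℕ) (ε : ℝ) (K₁ K₂ : ℝ → (Fin d → ℝ) → ℝ) : ℝ → (Fin d → ℝ) → ℝ :=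
  fun t x => ∫ s : ℝ, ε^d * ∑' y : Fin d → ℤ,
    K₁ s (fun i => ε * (y i : ℝ)) * K₂ (t - s) (fun i => x i - ε * (y i : ℝ))

/-- The discrete space-time integral `∫_{ℝ×Λ_ε^d} F(z) dz`. -/
def dIntegral (d : ℕ) (ε : ℝ) (F : ℝ → (Fin d → ℝ) → ℝ) : ℝ :=
  ∫ s : ℝ, ε^d * ∑' y : Fin d → ℤ, F s (fun i => ε * (y i : ℝ))

/-- The shift by one grid step `ε` in the spatial direction `i`. -/
def dShift (d : ℕ) (ε : ℝ) (i : Fin d) (K : ℝ → (Fin d → ℝ) → ℝ) : ℝ → (Fin d → ℝ) → ℝ :=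
  fun t x => K t (fun j => x j + if j = i then ε else 0)

section SpatialDerivatives

variable {d : ℕ} {ε : ℝ}

lemma dDeriv_commute (i j : Fin d) : Function.Commute (dDeriv d ε i) (dDeriv d ε j) := by
  intro K
  funext t x
  have h : (fun l => x l + (if l = i then ε else 0) + if l = j then ε else 0)
      = fun l => x l + (if l = j then ε else 0) + if l = i then ε else 0 := by
    funext l
    ring
  simp only [dDeriv, h]
  ring

lemma dShift_commute_dDeriv (i j : Fin d) :
    Function.Commute (dShift d ε i) (dDeriv d ε j) := by
  intro K
  funext t x
  have h : (fun l => x l + (if l = i then ε else 0) + if l = j then ε else 0)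
      = fun l => x l + (if l = j then ε else 0) + if l = i then ε else 0 := by
    funext l
    ring
  simp only [dDeriv, dShift, h]

lemma dDeriv_add (i : Fin d) (K L : ℝ → (Fin d → ℝ) → ℝ) :
    dDeriv d ε i (K + L) = dDeriv d ε i K + dDeriv d ε i L := by
  funext t x
  simp only [dDeriv, Pi.add_apply]
  ring

/-- The discrete Leibniz rule. -/
lemma dDeriv_mul (i : Fin d) (K L : ℝ → (Fin d → ℝ) → ℝ) :
    dDeriv d ε i (K * L) = dDeriv d ε i K * L + dShift d ε i K * dDeriv d ε i L := by
  funext t x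
  simp only [dDeriv, dShift, Pi.add_apply, Pi.mul_apply]
  ring

/-- An operator commuting with all `D_{j,ε}` commutes with their iterated compositions. -/
lemma commute_foldr_dDeriv {T : (ℝ → (Fin d → ℝ) → ℝ) → ℝ → (Fin d → ℝ) → ℝ}
    (hT : ∀ j, Function.Commute T (dDeriv d ε j)) (ks : Fin d → ℕ) (l : List (Fin d)) :
    Function.Commute T (l.foldr (fun i g => (dDeriv d ε i)^[ks i] ∘ g) id) := by
  induction l with
  | nil => exact Function.Commute.id_right
  | cons j l ih => exact ((hT j).iterate_right _).comp_right ih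

lemma foldr_dDeriv_add_single_of_notMem (ks : Fin d → ℕ) (i : Fin d) (l : List (Fin d))
    (hi : i ∉ l) :
    l.foldr (fun j g => (dDeriv d ε j)^[(ks + Pi.single i 1 : Fin d → ℕ) j] ∘ g) id
      = l.foldr (fun j g => (dDeriv d ε j)^[ks j] ∘ g) id := by
  induction l with
  | nil => rfl
  | cons j l ih =>
    simp only [List.mem_cons, not_or] at hi
    rw [List.foldr_cons, ih hi.2, Pi.add_apply, Pi.single_eq_of_ne' hi.1, add_zero,
      List.foldr_cons]

lemma foldr_dDeriv_add_single (ks : Fin d → ℕ) (i : Fin d) (l : List (Fin d))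
    (hl : l.Nodup) (hi : i ∈ l) :
    l.foldr (fun j g => (dDeriv d ε j)^[(ks + Pi.single i 1 : Fin d → ℕ) j] ∘ g) id
      = (l.foldr (fun j g => (dDeriv d ε j)^[ks j] ∘ g) id) ∘ dDeriv d ε i := by
  induction l with
  | nil => simp at hi
  | cons j l ih =>
    rw [List.nodup_cons] at hl
    simp only [List.foldr_cons]
    by_cases hij : i = j
    · subst hij
      rw [foldr_dDeriv_add_single_of_notMem ks i l hl.1, Pi.add_apply, Pi.single_eq_same,
        Function.iterate_succ, Function.comp_assoc, Function.comp_assoc,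
        (commute_foldr_dDeriv (dDeriv_commute i) ks l).comp_eq]
    · rw [ih hl.2 ((List.mem_cons.1 hi).resolve_left hij), Pi.add_apply,
        Pi.single_eq_of_ne' hij, add_zero, Function.comp_assoc]

lemma dDerivSpace_add_single (ks : Fin d → ℕ) (i : Fin d) (K : ℝ → (Fin d → ℝ) → ℝ) :
    dDerivSpace d ε (ks + Pi.single i 1) K = dDerivSpace d ε ks (dDeriv d ε i K) :=
  congrFun (foldr_dDeriv_add_single ks i _ (List.nodup_finRange d) (List.mem_finRange i)) K

lemma dDerivSpace_dShift (ks : Fin d → ℕ) (i : Fin d) (K : ℝ → (Fin d → ℝ) → ℝ) :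
    dDerivSpace d ε ks (dShift d ε i K) = dShift d ε i (dDerivSpace d ε ks K) :=
  (commute_foldr_dDeriv (dShift_commute_dDeriv i) ks _ K).symm

/-- A property stable under all `D_{j,ε}` is stable under `D_ε^k`. -/
lemma dDerivSpace_induction {P : (ℝ → (Fin d → ℝ) → ℝ) → Prop}
    (hP : ∀ j K, P K → P (dDeriv d ε j K)) (ks : Fin d → ℕ) {K : ℝ → (Fin d → ℝ) → ℝ}
    (hK : P K) : P (dDerivSpace d ε ks K) := by
  unfold dDerivSpace
  induction List.finRange d with
  | nil => exact hK
  | cons j l ih => exact Function.Iterate.rec P ih (fun L hL => hP j L hL) (ks j)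

lemma dDerivSpace_zero (K : ℝ → (Fin d → ℝ) → ℝ) : dDerivSpace d ε 0 K = K := by
  unfold dDerivSpace
  induction List.finRange d with
  | nil => rfl
  | cons j l ih => exact ih

lemma dDerivSpace_add (ks : Fin d → ℕ) (K L : ℝ → (Fin d → ℝ) → ℝ) :
    dDerivSpace d ε ks (K + L) = dDerivSpace d ε ks K + dDerivSpace d ε ks L := by
  unfold dDerivSpace
  induction List.finRange d with
  | nil => rfl
  | cons j l ih =>
    have h : ∀ (n : ℕ) (A B : ℝ → (Fin d → ℝ) → ℝ), (dDeriv d ε j)^[n] (A + B)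
        = (dDeriv d ε j)^[n] A + (dDeriv d ε j)^[n] B := by
      intro n
      induction n with
      | zero => exact fun _ _ => rfl
      | succ n ihn => exact fun A B => by simp only [Function.iterate_succ_apply, dDeriv_add, ihn]
    simp only [List.foldr_cons, Function.comp_apply] at ih ⊢
    rw [ih, h]

end SpatialDerivatives

lemma sAbs_add_single {d : ℕ} (s0 k0 : ℕ) (ks : Fin d → ℕ) (i : Fin d) :
    sAbs s0 k0 (ks + Pi.single i 1) = sAbs s0 k0 ks + 1 := by
  simp [sAbs, Finset.sum_add_distrib, add_assoc]

section Regularity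

variable {d s0 m : ℕ} {ε : ℝ} {K L : ℝ → (Fin d → ℝ) → ℝ}

lemma onGrid.shift {x : Fin d → ℝ} (hx : onGrid d ε x) (i : Fin d) :
    onGrid d ε (fun j => x j + if j = i then ε else 0) := by
  intro j
  obtain ⟨n, hn⟩ := hx j
  by_cases h : j = i
  · exact ⟨n + 1, by dsimp only; rw [hn, if_pos h]; push_cast; ring⟩
  · exact ⟨n, by simp [hn, h]⟩

lemma timeReg.mono {m' : ℕ} (hm : m' ≤ m) (hK : timeReg d s0 ε m K) :
    timeReg d s0 ε m' K := fun x hx =>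
  (hK x hx).of_le (by exact_mod_cast Nat.div_le_div_right hm)

lemma timeReg.dShift (hK : timeReg d s0 ε m K) (i : Fin d) :
    timeReg d s0 ε m (dShift d ε i K) := fun _ hx => hK _ (hx.shift i)

lemma timeReg.dDeriv (hK : timeReg d s0 ε m K) (i : Fin d) :
    timeReg d s0 ε m (dDeriv d ε i K) := fun x hx =>
  ((hK _ (hx.shift i)).sub (hK x hx)).div_const ε

lemma timeReg.mul (hK : timeReg d s0 ε m K) (hL : timeReg d s0 ε m L) :
    timeReg d s0 ε m (K * L) := fun x hx => (hK x hx).mul (hL x hx)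

lemma timeReg.contDiffAt (hs0 : 1 ≤ s0) (hK : timeReg d s0 ε m K) {k0 : ℕ}
    (hk : s0 * k0 ≤ m) {t : ℝ} (ht : t ≠ 0) {x : Fin d → ℝ} (hx : onGrid d ε x) :
    ContDiffAt ℝ k0 (fun s => K s x) t := by
  have h := (hK x hx).contDiffAt (isOpen_ne.mem_nhds ht)
  refine h.of_le ?_
  exact_mod_cast (Nat.le_div_iff_mul_le hs0).2 (by rwa [mul_comm])

lemma dDerivST_add (hs0 : 1 ≤ s0) (hK : timeReg d s0 ε m K) (hL : timeReg d s0 ε m L)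
    {k0 : ℕ} (hk : s0 * k0 ≤ m) (ks : Fin d → ℕ) {t : ℝ} (ht : t ≠ 0) {x : Fin d → ℝ}
    (hx : onGrid d ε x) :
    dDerivST d ε k0 ks (K + L) t x = dDerivST d ε k0 ks K t x + dDerivST d ε k0 ks L t x := by
  have hreg : ∀ {M : ℝ → (Fin d → ℝ) → ℝ}, timeReg d s0 ε m M →
      ContDiffAt ℝ k0 (fun s => dDerivSpace d ε ks M s x) t := fun hM =>
    (dDerivSpace_induction (P := timeReg d s0 ε m) (fun j _ h => h.dDeriv j) ks hM).contDiffAt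
      hs0 hk ht hx
  simp only [dDerivST, dDerivSpace_add, Pi.add_apply]
  exact iteratedDeriv_fun_add (hreg hK) (hreg hL)

end Regularity

section Bounds

variable {d s0 m : ℕ} {ε ζ B : ℝ} {K : ℝ → (Fin d → ℝ) → ℝ}

lemma snormE_pos (hε : 0 < ε) (t : ℝ) (x : Fin d → ℝ) : 0 < snormE d s0 ε t x :=
  lt_max_of_lt_right hε

/-- For `ζ ≤ 0` the truncation of the exponent in `normBound` is vacuous. -/
lemma normBound_iff (hζ : ζ ≤ 0) : normBound d s0 ε ζ m K B ↔
    ∀ k0 : ℕ, ∀ ks : Fin d → ℕ, sAbs s0 k0 ks ≤ m →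
      ∀ t : ℝ, t ≠ 0 → ∀ x : Fin d → ℝ, onGrid d ε x →
        |dDerivST d ε k0 ks K t x| ≤ B * snormE d s0 ε t x ^ (ζ - (sAbs s0 k0 ks : ℝ)) := by
  have h : ∀ n : ℕ, min (ζ - (n : ℝ)) 0 = ζ - n := fun n =>
    min_eq_left (by linarith [n.cast_nonneg (α := ℝ)])
  simp only [normBound, h]

lemma normBound.nonneg (hε : 0 < ε) (hK : normBound d s0 ε ζ m K B) : 0 ≤ B := by
  have h := hK 0 0 (by simp [sAbs]) 1 one_ne_zero 0 (fun _ => ⟨0, by simp⟩)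
  exact nonneg_of_mul_nonneg_left ((abs_nonneg _).trans h)
    (Real.rpow_pos_of_pos (snormE_pos hε _ _) _)

lemma normBound.mono {m' : ℕ} (hm : m' ≤ m) (hK : normBound d s0 ε ζ m K B) :
    normBound d s0 ε ζ m' K B := fun k0 ks hk => hK k0 ks (hk.trans hm)

lemma normBound.dDeriv (hζ : ζ ≤ 0) (hK : normBound d s0 ε ζ (m + 1) K B) (i : Fin d) :
    normBound d s0 ε (ζ - 1) m (dDeriv d ε i K) B := by
  rw [normBound_iff (by linarith)]
  rw [normBound_iff hζ] at hK
  intro k0 ks hk t ht x hx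
  have h := hK k0 (ks + Pi.single i 1) (by rw [sAbs_add_single]; lia) t ht x hx
  rw [sAbs_add_single] at h
  simp only [dDerivST, dDerivSpace_add_single] at h ⊢
  convert h using 3
  push_cast
  ring

lemma snormE_le_two_mul_shift (hε : 0 < ε) (t : ℝ) (x : Fin d → ℝ) (i : Fin d) :
    snormE d s0 ε t x ≤ 2 * snormE d s0 ε t (fun j => x j + if j = i then ε else 0) := by
  set y : Fin d → ℝ := fun j => x j + if j = i then ε else 0
  have hpos := snormE_pos (s0 := s0) hε t y
  have h1 : |t| ^ ((s0 : ℝ)⁻¹) ≤ snormE d s0 ε t y := (le_max_left _ _).trans (le_max_left _ _)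
  have h2 : ‖y‖ ≤ snormE d s0 ε t y := (le_max_right _ _).trans (le_max_left _ _)
  have h3 : ε ≤ snormE d s0 ε t y := le_max_right _ _
  have h4 : ‖x‖ ≤ ‖y‖ + ε := by
    refine (pi_norm_le_iff_of_nonneg (by positivity)).2 fun j => ?_
    have hj : x j = y j - if j = i then ε else 0 := by simp [y]
    have he : ‖(if j = i then ε else 0 : ℝ)‖ ≤ ε := by
      split_ifs
      · exact (Real.norm_of_nonneg hε.le).le
      · simpa using hε.le
    rw [hj]
    exact (norm_sub_le _ _).trans (add_le_add (norm_le_pi_norm y j) he)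
  exact max_le (max_le (by linarith) (by linarith)) (by linarith)

lemma normBound.dShift (hε : 0 < ε) (hζ : ζ ≤ 0) (hK : normBound d s0 ε ζ m K B)
    (i : Fin d) : normBound d s0 ε ζ m (dShift d ε i K) ((2 : ℝ) ^ ((m : ℝ) - ζ) * B) := by
  have hB := hK.nonneg hε
  rw [normBound_iff hζ] at hK ⊢
  intro k0 ks hk t ht x hx
  have h := hK k0 ks hk t ht _ (hx.shift i)
  simp only [dDerivST, dDerivSpace_dShift]
  refine h.trans ?_
  set y : Fin d → ℝ := fun j => x j + if j = i then ε else 0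
  set a : ℝ := ζ - (sAbs s0 k0 ks : ℝ)
  have hkm : (sAbs s0 k0 ks : ℝ) ≤ m := by exact_mod_cast hk
  have ha : a ≤ 0 := by
    have : (0 : ℝ) ≤ sAbs s0 k0 ks := Nat.cast_nonneg _
    linarith
  have hx0 := snormE_pos (s0 := s0) hε t x
  have hy0 := snormE_pos (s0 := s0) hε t y
  have h2 : snormE d s0 ε t y ^ a ≤ (2 : ℝ) ^ ((m : ℝ) - ζ) * snormE d s0 ε t x ^ a := by
    calc snormE d s0 ε t y ^ a = (2 : ℝ) ^ (-a) * (2 * snormE d s0 ε t y) ^ a := by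
          rw [Real.mul_rpow two_pos.le hy0.le, ← mul_assoc, ← Real.rpow_add two_pos,
            neg_add_cancel, Real.rpow_zero, one_mul]
      _ ≤ (2 : ℝ) ^ ((m : ℝ) - ζ) * snormE d s0 ε t x ^ a := by
          have hle := Real.rpow_le_rpow_of_nonpos hx0 (snormE_le_two_mul_shift hε t x i) ha
          have hexp : (2 : ℝ) ^ (-a) ≤ (2 : ℝ) ^ ((m : ℝ) - ζ) :=
            Real.rpow_le_rpow_of_exponent_le one_le_two (by linarith)
          exact mul_le_mul hexp hle (by positivity) (by positivity)
  calc B * snormE d s0 ε t y ^ a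
      ≤ B * ((2 : ℝ) ^ ((m : ℝ) - ζ) * snormE d s0 ε t x ^ a) := by gcongr
    _ = _ := by ring

end Bounds

/-- Leibniz bound for pure time derivatives of a product. -/
lemma abs_iteratedDeriv_mul_le {d s0 m : ℕ} {ε ζ₁ ζ₂ B₁ B₂ : ℝ} {K₁ K₂ : ℝ → (Fin d → ℝ) → ℝ}
    (hs0 : 1 ≤ s0) (hε : 0 < ε) (hζ₁ : ζ₁ ≤ 0) (hζ₂ : ζ₂ ≤ 0)
    (hT₁ : timeReg d s0 ε m K₁) (hT₂ : timeReg d s0 ε m K₂)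
    (hK₁ : normBound d s0 ε ζ₁ m K₁ B₁) (hK₂ : normBound d s0 ε ζ₂ m K₂ B₂)
    {k0 : ℕ} (hk : s0 * k0 ≤ m) {t : ℝ} (ht : t ≠ 0) {x : Fin d → ℝ} (hx : onGrid d ε x) :
    |iteratedDeriv k0 (fun s => K₁ s x * K₂ s x) t|
      ≤ 2 ^ m * B₁ * B₂ * snormE d s0 ε t x ^ (ζ₁ + ζ₂ - (s0 * k0 : ℕ)) := by
  have hB₁ := hK₁.nonneg hε
  have hB₂ := hK₂.nonneg hε
  rw [normBound_iff hζ₁] at hK₁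
  rw [normBound_iff hζ₂] at hK₂
  have hpos := snormE_pos (s0 := s0) hε t x
  have hpure : ∀ {ζ B : ℝ} {K : ℝ → (Fin d → ℝ) → ℝ}, (∀ k0 : ℕ, ∀ ks : Fin d → ℕ,
      sAbs s0 k0 ks ≤ m → ∀ t : ℝ, t ≠ 0 → ∀ x : Fin d → ℝ, onGrid d ε x →
        |dDerivST d ε k0 ks K t x| ≤ B * snormE d s0 ε t x ^ (ζ - (sAbs s0 k0 ks : ℝ))) →
      ∀ j ≤ k0, |iteratedDeriv j (fun s => K s x) t|
        ≤ B * snormE d s0 ε t x ^ (ζ - (s0 * j : ℕ)) := by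
    intro ζ B K h j hj
    simpa [sAbs, dDerivST, dDerivSpace_zero] using
      h j 0 (by simpa [sAbs] using (Nat.mul_le_mul_left s0 hj).trans hk) t ht x hx
  rw [iteratedDeriv_fun_mul (hT₁.contDiffAt hs0 hk ht hx) (hT₂.contDiffAt hs0 hk ht hx)]
  set S := snormE d s0 ε t x
  have hterm : ∀ j ∈ Finset.range (k0 + 1),
      |(k0.choose j : ℝ) * iteratedDeriv j (fun s => K₁ s x) t
          * iteratedDeriv (k0 - j) (fun s => K₂ s x) t|
        ≤ k0.choose j * (B₁ * B₂ * S ^ (ζ₁ + ζ₂ - (s0 * k0 : ℕ))) := by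
    intro j hj
    have hj' : j ≤ k0 := Nat.lt_succ_iff.1 (Finset.mem_range.1 hj)
    have h1 := hpure hK₁ j hj'
    have h2 := hpure hK₂ (k0 - j) (Nat.sub_le _ _)
    have hexp : S ^ (ζ₁ + ζ₂ - (s0 * k0 : ℕ))
        = S ^ (ζ₁ - (s0 * j : ℕ)) * S ^ (ζ₂ - (s0 * (k0 - j) : ℕ)) := by
      rw [← Real.rpow_add hpos]
      congr 1
      push_cast [Nat.cast_sub hj']
      ring
    rw [abs_mul, abs_mul, Nat.abs_cast, mul_assoc, hexp]
    refine mul_le_mul_of_nonneg_left ?_ (Nat.cast_nonneg _)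
    calc _ ≤ (B₁ * S ^ (ζ₁ - (s0 * j : ℕ))) * (B₂ * S ^ (ζ₂ - (s0 * (k0 - j) : ℕ))) :=
          mul_le_mul h1 h2 (abs_nonneg _) (by positivity)
      _ = _ := by ring
  have hk0 : k0 ≤ m := (Nat.le_mul_of_pos_left k0 hs0).trans hk
  calc _ ≤ _ := Finset.abs_sum_le_sum_abs _ _
    _ ≤ _ := Finset.sum_le_sum hterm
    _ = 2 ^ k0 * (B₁ * B₂ * S ^ (ζ₁ + ζ₂ - (s0 * k0 : ℕ))) := by
        rw [← Finset.sum_mul]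
        congr 1
        exact_mod_cast Nat.sum_range_choose k0
    _ ≤ 2 ^ m * (B₁ * B₂ * S ^ (ζ₁ + ζ₂ - (s0 * k0 : ℕ))) := by
        gcongr
        exact one_le_two
    _ = _ := by ring

/-- The product bound for an arbitrary mesh size `ε > 0`, without support assumption. -/
lemma exists_normBound_mul (d s0 : ℕ) (hs0 : 1 ≤ s0) (m : ℕ) :
    ∀ ζ₁ ζ₂ : ℝ, ζ₁ ≤ 0 → ζ₂ ≤ 0 → ∃ C : ℝ, 0 < C ∧
      ∀ ε : ℝ, 0 < ε → ∀ K₁ K₂ : ℝ → (Fin d → ℝ) → ℝ, ∀ B₁ B₂ : ℝ,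
        timeReg d s0 ε m K₁ → timeReg d s0 ε m K₂ →
        normBound d s0 ε ζ₁ m K₁ B₁ → normBound d s0 ε ζ₂ m K₂ B₂ →
        normBound d s0 ε (ζ₁ + ζ₂) m (K₁ * K₂) (C * B₁ * B₂) := by
  induction m with
  | zero =>
    intro ζ₁ ζ₂ hζ₁ hζ₂
    refine ⟨2 ^ 0, by positivity, fun ε hε K₁ K₂ B₁ B₂ hT₁ hT₂ hK₁ hK₂ => ?_⟩
    rw [normBound_iff (by linarith)]
    intro k0 ks hk t ht x hx
    obtain rfl : ks = 0 := by
      funext i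
      simp only [sAbs, Nat.le_zero, Nat.add_eq_zero_iff, Finset.sum_eq_zero_iff] at hk
      exact hk.2 i (Finset.mem_univ i)
    simpa [dDerivST, dDerivSpace_zero, sAbs] using
      abs_iteratedDeriv_mul_le hs0 hε hζ₁ hζ₂ hT₁ hT₂ hK₁ hK₂ ((Nat.le_add_right _ _).trans hk)
        ht hx
  | succ m ih =>
    intro ζ₁ ζ₂ hζ₁ hζ₂
    obtain ⟨C₁, hC₁, h₁⟩ := ih (ζ₁ - 1) ζ₂ (by linarith) hζ₂
    obtain ⟨C₂, hC₂, h₂⟩ := ih ζ₁ (ζ₂ - 1) hζ₁ (by linarith)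
    refine ⟨2 ^ (m + 1) + C₁ + C₂ * (2 : ℝ) ^ ((m : ℝ) - ζ₁), by positivity,
      fun ε hε K₁ K₂ B₁ B₂ hT₁ hT₂ hK₁ hK₂ => ?_⟩
    have hB₁ := hK₁.nonneg hε
    have hB₂ := hK₂.nonneg hε
    rw [normBound_iff (by linarith)]
    intro k0 ks hk t ht x hx
    have hk0 : s0 * k0 ≤ m + 1 := (Nat.le_add_right _ _).trans hk
    have hpos := snormE_pos (s0 := s0) hε t x
    by_cases hks : ks = 0
    · subst hks
      have h := abs_iteratedDeriv_mul_le hs0 hε hζ₁ hζ₂ hT₁ hT₂ hK₁ hK₂ hk0 ht hx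
      have hs : sAbs s0 k0 (0 : Fin d → ℕ) = s0 * k0 := by simp [sAbs]
      simp only [dDerivST, dDerivSpace_zero, hs, Pi.mul_apply]
      refine h.trans ?_
      gcongr
      have : 0 < C₂ * (2 : ℝ) ^ ((m : ℝ) - ζ₁) := by positivity
      linarith
    · obtain ⟨i, hi⟩ := Function.ne_iff.1 hks
      obtain ⟨js, rfl⟩ : ∃ js, ks = js + Pi.single i 1 := by
        refine ⟨ks - Pi.single i 1, (tsub_add_cancel_of_le ?_).symm⟩
        intro l
        by_cases hl : l = i
        · subst hl
          simpa [Nat.one_le_iff_ne_zero] using hi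
        · simp [hl]
      rw [sAbs_add_single] at hk ⊢
      have hj : sAbs s0 k0 js ≤ m := Nat.le_of_succ_le_succ hk
      have hT₁' := hT₁.mono (Nat.le_succ m)
      have hT₂' := hT₂.mono (Nat.le_succ m)
      have hD₁ := h₁ ε hε _ _ _ _ (hT₁'.dDeriv i) hT₂' (hK₁.dDeriv hζ₁ i)
        (hK₂.mono (Nat.le_succ m))
      have hD₂ := h₂ ε hε _ _ _ _ (hT₁'.dShift i) (hT₂'.dDeriv i)
        ((hK₁.mono (Nat.le_succ m)).dShift hε hζ₁ i) (hK₂.dDeriv hζ₂ i)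
      rw [normBound_iff (by linarith)] at hD₁ hD₂
      have hD₁ := hD₁ k0 js hj t ht x hx
      have hD₂ := hD₂ k0 js hj t ht x hx
      have hsplit : dDerivST d ε k0 (js + Pi.single i 1) (K₁ * K₂) t x
          = dDerivST d ε k0 js (dDeriv d ε i K₁ * K₂) t x
            + dDerivST d ε k0 js (dShift d ε i K₁ * dDeriv d ε i K₂) t x := by
        rw [← dDerivST_add hs0 ((hT₁'.dDeriv i).mul hT₂') ((hT₁'.dShift i).mul (hT₂'.dDeriv i))
          ((Nat.le_add_right _ _).trans hj) js ht hx, ← dDeriv_mul]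
        simp only [dDerivST, dDerivSpace_add_single]
      have he₁ : ζ₁ - 1 + ζ₂ - (sAbs s0 k0 js : ℝ)
          = ζ₁ + ζ₂ - ((sAbs s0 k0 js + 1 : ℕ) : ℝ) := by
        push_cast
        ring
      have he₂ : ζ₁ + (ζ₂ - 1) - (sAbs s0 k0 js : ℝ)
          = ζ₁ + ζ₂ - ((sAbs s0 k0 js + 1 : ℕ) : ℝ) := by
        push_cast
        ring
      rw [he₁] at hD₁
      rw [he₂] at hD₂
      set P := snormE d s0 ε t x ^ (ζ₁ + ζ₂ - ((sAbs s0 k0 js + 1 : ℕ) : ℝ)) with hP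
      have hP0 : 0 ≤ 2 ^ (m + 1) * B₁ * B₂ * P := by positivity
      rw [hsplit]
      calc _ ≤ _ := abs_add_le _ _
        _ ≤ _ := add_le_add hD₁ hD₂
        _ ≤ _ := by linarith

/-- **Bound on products of discrete singular kernels** (Lemma 7.2(i) in the paper).  For
`ζ₁, ζ₂ ≤ 0`, `m ∈ ℕ` and `R > 0` there is a constant `C`, independent of `ε = 2^{-N}`, such
that `⦀K₁K₂⦀_{ζ₁+ζ₂;m} ≤ C ⦀K₁⦀_{ζ₁;m} ⦀K₂⦀_{ζ₂;m}` for all kernels supported in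
`{‖z‖_𝔰 ≤ R}`. -/
theorem discrete_product_bound (d s0 : ℕ) (hd : 1 ≤ d) (hs0 : 1 ≤ s0)
    (ζ₁ ζ₂ : ℝ) (hζ₁ : ζ₁ ≤ 0) (hζ₂ : ζ₂ ≤ 0) (m : ℕ) (R : ℝ) (hR : 0 < R) :
    ∃ C : ℝ, 0 < C ∧
      ∀ N : ℕ, ∀ K₁ K₂ : ℝ → (Fin d → ℝ) → ℝ, ∀ B₁ B₂ : ℝ,
        suppIn d s0 R K₁ → suppIn d s0 R K₂ →
        timeReg d s0 (meps N) m K₁ → timeReg d s0 (meps N) m K₂ →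
        normBound d s0 (meps N) ζ₁ m K₁ B₁ →
        normBound d s0 (meps N) ζ₂ m K₂ B₂ →
        normBound d s0 (meps N) (ζ₁ + ζ₂) m (fun t x => K₁ t x * K₂ t x) (C * B₁ * B₂) := by
  obtain ⟨C, hC, h⟩ := exists_normBound_mul d s0 hs0 m ζ₁ ζ₂ hζ₁ hζ₂
  exact ⟨C, hC, fun N K₁ K₂ B₁ B₂ _ _ => h (meps N) (zpow_pos two_pos _) K₁ K₂ B₁ B₂⟩
end
end

section
/- Let φ be a scaling function on ℝ^d satisfying a refinement equation with finite set 𝒦 ⊂ Λ_1^d and structure constants (a_k)_{k∈𝒦}. Then for every N ∈ ℕ, every integer 0 ≤ n ≤ N and every x ∈ Λ_n^d, one has 2^{−Nd} Σ_{y∈Λ_N^d} φ_x^{N,n}(y) = 2^{−nd/2} (the sum has finitely many nonzero terms since φ_x^{N,n} is compactly supported). -/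
noncomputable section

open scoped BigOperators

/-- The rescaled and recentred scaling function `φ_x^n(y) = 2^{nd/2} φ(2^n(y−x))`. -/
def scFun (d : ℕ) (φ : (Fin d → ℝ) → ℝ) (n : ℕ) (x : Fin d → ℝ) : (Fin d → ℝ) → ℝ :=
  fun y => Real.sqrt 2 ^ (n * d) * φ (fun i => 2^n * (y i - x i))

/-- `x` belongs to the dyadic grid `Λ_n^d = 2^{-n}ℤ^d`. -/
def onDyadic (d n : ℕ) (x : Fin d → ℝ) : Prop := ∀ i, ∃ m : ℤ, x i = (m : ℝ) / 2^n

/-- The discrete scaling function `φ_x^{N,n}(y) = 2^{Nd/2} ∫ φ_y^N(u) φ_x^n(u) du`. -/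
def discScFun (d : ℕ) (φ : (Fin d → ℝ) → ℝ) (N n : ℕ) (x : Fin d → ℝ) : (Fin d → ℝ) → ℝ :=
  fun y => Real.sqrt 2 ^ (N * d) * ∫ u : Fin d → ℝ, scFun d φ N y u * scFun d φ n x u

open MeasureTheory in
theorem integral_comp_dilation {d : ℕ} (n : ℕ) (x : Fin d → ℝ) (g : (Fin d → ℝ) → ℝ) :
    ∫ u : Fin d → ℝ, g (fun i => 2 ^ n * (u i - x i)) =
      ((2 : ℝ) ^ (n * d))⁻¹ * ∫ u : Fin d → ℝ, g u := by
  have h1 := integral_sub_right_eq_self (μ := (volume : Measure (Fin d → ℝ)))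
    (fun u => g ((2 : ℝ) ^ n • u)) x
  have h2 := Measure.integral_comp_smul (volume : Measure (Fin d → ℝ)) g ((2 : ℝ) ^ n)
  rw [Module.finrank_fin_fun, ← pow_mul, abs_of_pos (by positivity), smul_eq_mul] at h2
  rw [← h2, ← h1]
  rfl

theorem sqrt_two_pow_mul_self (m : ℕ) : Real.sqrt 2 ^ m * Real.sqrt 2 ^ m = (2 : ℝ) ^ m := by
  rw [← mul_pow, Real.mul_self_sqrt (by norm_num)]

section

variable {d : ℕ} {φ : (Fin d → ℝ) → ℝ}

theorem continuous_scFun (hcont : Continuous φ) (n : ℕ) (x : Fin d → ℝ) :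
    Continuous (scFun d φ n x) := by
  unfold scFun
  fun_prop

theorem hasCompactSupport_scFun (hsupp : HasCompactSupport φ) (n : ℕ) (x : Fin d → ℝ) :
    HasCompactSupport (scFun d φ n x) := by
  have h := (hsupp.comp_smul (c := (2 : ℝ) ^ n) (by positivity)).comp_homeomorph
    (Homeomorph.subRight x)
  exact h.mul_left (f := fun _ => Real.sqrt 2 ^ (n * d))

theorem integral_scFun (hint : ∫ x : Fin d → ℝ, φ x = 1) (n : ℕ) (x : Fin d → ℝ) :
    ∫ u : Fin d → ℝ, scFun d φ n x u = (Real.sqrt 2 ^ (n * d))⁻¹ := by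
  unfold scFun
  rw [MeasureTheory.integral_const_mul, integral_comp_dilation, hint,
    ← sqrt_two_pow_mul_self]
  field_simp

theorem integral_scFun_mul_scFun
    (horth : ∀ k : Fin d → ℤ,
      ∫ x : Fin d → ℝ, φ x * φ (fun i => x i + (k i : ℝ)) = if k = 0 then (1 : ℝ) else 0)
    (n : ℕ) (y m : Fin d → ℤ) :
    ∫ u : Fin d → ℝ, scFun d φ n (fun i => (y i : ℝ) / 2 ^ n) u *
        scFun d φ n (fun i => (m i : ℝ) / 2 ^ n) u = if y = m then 1 else 0 := by
  have h := integral_comp_dilation n (fun i => (y i : ℝ) / 2 ^ n)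
    (fun v => φ v * φ (fun i => v i + ((y - m) i : ℤ)))
  rw [horth] at h
  simp only [sub_eq_zero] at h
  have hfun : ∀ u : Fin d → ℝ,
      scFun d φ n (fun i => (y i : ℝ) / 2 ^ n) u * scFun d φ n (fun i => (m i : ℝ) / 2 ^ n) u =
      (2 : ℝ) ^ (n * d) * (φ (fun i => 2 ^ n * (u i - (y i : ℝ) / 2 ^ n)) *
        φ (fun i => 2 ^ n * (u i - (y i : ℝ) / 2 ^ n) + ((y - m) i : ℤ))) := by
    intro u
    have harg : (fun i => 2 ^ n * (u i - (y i : ℝ) / 2 ^ n) + ((y - m) i : ℤ)) =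
        fun i => 2 ^ n * (u i - (m i : ℝ) / 2 ^ n) := by
      funext i
      simp only [Pi.sub_apply, Int.cast_sub]
      field_simp
      ring
    rw [harg, ← sqrt_two_pow_mul_self (n * d)]
    unfold scFun
    ring
  simp_rw [hfun]
  rw [MeasureTheory.integral_const_mul, h, mul_inv_cancel_left₀ (by positivity)]

/-- The refinement equation as a finite sum. -/
theorem scFun_eq_sum {a : (Fin d → ℝ) → ℝ} (hafin : (Function.support a).Finite)
    (href : ∀ n : ℕ, ∀ x : Fin d → ℝ, onDyadic d n x → ∀ y : Fin d → ℝ,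
      scFun d φ n x y =
        ∑' k : Fin d → ℝ, a k * scFun d φ (n+1) (fun i => x i + k i / 2^n) y)
    {n : ℕ} {x : Fin d → ℝ} (hx : onDyadic d n x) (y : Fin d → ℝ) :
    scFun d φ n x y =
      ∑ k ∈ hafin.toFinset, a k * scFun d φ (n+1) (fun i => x i + k i / 2^n) y := by
  rw [href n x hx y]
  refine tsum_eq_sum fun k hk => ?_
  have : a k = 0 := by simpa using hk
  simp [this]

theorem sum_structure_constants (hcont : Continuous φ) (hsupp : HasCompactSupport φ)
    (hint : ∫ x : Fin d → ℝ, φ x = 1)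
    {a : (Fin d → ℝ) → ℝ} (hafin : (Function.support a).Finite)
    (href : ∀ n : ℕ, ∀ x : Fin d → ℝ, onDyadic d n x → ∀ y : Fin d → ℝ,
      scFun d φ n x y =
        ∑' k : Fin d → ℝ, a k * scFun d φ (n+1) (fun i => x i + k i / 2^n) y) :
    ∑ k ∈ hafin.toFinset, a k = Real.sqrt 2 ^ d := by
  have h0 : onDyadic d 0 (0 : Fin d → ℝ) := fun i => ⟨0, by simp⟩
  have h := integral_scFun hint 0 (0 : Fin d → ℝ)
  simp_rw [scFun_eq_sum hafin href h0] at h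
  rw [MeasureTheory.integral_finsetSum _ fun k _ =>
    ((continuous_scFun hcont _ _).integrable_of_hasCompactSupport
      (hasCompactSupport_scFun hsupp _ _)).const_mul _] at h
  simp_rw [MeasureTheory.integral_const_mul, integral_scFun hint] at h
  rw [← Finset.sum_mul] at h
  simp only [zero_add, one_mul, zero_mul, pow_zero, inv_one] at h
  exact eq_of_mul_inv_eq_one h

theorem discScFun_eq_sum (hcont : Continuous φ) (hsupp : HasCompactSupport φ)
    {a : (Fin d → ℝ) → ℝ} (hafin : (Function.support a).Finite)
    (href : ∀ n : ℕ, ∀ x : Fin d → ℝ, onDyadic d n x → ∀ y : Fin d → ℝ,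
      scFun d φ n x y =
        ∑' k : Fin d → ℝ, a k * scFun d φ (n+1) (fun i => x i + k i / 2^n) y)
    (N : ℕ) {n : ℕ} {x : Fin d → ℝ} (hx : onDyadic d n x) (y : Fin d → ℝ) :
    discScFun d φ N n x y =
      ∑ k ∈ hafin.toFinset, a k * discScFun d φ N (n+1) (fun i => x i + k i / 2^n) y := by
  unfold discScFun
  simp_rw [scFun_eq_sum hafin href hx, Finset.mul_sum, mul_left_comm _ (a _)]
  rw [MeasureTheory.integral_finsetSum]
  swap
  · exact fun k _ => (((continuous_scFun hcont _ _).mul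
      (continuous_scFun hcont _ _)).integrable_of_hasCompactSupport
      ((hasCompactSupport_scFun hsupp _ _).mul_left)).const_mul _
  simp_rw [MeasureTheory.integral_const_mul, Finset.mul_sum, mul_left_comm _ (a _)]

theorem onDyadic_add_div {n : ℕ} {x k : Fin d → ℝ} (hx : onDyadic d n x)
    (hk : ∀ i, ∃ m : ℤ, k i = (m : ℝ) / 2) :
    onDyadic d (n+1) (fun i => x i + k i / 2^n) := by
  intro i
  obtain ⟨p, hp⟩ := hx i
  obtain ⟨q, hq⟩ := hk i
  refine ⟨2 * p + q, ?_⟩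
  simp only [hp, hq]
  push_cast
  field_simp
  ring

theorem hasSum_discScFun (hcont : Continuous φ) (hsupp : HasCompactSupport φ)
    (hint : ∫ x : Fin d → ℝ, φ x = 1)
    (horth : ∀ k : Fin d → ℤ,
      ∫ x : Fin d → ℝ, φ x * φ (fun i => x i + (k i : ℝ)) = if k = 0 then (1 : ℝ) else 0)
    {a : (Fin d → ℝ) → ℝ} (hafin : (Function.support a).Finite)
    (hahalf : ∀ k : Fin d → ℝ, a k ≠ 0 → ∀ i, ∃ m : ℤ, k i = (m : ℝ) / 2)
    (href : ∀ n : ℕ, ∀ x : Fin d → ℝ, onDyadic d n x → ∀ y : Fin d → ℝ,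
      scFun d φ n x y =
        ∑' k : Fin d → ℝ, a k * scFun d φ (n+1) (fun i => x i + k i / 2^n) y)
    {N n : ℕ} (hn : n ≤ N) {x : Fin d → ℝ} (hx : onDyadic d n x) :
    HasSum (fun y : Fin d → ℤ => discScFun d φ N n x (fun i => (y i : ℝ) / 2^N))
      ((2 : ℝ) ^ (N * d) * (Real.sqrt 2 ^ (n * d))⁻¹) := by
  induction hn using Nat.decreasingInduction generalizing x with
  | self =>
    choose m hm using hx
    obtain rfl : x = fun i => (m i : ℝ) / 2 ^ N := funext hm
    have h : (2 : ℝ) ^ (N * d) * (Real.sqrt 2 ^ (N * d))⁻¹ = Real.sqrt 2 ^ (N * d) := by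
      rw [← sqrt_two_pow_mul_self]
      field_simp
    simp only [discScFun, integral_scFun_mul_scFun horth, mul_ite, mul_one, mul_zero, h]
    exact hasSum_ite_eq m _
  | of_succ n _ ih =>
    simp_rw [discScFun_eq_sum hcont hsupp hafin href N hx]
    have h := hasSum_sum fun k (hk : k ∈ hafin.toFinset) =>
      (ih (onDyadic_add_div hx (hahalf k (by simpa using hk)))).mul_left (a k)
    rw [← Finset.sum_mul, sum_structure_constants hcont hsupp hint hafin href] at h
    have hpow : Real.sqrt 2 ^ d * ((2 : ℝ) ^ (N * d) * (Real.sqrt 2 ^ ((n + 1) * d))⁻¹) =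
        (2 : ℝ) ^ (N * d) * (Real.sqrt 2 ^ (n * d))⁻¹ := by
      rw [add_mul, one_mul, pow_add, mul_inv]
      field_simp
    rwa [hpow] at h

end

/-- **Total mass of the discrete scaling functions.**  If `φ` is a scaling function on `ℝ^d`
satisfying a refinement equation, then for every `N`, every `0 ≤ n ≤ N` and every `x ∈ Λ_n^d`
one has `2^{−Nd} Σ_{y∈Λ_N^d} φ_x^{N,n}(y) = 2^{−nd/2}`. -/
theorem discrete_scaling_function_mass (d : ℕ) (hd : 1 ≤ d)
    (φ : (Fin d → ℝ) → ℝ) (hcont : Continuous φ) (hsupp : HasCompactSupport φ)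
    (hint : ∫ x : Fin d → ℝ, φ x = 1)
    (horth : ∀ k : Fin d → ℤ,
      ∫ x : Fin d → ℝ, φ x * φ (fun i => x i + (k i : ℝ)) =
        if k = 0 then (1:ℝ) else 0)
    (a : (Fin d → ℝ) → ℝ) (hafin : (Function.support a).Finite)
    (hahalf : ∀ k : Fin d → ℝ, a k ≠ 0 → ∀ i, ∃ m : ℤ, k i = (m : ℝ) / 2)
    (href : ∀ n : ℕ, ∀ x : Fin d → ℝ, onDyadic d n x → ∀ y : Fin d → ℝ,
      scFun d φ n x y =
        ∑' k : Fin d → ℝ, a k * scFun d φ (n+1) (fun i => x i + k i / 2^n) y) :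
    ∀ N n : ℕ, n ≤ N → ∀ x : Fin d → ℝ, onDyadic d n x →
      ((2:ℝ) ^ (N * d))⁻¹ *
          (∑' y : Fin d → ℤ, discScFun d φ N n x (fun i => (y i : ℝ) / 2^N)) =
        (Real.sqrt 2 ^ (n * d))⁻¹ := by
  intro N n hn x hx
  rw [(hasSum_discScFun hcont hsupp hint horth hafin hahalf href hn hx).tsum_eq,
    inv_mul_cancel_left₀ (by positivity)]
end
end

section
/- Let φ be a scaling function on ℝ (d = 1) satisfying a refinement equation with finite set 𝒦 ⊂ Λ_1 and structure constants (a_k)_{k∈𝒦}, and let ψ : ℝ → ℝ be compactly supported and continuous such that ψ_x^n = Σ_{k∈𝒦} b_k φ^{n+1}_{x+2^{-n}k} for some reals (b_k)_{k∈𝒦} (where ψ_x^n(y) := 2^{n/2}ψ(2^n(y−x))), and such that for every n ∈ ℕ the family {φ_x^n : x ∈ Λ_n} ∪ {ψ_x^n : x ∈ Λ_n} is an orthonormal basis of the closed linear span of {φ_x^{n+1} : x ∈ Λ_{n+1}} in L²(ℝ). For N ∈ ℕ, ε := 2^{-N}, define φ_x^{N,n}(y) := 2^{N/2} ∫_ℝ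 φ_y^N(u) φ_x^n(u) du and ψ_x^{N,n}(y) := 2^{N/2} ∫_ℝ φ_y^N(u) ψ_x^n(u) du. Then for every integer 0 ≤ n < N, the family consisting of the restrictions to Λ_ε := εℤ of {φ_x^{N,n} : x ∈ Λ_n} together with {ψ_x^{N,m} : n ≤ m < N, x ∈ Λ_m} forms an orthonormal basis of the Hilbert space ℓ²(Λ_ε) of square-summable functions on Λ_ε equipped with the inner product ⟨f,g⟩_ε := ε Σ_{x∈Λ_ε} f(x)g(x). -/
noncomputable section

open scoped BigOperators

/-- The rescaled and recentred function `h_x^n(y) = 2^{n/2} h(2^n(y−x))` (for `d = 1`). -/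
def scF (h : ℝ → ℝ) (n : ℕ) (x : ℝ) : ℝ → ℝ :=
  fun y => Real.sqrt 2 ^ n * h (2^n * (y - x))

/-- `x` belongs to the dyadic grid `Λ_n = 2^{-n}ℤ`. -/
def onDy (n : ℕ) (x : ℝ) : Prop := ∃ m : ℤ, x = (m : ℝ) / 2^n

/-- The discrete scaling function `φ_x^{N,n}(y) = 2^{N/2} ∫ φ_y^N(u) φ_x^n(u) du`. -/
def discF (φ : ℝ → ℝ) (N n : ℕ) (x : ℝ) : ℝ → ℝ :=
  fun y => Real.sqrt 2 ^ N * ∫ u : ℝ, scF φ N y u * scF φ n x u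

/-- The discrete wavelet function `ψ_x^{N,n}(y) = 2^{N/2} ∫ φ_y^N(u) ψ_x^n(u) du`. -/
def discW (φ ψ : ℝ → ℝ) (N n : ℕ) (x : ℝ) : ℝ → ℝ :=
  fun y => Real.sqrt 2 ^ N * ∫ u : ℝ, scF φ N y u * scF ψ n x u

/-- The point `εq` of the grid `Λ_ε = εℤ`, `ε = 2^{-N}`. -/
def gridE (N : ℕ) (q : ℤ) : ℝ := ((2:ℝ)^N)⁻¹ * (q : ℝ)

open MeasureTheory

/-- The rescaled function `h_x^n` centred at the dyadic point `x = j / 2^n`. -/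
def dyF (h : ℝ → ℝ) (n : ℕ) (j : ℤ) : ℝ → ℝ := scF h n ((j : ℝ) / 2 ^ n)

/-- The linear span of the functions `h_x^n`, `x ∈ Λ_n`. -/
def levelSpan (h : ℝ → ℝ) (n : ℕ) : Submodule ℝ (ℝ → ℝ) :=
  Submodule.span ℝ (Set.range (dyF h n))

theorem dyF_apply (h : ℝ → ℝ) (n : ℕ) (j : ℤ) (y : ℝ) :
    dyF h n j y = Real.sqrt 2 ^ n * h (2 ^ n * y - j) := by
  simp only [dyF, scF]
  congr 2
  field_simp

theorem dyF_mem_levelSpan (h : ℝ → ℝ) (n : ℕ) (j : ℤ) : dyF h n j ∈ levelSpan h n :=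
  Submodule.subset_span ⟨j, rfl⟩

theorem continuous_dyF {h : ℝ → ℝ} (hc : Continuous h) (n : ℕ) (j : ℤ) :
    Continuous (dyF h n j) := by
  unfold dyF scF
  fun_prop

theorem exists_support_bound {h : ℝ → ℝ} (hs : HasCompactSupport h) :
    ∃ R : ℝ, ∀ x, h x ≠ 0 → |x| ≤ R := by
  obtain ⟨R, hR⟩ := hs.isCompact.isBounded.exists_norm_le
  exact ⟨R, fun x hx => hR x (subset_tsupport h hx)⟩

theorem hasCompactSupport_dyF {h : ℝ → ℝ} (hs : HasCompactSupport h) (n : ℕ) (j : ℤ) :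
    HasCompactSupport (dyF h n j) := by
  obtain ⟨R, hR⟩ := exists_support_bound hs
  refine HasCompactSupport.of_support_subset_isCompact
    (isCompact_Icc (a := (j - R) / 2 ^ n) (b := (j + R) / 2 ^ n)) fun x hx => ?_
  rw [Function.mem_support, dyF_apply] at hx
  have := abs_le.1 (hR _ (right_ne_zero_of_mul hx))
  constructor
  · rw [div_le_iff₀ (by positivity)]; linarith
  · rw [le_div_iff₀ (by positivity)]; linarith

/-- A compactly supported function overlaps only finitely many translates at a given level. -/
theorem finite_integral_mul_dyF_ne_zero {g h : ℝ → ℝ} (hg : HasCompactSupport g)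
    (hh : HasCompactSupport h) (n : ℕ) :
    {j : ℤ | (∫ v, g v * dyF h n j v) ≠ 0}.Finite := by
  obtain ⟨R, hR⟩ := exists_support_bound hg
  obtain ⟨S, hS⟩ := exists_support_bound hh
  refine (Set.finite_Icc (-⌈2 ^ n * R + S⌉) ⌈2 ^ n * R + S⌉).subset fun j hj => ?_
  obtain ⟨v, hv⟩ : ∃ v, g v * dyF h n j v ≠ 0 := by
    by_contra! hz
    exact hj (by simp [hz])
  have h1 := abs_le.1 (hR v (left_ne_zero_of_mul hv))
  have h2 := right_ne_zero_of_mul hv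
  rw [dyF_apply] at h2
  have h3 := abs_le.1 (hS _ (right_ne_zero_of_mul h2))
  have h4 : (2 : ℝ) ^ n * v ≤ 2 ^ n * R := by gcongr; exact h1.2
  have h5 : (2 : ℝ) ^ n * (-R) ≤ 2 ^ n * v := by gcongr; exact h1.1
  have h6 := Int.le_ceil ((2 : ℝ) ^ n * R + S)
  constructor
  · rify; linarith
  · rify; linarith

theorem continuous_and_hasCompactSupport_of_mem_levelSpan {h : ℝ → ℝ} (hc : Continuous h)
    (hs : HasCompactSupport h) {n : ℕ} {g : ℝ → ℝ} (hg : g ∈ levelSpan h n) :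
    Continuous g ∧ HasCompactSupport g := by
  induction hg using Submodule.span_induction with
  | mem x hx =>
    obtain ⟨j, rfl⟩ := hx
    exact ⟨continuous_dyF hc n j, hasCompactSupport_dyF hs n j⟩
  | zero => exact ⟨continuous_zero, HasCompactSupport.zero⟩
  | add x y _ _ hx hy => exact ⟨hx.1.add hy.1, hx.2.add hy.2⟩
  | smul r x _ hx => exact ⟨hx.1.const_smul r, hx.2.smul_left (f := fun _ => r)⟩

theorem integrable_mul_dyF {g h : ℝ → ℝ} (hg : Continuous g) (hc : Continuous h)
    (hs : HasCompactSupport h) (n : ℕ) (j : ℤ) : Integrable fun u => g u * dyF h n j u :=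
  (hg.mul (continuous_dyF hc n j)).integrable_of_hasCompactSupport
    (hasCompactSupport_dyF hs n j).mul_left

theorem integral_mul_linearCombination_dyF {g h : ℝ → ℝ} (hg : Continuous g)
    (hc : Continuous h) (hs : HasCompactSupport h) (n : ℕ) (c : ℤ →₀ ℝ) :
    ∫ u, g u * Finsupp.linearCombination ℝ (dyF h n) c u =
      c.sum fun q r => r * ∫ u, g u * dyF h n q u := by
  simp only [Finsupp.linearCombination_apply, Finsupp.sum, Finset.sum_apply, Pi.smul_apply,
    smul_eq_mul, Finset.mul_sum, mul_left_comm (g _)]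
  rw [integral_finsetSum _ fun q _ => (integrable_mul_dyF hg hc hs n q).const_mul _]
  simp only [integral_const_mul]

theorem integral_dyF_mul_dyF {φ : ℝ → ℝ}
    (hφorth : ∀ k : ℤ, ∫ x : ℝ, φ x * φ (x + (k : ℝ)) = if k = 0 then (1:ℝ) else 0)
    (N : ℕ) (p q : ℤ) :
    ∫ u, dyF φ N p u * dyF φ N q u = if p = q then (1:ℝ) else 0 := by
  have h2 : (Real.sqrt 2 ^ N) * (Real.sqrt 2 ^ N) = (2 : ℝ) ^ N := by
    rw [← mul_pow, Real.mul_self_sqrt (by norm_num)]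
  have h3 : ∀ u, dyF φ N p u * dyF φ N q u =
      (2 : ℝ) ^ N * (fun x => φ (x - p) * φ (x - q)) (2 ^ N * u) := fun u => by
    simp only [dyF_apply, ← h2]; ring
  rw [integral_congr_ae (.of_forall h3), integral_const_mul,
    Measure.integral_comp_mul_left (fun x => φ (x - p) * φ (x - q)),
    ← integral_add_right_eq_self (fun x => φ (x - p) * φ (x - q)) (p : ℝ)]
  have h4 := hφorth (p - q)
  push_cast at h4
  simp only [add_sub_cancel_right, add_sub_assoc, h4, sub_eq_zero]
  rw [abs_of_pos (by positivity), smul_eq_mul, mul_inv_cancel_left₀ (by positivity)]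

theorem integral_dyF_mul_linearCombination {φ : ℝ → ℝ} (hc : Continuous φ)
    (hs : HasCompactSupport φ) {N : ℕ}
    (ho : ∀ p q : ℤ, ∫ u, dyF φ N p u * dyF φ N q u = if p = q then (1:ℝ) else 0)
    (q : ℤ) (c : ℤ →₀ ℝ) :
    ∫ u, dyF φ N q u * Finsupp.linearCombination ℝ (dyF φ N) c u = c q := by
  rw [integral_mul_linearCombination_dyF (continuous_dyF hc N q) hc hs]
  simp only [ho, mul_ite, mul_one, mul_zero, Finsupp.sum_ite_eq]
  simpa using Eq.symm

/-- An element of the span at level `N` is the finite combination of the orthonormal functions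
`φ_x^N` whose coefficients are its inner products with them. -/
theorem exists_coeff_of_mem_levelSpan {φ : ℝ → ℝ} (hc : Continuous φ)
    (hs : HasCompactSupport φ) {N : ℕ}
    (ho : ∀ p q : ℤ, ∫ u, dyF φ N p u * dyF φ N q u = if p = q then (1:ℝ) else 0)
    {g : ℝ → ℝ} (hg : g ∈ levelSpan φ N) :
    ∃ c : ℤ →₀ ℝ, Finsupp.linearCombination ℝ (dyF φ N) c = g ∧
      ∀ q, ∫ u, dyF φ N q u * g u = c q := by
  obtain ⟨c, rfl⟩ := (Finsupp.mem_span_range_iff_exists_finsupp).1 hg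
  refine ⟨c, Finsupp.linearCombination_apply .., fun q => ?_⟩
  rw [← Finsupp.linearCombination_apply, integral_dyF_mul_linearCombination hc hs ho]

theorem tsum_integral_mul_integral {φ : ℝ → ℝ} (hc : Continuous φ)
    (hs : HasCompactSupport φ) {N : ℕ}
    (ho : ∀ p q : ℤ, ∫ u, dyF φ N p u * dyF φ N q u = if p = q then (1:ℝ) else 0)
    {g h : ℝ → ℝ} (hg : g ∈ levelSpan φ N) (hh : h ∈ levelSpan φ N) :
    ∑' q : ℤ, (∫ u, dyF φ N q u * g u) * (∫ u, dyF φ N q u * h u) = ∫ u, g u * h u := by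
  obtain ⟨d, rfl, hd⟩ := exists_coeff_of_mem_levelSpan hc hs ho hh
  have hgc := (continuous_and_hasCompactSupport_of_mem_levelSpan hc hs hg).1
  rw [integral_mul_linearCombination_dyF hgc hc hs]
  simp only [hd]
  rw [tsum_eq_sum (s := d.support) fun q hq => by simp [Finsupp.notMem_support_iff.1 hq]]
  refine Finset.sum_congr rfl fun q _ => ?_
  simp only [mul_comm (g _), mul_comm (d q)]

theorem discW_gridE (φ h : ℝ → ℝ) (N n : ℕ) (j q : ℤ) :
    discW φ h N n ((j : ℝ) / 2 ^ n) (gridE N q) =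
      Real.sqrt 2 ^ N * ∫ u, dyF φ N q u * dyF h n j u := by
  have : gridE N q = (q : ℝ) / 2 ^ N := by rw [gridE, div_eq_inv_mul]
  rw [discW, this]
  rfl

theorem summable_discW_sq {φ h : ℝ → ℝ} (hc : Continuous φ)
    (hs : HasCompactSupport φ) {N n : ℕ} {j : ℤ}
    (ho : ∀ p q : ℤ, ∫ u, dyF φ N p u * dyF φ N q u = if p = q then (1:ℝ) else 0)
    (hh : dyF h n j ∈ levelSpan φ N) :
    Summable fun q : ℤ => (discW φ h N n ((j : ℝ) / 2 ^ n) (gridE N q)) ^ 2 := by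
  obtain ⟨c, -, h⟩ := exists_coeff_of_mem_levelSpan hc hs ho hh
  refine summable_of_ne_finset_zero (s := c.support) fun q hq => ?_
  rw [discW_gridE, h, Finsupp.notMem_support_iff.1 hq]
  simp

/-- The discrete inner product of two discretised functions of the span at level `N` is the
`L²(ℝ)` inner product of these functions. -/
theorem tsum_discW_mul_discW {φ g h : ℝ → ℝ} (hc : Continuous φ)
    (hs : HasCompactSupport φ) {N n m : ℕ} {j j' : ℤ}
    (ho : ∀ p q : ℤ, ∫ u, dyF φ N p u * dyF φ N q u = if p = q then (1:ℝ) else 0)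
    (hg : dyF g n j ∈ levelSpan φ N) (hh : dyF h m j' ∈ levelSpan φ N) :
    ((2:ℝ) ^ N)⁻¹ * ∑' q : ℤ, discW φ g N n ((j : ℝ) / 2 ^ n) (gridE N q) *
        discW φ h N m ((j' : ℝ) / 2 ^ m) (gridE N q) =
      ∫ u, dyF g n j u * dyF h m j' u := by
  have h2 : (Real.sqrt 2 ^ N) * (Real.sqrt 2 ^ N) = (2 : ℝ) ^ N := by
    rw [← mul_pow, Real.mul_self_sqrt (by norm_num)]
  simp only [discW_gridE, mul_mul_mul_comm, h2, tsum_mul_left]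
  rw [inv_mul_cancel_left₀ (by positivity), tsum_integral_mul_integral hc hs ho hg hh]

/-- A function whose rescalings are finite combinations of the `φ_x^{n+1}` lies in the span at
level `n + 1`. -/
theorem dyF_mem_levelSpan_succ {φ h : ℝ → ℝ} {a : ℝ → ℝ} (hafin : (Function.support a).Finite)
    (hahalf : ∀ k : ℝ, a k ≠ 0 → ∃ m : ℤ, k = (m : ℝ) / 2)
    (href : ∀ n : ℕ, ∀ x : ℝ, onDy n x → ∀ y : ℝ,
      scF h n x y = ∑' k : ℝ, a k * scF φ (n+1) (x + k / 2^n) y) (n : ℕ) (j : ℤ) :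
    dyF h n j ∈ levelSpan φ (n + 1) := by
  have : dyF h n j = ∑ k ∈ hafin.toFinset,
      a k • scF φ (n + 1) ((j : ℝ) / 2 ^ n + k / 2 ^ n) := by
    ext y
    rw [dyF, href n _ ⟨j, rfl⟩, tsum_eq_sum (s := hafin.toFinset), Finset.sum_apply]
    · rfl
    · intro k hk
      simp_all
  rw [this]
  refine Submodule.sum_mem _ fun k hk => Submodule.smul_mem _ _ ?_
  obtain ⟨m, rfl⟩ := hahalf k (hafin.mem_toFinset.1 hk)
  refine Submodule.subset_span ⟨2 * j + m, ?_⟩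
  rw [dyF]
  congr 1
  push_cast
  field_simp
  ring

theorem levelSpan_mono_of_succ {φ : ℝ → ℝ} (h : ∀ n j, dyF φ n j ∈ levelSpan φ (n + 1)) :
    Monotone (levelSpan φ) :=
  monotone_nat_of_le_succ fun n => Submodule.span_le.2 <| by
    rintro _ ⟨j, rfl⟩
    exact h n j

/-- If `g` satisfies `g = ∑ ⟨g, φ_x^n⟩ φ_x^n + ∑ ⟨g, ψ_x^n⟩ ψ_x^n` and all functions involved are
compactly supported, then both sums are finite. -/
theorem mem_levelSpan_sup_of_expansion {g φ ψ : ℝ → ℝ} (hg : HasCompactSupport g)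
    (hφs : HasCompactSupport φ) (hψs : HasCompactSupport ψ) {n : ℕ}
    (h : ∀ u, g u = (∑' j : ℤ, (∫ v, g v * dyF φ n j v) * dyF φ n j u) +
      ∑' j : ℤ, (∫ v, g v * dyF ψ n j v) * dyF ψ n j u) :
    g ∈ levelSpan φ n ⊔ levelSpan ψ n := by
  have hF := finite_integral_mul_dyF_ne_zero hg hφs n
  have hG := finite_integral_mul_dyF_ne_zero hg hψs n
  have : g = (∑ j ∈ hF.toFinset, (∫ v, g v * dyF φ n j v) • dyF φ n j) +
      ∑ j ∈ hG.toFinset, (∫ v, g v * dyF ψ n j v) • dyF ψ n j := by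
    ext u
    rw [h, tsum_eq_sum (s := hF.toFinset), tsum_eq_sum (s := hG.toFinset), Pi.add_apply,
      Finset.sum_apply, Finset.sum_apply]
    · rfl
    · intro j hj
      rw [Set.Finite.mem_toFinset, Set.notMem_ofPred_iff, not_not] at hj
      rw [hj, zero_mul]
    · intro j hj
      rw [Set.Finite.mem_toFinset, Set.notMem_ofPred_iff, not_not] at hj
      rw [hj, zero_mul]
  rw [this]
  exact Submodule.add_mem_sup
    (Submodule.sum_mem _ fun j _ => Submodule.smul_mem _ _ (dyF_mem_levelSpan φ n j))
    (Submodule.sum_mem _ fun j _ => Submodule.smul_mem _ _ (dyF_mem_levelSpan ψ n j))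

/-- The elements of the span at level `N` on which the functional determined by
`φ_{q / 2^N}^N ↦ f q` vanishes. -/
def annihilated (φ : ℝ → ℝ) (N : ℕ) (f : ℤ → ℝ) : Submodule ℝ (ℝ → ℝ) :=
  (LinearMap.ker (Finsupp.linearCombination ℝ f)).map (Finsupp.linearCombination ℝ (dyF φ N))

theorem dyF_mem_annihilated {φ h : ℝ → ℝ} (hc : Continuous φ)
    (hs : HasCompactSupport φ) {N n : ℕ} {j : ℤ}
    (ho : ∀ p q : ℤ, ∫ u, dyF φ N p u * dyF φ N q u = if p = q then (1:ℝ) else 0)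
    (hh : dyF h n j ∈ levelSpan φ N) {f : ℤ → ℝ}
    (hf : ((2:ℝ) ^ N)⁻¹ * ∑' q : ℤ, f q * discW φ h N n ((j:ℝ) / 2 ^ n) (gridE N q) = 0) :
    dyF h n j ∈ annihilated φ N f := by
  obtain ⟨c, hc', hq⟩ := exists_coeff_of_mem_levelSpan hc hs ho hh
  refine ⟨c, ?_, hc'⟩
  simp only [discW_gridE, hq, mul_left_comm (f _), tsum_mul_left] at hf
  have h0 : ∑' q : ℤ, f q * c q = 0 := by
    simpa using hf
  rw [tsum_eq_sum (s := c.support) fun q hq => by simp [Finsupp.notMem_support_iff.1 hq]] at h0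
  simpa [Finsupp.linearCombination_apply, Finsupp.sum, mul_comm] using h0

theorem eq_zero_of_levelSpan_le_annihilated {φ : ℝ → ℝ} (hc : Continuous φ)
    (hs : HasCompactSupport φ) {N : ℕ}
    (ho : ∀ p q : ℤ, ∫ u, dyF φ N p u * dyF φ N q u = if p = q then (1:ℝ) else 0)
    {f : ℤ → ℝ} (h : levelSpan φ N ≤ annihilated φ N f) : f = 0 := by
  ext q
  obtain ⟨c, hc0, hcq⟩ := h (dyF_mem_levelSpan φ N q)
  have : c = Finsupp.single q 1 := by
    ext p
    rw [← integral_dyF_mul_linearCombination hc hs ho p c, hcq, ho, Finsupp.single_apply]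
    simp only [eq_comm]
  simpa [this] using hc0

/-- **Discrete wavelet basis of `ℓ²(Λ_ε)`** (Proposition 4.12 in the paper, `d = 1`).  For
`0 ≤ n < N`, the restrictions to `Λ_ε = εℤ` of the discrete scaling functions
`φ_x^{N,n}`, `x ∈ Λ_n`, together with the discrete wavelets `ψ_x^{N,m}`, `n ≤ m < N`,
`x ∈ Λ_m`, form an orthonormal basis of `ℓ²(Λ_ε)` with the inner product
`⟨f,g⟩_ε = ε Σ_{x∈Λ_ε} f(x)g(x)`: they lie in `ℓ²`, are orthonormal, and any `ℓ²` function
orthogonal to all of them vanishes. -/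
theorem discrete_wavelet_basis
    (φ : ℝ → ℝ) (hφc : Continuous φ) (hφs : HasCompactSupport φ)
    (hφint : ∫ x : ℝ, φ x = 1)
    (hφorth : ∀ k : ℤ, ∫ x : ℝ, φ x * φ (x + (k : ℝ)) = if k = 0 then (1:ℝ) else 0)
    (a : ℝ → ℝ) (hafin : (Function.support a).Finite)
    (hahalf : ∀ k : ℝ, a k ≠ 0 → ∃ m : ℤ, k = (m : ℝ) / 2)
    (href : ∀ n : ℕ, ∀ x : ℝ, onDy n x → ∀ y : ℝ,
      scF φ n x y = ∑' k : ℝ, a k * scF φ (n+1) (x + k / 2^n) y)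
    (ψ : ℝ → ℝ) (hψc : Continuous ψ) (hψs : HasCompactSupport ψ)
    (b : ℝ → ℝ) (hbfin : (Function.support b).Finite)
    (hbhalf : ∀ k : ℝ, b k ≠ 0 → ∃ m : ℤ, k = (m : ℝ) / 2)
    (hwav : ∀ n : ℕ, ∀ x : ℝ, onDy n x → ∀ y : ℝ,
      scF ψ n x y = ∑' k : ℝ, b k * scF φ (n+1) (x + k / 2^n) y)
    (hψψ : ∀ n : ℕ, ∀ x y : ℝ, onDy n x → onDy n y →
      (∫ u : ℝ, scF ψ n x u * scF ψ n y u) = if x = y then (1:ℝ) else 0)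
    (hφψ : ∀ n : ℕ, ∀ x y : ℝ, onDy n x → onDy n y →
      (∫ u : ℝ, scF φ n x u * scF ψ n y u) = 0)
    (hcompl : ∀ n : ℕ, ∀ x : ℝ, onDy (n+1) x → ∀ u : ℝ,
      scF φ (n+1) x u =
        (∑' j : ℤ, (∫ v : ℝ, scF φ (n+1) x v * scF φ n ((j:ℝ)/2^n) v) *
            scF φ n ((j:ℝ)/2^n) u) +
          ∑' j : ℤ, (∫ v : ℝ, scF φ (n+1) x v * scF ψ n ((j:ℝ)/2^n) v) *
            scF ψ n ((j:ℝ)/2^n) u) :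
    ∀ N n : ℕ, n < N →
      -- the basis functions belong to `ℓ²(Λ_ε)`
      ((∀ j : ℤ, Summable (fun q : ℤ => (discF φ N n ((j:ℝ)/2^n) (gridE N q))^2)) ∧
       (∀ m : ℕ, n ≤ m → m < N → ∀ j : ℤ,
          Summable (fun q : ℤ => (discW φ ψ N m ((j:ℝ)/2^m) (gridE N q))^2))) ∧
      -- orthonormality
      ((∀ j j' : ℤ,
          ((2:ℝ)^N)⁻¹ * ∑' q : ℤ,
              discF φ N n ((j:ℝ)/2^n) (gridE N q) * discF φ N n ((j':ℝ)/2^n) (gridE N q) =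
            if j = j' then (1:ℝ) else 0) ∧
       (∀ j : ℤ, ∀ m : ℕ, n ≤ m → m < N → ∀ j' : ℤ,
          ((2:ℝ)^N)⁻¹ * ∑' q : ℤ,
              discF φ N n ((j:ℝ)/2^n) (gridE N q) * discW φ ψ N m ((j':ℝ)/2^m) (gridE N q) = 0) ∧
       (∀ m m' : ℕ, n ≤ m → m < N → n ≤ m' → m' < N → ∀ j j' : ℤ,
          ((2:ℝ)^N)⁻¹ * ∑' q : ℤ,
              discW φ ψ N m ((j:ℝ)/2^m) (gridE N q) *
                discW φ ψ N m' ((j':ℝ)/2^m') (gridE N q) =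
            if m = m' ∧ j = j' then (1:ℝ) else 0)) ∧
      -- completeness
      (∀ f : ℤ → ℝ, Summable (fun q : ℤ => (f q)^2) →
        (∀ j : ℤ, ((2:ℝ)^N)⁻¹ * ∑' q : ℤ, f q * discF φ N n ((j:ℝ)/2^n) (gridE N q) = 0) →
        (∀ m : ℕ, n ≤ m → m < N → ∀ j : ℤ,
          ((2:ℝ)^N)⁻¹ * ∑' q : ℤ, f q * discW φ ψ N m ((j:ℝ)/2^m) (gridE N q) = 0) →
        f = 0) := by
  have ho := integral_dyF_mul_dyF hφorth
  have hφsucc := dyF_mem_levelSpan_succ hafin hahalf href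
  have hψsucc := dyF_mem_levelSpan_succ hbfin hbhalf hwav
  have hmono := levelSpan_mono_of_succ hφsucc
  have hφψ_level : ∀ (m : ℕ) (j : ℤ), ∀ g ∈ levelSpan φ m, ∫ u, g u * dyF ψ m j u = 0 := by
    intro m j g hg
    obtain ⟨c, rfl⟩ := (Finsupp.mem_span_range_iff_exists_finsupp).1 hg
    simp only [mul_comm _ (dyF ψ m j _), ← Finsupp.linearCombination_apply]
    rw [integral_mul_linearCombination_dyF (continuous_dyF hψc m j) hφc hφs]
    refine Finset.sum_eq_zero fun q _ => ?_
    simp only [mul_comm (dyF ψ m j _)]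
    exact mul_eq_zero_of_right _ (hφψ m _ _ ⟨q, rfl⟩ ⟨j, rfl⟩)
  intro N n hnN
  have hφN (j : ℤ) : dyF φ n j ∈ levelSpan φ N := hmono hnN.le (dyF_mem_levelSpan φ n j)
  have hψN {m : ℕ} (hm : m < N) (j : ℤ) : dyF ψ m j ∈ levelSpan φ N := hmono hm (hψsucc m j)
  refine ⟨⟨fun j => summable_discW_sq hφc hφs (ho N) (hφN j),
    fun m _ hm j => summable_discW_sq hφc hφs (ho N) (hψN hm j)⟩, ⟨?_, ?_, ?_⟩, ?_⟩
  · intro j j'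
    exact (tsum_discW_mul_discW hφc hφs (ho N) (hφN j) (hφN j')).trans (ho n j j')
  · intro j m hnm hm j'
    exact (tsum_discW_mul_discW hφc hφs (ho N) (hφN j) (hψN hm j')).trans
      (hφψ_level m j' _ (hmono hnm (dyF_mem_levelSpan φ n j)))
  · intro m m' _ hm _ hm' j j'
    rw [tsum_discW_mul_discW hφc hφs (ho N) (hψN hm j) (hψN hm' j')]
    rcases lt_trichotomy m m' with hlt | rfl | hlt
    · rw [hφψ_level m' j' _ (hmono hlt (hψsucc m j)), if_neg fun h => hlt.ne h.1]
    · refine (hψψ m _ _ ⟨j, rfl⟩ ⟨j', rfl⟩).trans ?_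
      have : (j : ℝ) / 2 ^ m = (j' : ℝ) / 2 ^ m ↔ j = j' := by
        rw [div_left_inj' (by positivity), Int.cast_inj]
      simp [this]
    · simp only [mul_comm (dyF ψ m j _)]
      rw [hφψ_level m j _ (hmono hlt (hψsucc m' j')), if_neg fun h => hlt.ne' h.1]
  · intro f _ hfφ hfψ
    refine eq_zero_of_levelSpan_le_annihilated hφc hφs (ho N) ?_
    suffices ∀ m, n ≤ m → m ≤ N → levelSpan φ m ≤ annihilated φ N f from this N hnN.le le_rfl
    intro m hnm
    induction m, hnm using Nat.le_induction with
    | base =>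
      rintro -
      refine Submodule.span_le.2 ?_
      rintro _ ⟨j, rfl⟩
      exact dyF_mem_annihilated hφc hφs (ho N) (hφN j) (hfφ j)
    | succ m hnm ih =>
      intro hm
      have hψ : levelSpan ψ m ≤ annihilated φ N f := by
        refine Submodule.span_le.2 ?_
        rintro _ ⟨j, rfl⟩
        exact dyF_mem_annihilated hφc hφs (ho N) (hψN hm j) (hfψ m hnm hm j)
      refine Submodule.span_le.2 ?_
      rintro _ ⟨j, rfl⟩
      exact sup_le (ih (Nat.le_of_succ_le hm)) hψ <| mem_levelSpan_sup_of_expansion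
        (hasCompactSupport_dyF hφs (m + 1) j) hφs hψs (hcompl m _ ⟨j, rfl⟩)
end
end
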